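/- Let B₁(0) ⊂ ℝ² be the open unit disk, x₀ ∈ ∂B₁(0), α ∈ (0,1/2), and fix constants b, C > 0, A > 0, s ∈ (1/2, 1], ε > 0. Then there exists a constant c = c(b, C, A, s, ε, α, x₀) such that: for every pair (u, V) with V : closure(B₁(0)) → ℝ satisfying 0 ≤ V ≤ b and |V(x) − V(y)| ≤ A|x−y|^s for all x,y, and u ∈ C²(B₁(0)) ∩ C¹(closure(B₁(0))) solving −Δu(x) = |x−x₀|^{−2α} V(x) e^{u(x)} in B₁(0), u = 0 on ∂B₁(0), with ∫_{B₁(0)} |x−x₀|^{−2α} e^{u(x)} dx ≤ C and ∫_{B₁(0)} |x−x₀|^{−2α} V(x) e^{u(x)} dx ≤ 16π − ε, one has sup_{B₁(0)} u ≤ c. -/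

import Mathlib

open MeasureTheory Metric Filter

/-- The Laplacian on `ℂ ≅ ℝ²`: sum of the two second partial derivatives. -/
noncomputable def lap (u : ℂ → ℝ) (x : ℂ) : ℝ :=
  fderiv ℝ (fun y => fderiv ℝ u y 1) x 1 +
  fderiv ℝ (fun y => fderiv ℝ u y Complex.I) x Complex.I

/-- `u` is a classical solution of problem (P) on the unit disk:
`u ∈ C²(B₁(0)) ∩ C¹(closure B₁(0))`, `-Δu = |x-x₀|^{-2α} V e^u` in `B₁(0)`, `u = 0` on `∂B₁(0)`. -/
def IsSol (α : ℝ) (x₀ : ℂ) (V u : ℂ → ℝ) : Prop :=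
  ContDiffOn ℝ 2 u (ball 0 1) ∧ ContDiffOn ℝ 1 u (closedBall 0 1) ∧
  (∀ x ∈ ball (0:ℂ) 1, -lap u x = ‖x - x₀‖ ^ (-(2*α)) * V x * Real.exp (u x)) ∧
  (∀ x ∈ sphere (0:ℂ) 1, u x = 0)

open Set Topology ComplexConjugate

lemma contDiffAt_fderiv_apply {u : ℂ → ℝ} {x : ℂ} (hu : ContDiffAt ℝ 2 u x) (v : ℂ) :
    ContDiffAt ℝ 1 (fun y => fderiv ℝ u y v) x :=
  (hu.fderiv_right (m := 1) (by norm_num)).clm_apply contDiffAt_const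

/-- The product rule behind Green's second identity. -/
lemma fderiv_wronskian {h H : ℂ → ℝ} {w : ℂ} (hh : ContDiffAt ℝ 2 h w) (hH : ContDiffAt ℝ 2 H w)
    (v : ℂ) :
    fderiv ℝ (fun y => H y * fderiv ℝ h y v - h y * fderiv ℝ H y v) w v =
      H w * fderiv ℝ (fun y => fderiv ℝ h y v) w v
        - h w * fderiv ℝ (fun y => fderiv ℝ H y v) w v := by
  have h1 := (contDiffAt_fderiv_apply hh v).differentiableAt (by norm_num)
  have h2 := (contDiffAt_fderiv_apply hH v).differentiableAt (by norm_num)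
  have h3 := hh.differentiableAt (by norm_num)
  have h4 := hH.differentiableAt (by norm_num)
  rw [fderiv_fun_sub (h4.fun_mul h1) (h3.fun_mul h2), fderiv_fun_mul h4 h1, fderiv_fun_mul h3 h2]
  simp only [sub_apply, add_apply,
    smul_apply, smul_eq_mul]
  ring

/-- Green's second identity on a period rectangle of the left half plane. -/
lemma green_rectangle {h H : ℂ → ℝ} (hh : ∀ w : ℂ, w.re < 0 → ContDiffAt ℝ 2 h w)
    (hH : ∀ w : ℂ, w.re < 0 → ContDiffAt ℝ 2 H w)
    (hper : ∀ w, h (w + 2 * Real.pi * Complex.I) = h w)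
    (Hper : ∀ w, H (w + 2 * Real.pi * Complex.I) = H w)
    {S T : ℝ} (hST : S ≤ T) (hT : T < 0) :
    ∫ s in S..T, ∫ θ in (-Real.pi)..Real.pi,
        (H (s + θ * Complex.I) * lap h (s + θ * Complex.I)
          - h (s + θ * Complex.I) * lap H (s + θ * Complex.I)) =
      (∫ θ in (-Real.pi)..Real.pi, (H (T + θ * Complex.I) * fderiv ℝ h (T + θ * Complex.I) 1
          - h (T + θ * Complex.I) * fderiv ℝ H (T + θ * Complex.I) 1)) -
      ∫ θ in (-Real.pi)..Real.pi, (H (S + θ * Complex.I) * fderiv ℝ h (S + θ * Complex.I) 1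
          - h (S + θ * Complex.I) * fderiv ℝ H (S + θ * Complex.I) 1) := by
  set φ : ℂ → ℂ → ℝ := fun v y => H y * fderiv ℝ h y v - h y * fderiv ℝ H y v with hφ
  have hφd : ∀ v w : ℂ, w.re < 0 → ContDiffAt ℝ 1 (φ v) w := fun v w hw =>
    (((hH w hw).of_le (by norm_num)).mul (contDiffAt_fderiv_apply (hh w hw) v)).sub
      (((hh w hw).of_le (by norm_num)).mul (contDiffAt_fderiv_apply (hH w hw) v))
  let L : ℝ × ℝ →L[ℝ] ℂ := (Complex.equivRealProdCLM.symm : (ℝ × ℝ) ≃L[ℝ] ℂ)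
  have hL : ∀ p : ℝ × ℝ, L p = p.1 + p.2 * Complex.I := fun p =>
    Complex.equivRealProdCLM_symm_apply p
  have hre : ∀ p : ℝ × ℝ, (L p).re = p.1 := fun p => by simp [hL]
  have hrect : ∀ p ∈ uIcc S T ×ˢ uIcc (-Real.pi) Real.pi, (L p).re < 0 := by
    rintro p ⟨hp, -⟩
    rw [hre]; rw [uIcc_of_le hST] at hp; exact lt_of_le_of_lt hp.2 hT
  have hcd : ∀ v : ℂ, ∀ p : ℝ × ℝ, (L p).re < 0 → ContDiffAt ℝ 1 (fun p => φ v (L p)) p :=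
    fun v p hp => (hφd v _ hp).comp p L.contDiff.contDiffAt
  have hfd : ∀ v : ℂ, ∀ p : ℝ × ℝ, (L p).re < 0 →
      HasFDerivAt (fun p => φ v (L p)) ((fderiv ℝ (φ v) (L p)).comp L) p :=
    fun v p hp => ((hφd v _ hp).differentiableAt (by norm_num)).hasFDerivAt.comp p L.hasFDerivAt
  have hcont : ∀ v : ℂ, ContinuousOn (fun p => φ v (L p)) (uIcc S T ×ˢ uIcc (-Real.pi) Real.pi) :=
    fun v p hp => (hcd v p (hrect p hp)).continuousAt.continuousWithinAt
  have hsub : ∀ p ∈ Ioo (min S T) (max S T) ×ˢ Ioo (min (-Real.pi) Real.pi)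
      (max (-Real.pi) Real.pi) \ (∅ : Set (ℝ × ℝ)), (L p).re < 0 := by
    rintro p ⟨⟨hp, -⟩, -⟩
    rw [hre]; rw [max_eq_right hST] at hp; exact hp.2.trans hT
  have hcf : ∀ v e : ℂ, ContinuousOn (fun p : ℝ × ℝ => fderiv ℝ (φ v) (L p) e)
      (uIcc S T ×ˢ uIcc (-Real.pi) Real.pi) := by
    intro v e p hp
    have := ((hφd v _ (hrect p hp)).fderiv_right (m := 0) (by norm_num)).clm_apply
      (contDiffAt_const (c := e))
    exact (this.continuousAt.comp (f := fun p => L p) L.continuous.continuousAt).continuousWithinAt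
  have hL1 : L (1, 0) = 1 := by simp [hL]
  have hL2 : L (0, 1) = Complex.I := by simp [hL]
  have key := integral2_divergence_prod_of_hasFDerivAt_off_countable
    (fun p => φ 1 (L p)) (fun p => φ Complex.I (L p))
    (fun p => (fderiv ℝ (φ 1) (L p)).comp L) (fun p => (fderiv ℝ (φ Complex.I) (L p)).comp L)
    S (-Real.pi) T Real.pi ∅ countable_empty (hcont 1) (hcont Complex.I)
    (fun p hp => hfd 1 p (hsub p hp)) (fun p hp => hfd Complex.I p (hsub p hp)) (by
      simp only [ContinuousLinearMap.comp_apply, hL1, hL2]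
      exact ((hcf 1 1).add (hcf Complex.I Complex.I)).integrableOn_compact
        (isCompact_uIcc.prod isCompact_uIcc))
  simp only [ContinuousLinearMap.comp_apply, hL1, hL2, hL] at key
  have hperφ : ∀ w, φ Complex.I (w + 2 * Real.pi * Complex.I) = φ Complex.I w := by
    have e1 : ∀ {g : ℂ → ℝ}, (∀ w, g (w + 2 * Real.pi * Complex.I) = g w) → ∀ w,
        fderiv ℝ g (w + 2 * Real.pi * Complex.I) = fderiv ℝ g w := by
      intro g hg w
      rw [← fderiv_comp_add_right]
      congr 1; funext w; exact hg w
    intro w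
    simp only [hφ, hper, Hper, e1 hper, e1 Hper]
  have hcancel : (∫ x in S..T, φ Complex.I (x + (Real.pi : ℝ) * Complex.I)) =
      ∫ x in S..T, φ Complex.I (x + ((-Real.pi : ℝ) : ℂ) * Complex.I) := by
    congr 1; funext x
    rw [← hperφ (x + ((-Real.pi : ℝ) : ℂ) * Complex.I)]; congr 1; push_cast; ring
  rw [hcancel, sub_self, zero_add] at key
  rw [← key]
  refine intervalIntegral.integral_congr fun s hs => intervalIntegral.integral_congr fun θ _ => ?_
  have hs0 : (s + θ * Complex.I : ℂ).re < 0 := by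
    rw [uIcc_of_le hST] at hs; simpa using lt_of_le_of_lt hs.2 hT
  simp only [hφ, fderiv_wronskian (hh _ hs0) (hH _ hs0), lap]
  ring

/-- Conformal covariance of the Laplacian. -/
lemma lap_comp_of_hasDerivAt {u : ℂ → ℝ} {F F' : ℂ → ℂ} {F'' w : ℂ}
    (hu : ContDiffAt ℝ 2 u (F w)) (hF : ∀ᶠ y in 𝓝 w, HasDerivAt F (F' y) y)
    (hF' : HasDerivAt F' F'' w) :
    lap (fun y => u (F y)) w = ‖F' w‖ ^ 2 * lap u (F w) := by
  have hFw : HasDerivAt F (F' w) w := hF.self_of_nhds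
  have hev : ∀ᶠ y in 𝓝 w, ContDiffAt ℝ 2 u (F y) :=
    hFw.continuousAt.eventually (hu.eventually (by simp))
  have hD1 : ∀ v : ℂ, (fun y => fderiv ℝ (fun y => u (F y)) y v) =ᶠ[𝓝 w]
      fun y => fderiv ℝ u (F y) (F' y * v) := by
    intro v
    filter_upwards [hev, hF] with y hy hFy
    have h1 := (hy.differentiableAt (by norm_num)).hasFDerivAt.comp y
      (hFy.hasFDerivAt.restrictScalars ℝ)
    have h2 : fderiv ℝ (fun y => u (F y)) y = _ := h1.fderiv
    rw [h2]
    simp [mul_comm]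
  have hdu : HasFDerivAt (fderiv ℝ u) (fderiv ℝ (fderiv ℝ u) (F w)) (F w) :=
    ((hu.fderiv_right (m := 1) (by norm_num)).differentiableAt (by norm_num)).hasFDerivAt
  have hD2 : ∀ v : ℂ, fderiv ℝ (fun y => fderiv ℝ (fun y => u (F y)) y v) w v =
      fderiv ℝ (fderiv ℝ u) (F w) (F' w * v) (F' w * v) + fderiv ℝ u (F w) (F'' * v * v) := by
    intro v
    rw [(hD1 v).fderiv_eq]
    have h1 : HasFDerivAt (fun y => fderiv ℝ u (F y)) _ w :=
      hdu.comp w (hFw.hasFDerivAt.restrictScalars ℝ)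
    have h2 : HasFDerivAt (fun y => F' y * v) _ w :=
      (hF'.mul_const v).hasFDerivAt.restrictScalars ℝ
    have h3 := h1.clm_apply h2
    rw [h3.fderiv]
    simp [mul_comm, mul_left_comm]
    ring
  have hlap : ∀ v : ℂ, fderiv ℝ (fun y => fderiv ℝ u y v) (F w) v =
      fderiv ℝ (fderiv ℝ u) (F w) v v := by
    intro v
    have := hdu.clm_apply (hasFDerivAt_const v (F w))
    rw [this.fderiv]; simp
  rw [lap, hD2, hD2, lap, hlap, hlap]
  set B := fderiv ℝ (fderiv ℝ u) (F w)
  set a := (F' w).re with ha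
  set b := (F' w).im with hb
  have e1 : F' w * 1 = a • (1 : ℂ) + b • Complex.I := by
    simp [ha, hb, Complex.re_add_im]
  have e2 : F' w * Complex.I = a • Complex.I - b • (1 : ℂ) := by
    apply Complex.ext <;> simp [ha, hb]
  have e3 : F'' * Complex.I * Complex.I = -(F'' * 1 * 1) := by
    rw [mul_assoc, Complex.I_mul_I]; ring
  have e4 : ‖F' w‖ ^ 2 = a ^ 2 + b ^ 2 := by
    rw [← Complex.normSq_eq_norm_sq, Complex.normSq_apply]; ring
  rw [e1, e2, e3, e4]
  simp only [map_add, map_sub, map_smul, map_neg, add_apply,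
    sub_apply, smul_apply, smul_eq_mul]
  ring

lemma abs_det_mulRight (c : ℂ) :
    |((ContinuousLinearMap.toSpanSingleton ℂ c).restrictScalars ℝ : ℂ →L[ℝ] ℂ).det| = ‖c‖ ^ 2 := by
  have h1 : (((ContinuousLinearMap.toSpanSingleton ℂ c).restrictScalars ℝ : ℂ →L[ℝ] ℂ) :
      ℂ →ₗ[ℝ] ℂ) = LinearMap.mul ℝ ℂ c := by
    ext; simp [mul_comm]
  have h2 : LinearMap.det (LinearMap.mul ℝ ℂ c) = Complex.normSq c := by
    rw [← Algebra.norm_complex_apply, Algebra.norm_apply]; rfl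
  rw [ContinuousLinearMap.det, h1, h2, Complex.normSq_eq_norm_sq, abs_of_nonneg (by positivity)]

section conformal

variable {s : Set ℂ} {F F' : ℂ → ℂ}

lemma integral_image_conformal (hs : MeasurableSet s)
    (hF : ∀ w ∈ s, HasDerivAt F (F' w) w) (hinj : InjOn F s) (g : ℂ → ℝ) :
    ∫ y in F '' s, g y = ∫ w in s, ‖F' w‖ ^ 2 * g (F w) := by
  have := integral_image_eq_integral_abs_det_fderiv_smul volume hs
    (fun w hw => ((hF w hw).hasFDerivAt.restrictScalars ℝ).hasFDerivWithinAt) hinj g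
  rw [this]
  refine setIntegral_congr_fun hs fun w _ => ?_
  simp only [abs_det_mulRight, smul_eq_mul]

lemma integrableOn_image_conformal (hs : MeasurableSet s)
    (hF : ∀ w ∈ s, HasDerivAt F (F' w) w) (hinj : InjOn F s) (g : ℂ → ℝ) :
    IntegrableOn g (F '' s) ↔ IntegrableOn (fun w => ‖F' w‖ ^ 2 * g (F w)) s := by
  have := integrableOn_image_iff_integrableOn_abs_det_fderiv_smul volume hs
    (fun w hw => ((hF w hw).hasFDerivAt.restrictScalars ℝ).hasFDerivWithinAt) hinj g
  simpa only [abs_det_mulRight, smul_eq_mul] using this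

end conformal

/-- The period strip of the exponential over the punctured unit disk. -/
def expStrip : Set ℂ := {w | w.re < 0 ∧ -Real.pi < w.im ∧ w.im ≤ Real.pi}

lemma measurableSet_expStrip : MeasurableSet expStrip :=
  (measurableSet_lt Complex.measurable_re measurable_const).inter
    ((measurableSet_lt measurable_const Complex.measurable_im).inter
      (measurableSet_le Complex.measurable_im measurable_const))

lemma injOn_exp_expStrip : InjOn Complex.exp expStrip := fun _ hx _ hy h =>
  Complex.exp_inj_of_neg_pi_lt_of_le_pi hx.2.1 hx.2.2 hy.2.1 hy.2.2 h

lemma image_exp_expStrip : Complex.exp '' expStrip = ball 0 1 \ {0} := by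
  ext z
  simp only [mem_image, Set.mem_sdiff, mem_ball_zero_iff, mem_singleton_iff]
  constructor
  · rintro ⟨w, hw, rfl⟩
    refine ⟨?_, Complex.exp_ne_zero w⟩
    rw [Complex.norm_exp, Real.exp_lt_one_iff]; exact hw.1
  · rintro ⟨hz, hz0⟩
    refine ⟨Complex.log z, ⟨?_, ?_, ?_⟩, Complex.exp_log hz0⟩
    · rw [Complex.log_re]; exact Real.log_neg (norm_pos_iff.2 hz0) hz
    · exact Complex.neg_pi_lt_log_im z
    · exact Complex.log_im_le_pi z

lemma setIntegral_ball_eq_expStrip (g : ℂ → ℝ) :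
    ∫ y in ball (0 : ℂ) 1, g y =
      ∫ w in expStrip, ‖Complex.exp w‖ ^ 2 * g (Complex.exp w) := by
  rw [← integral_image_conformal measurableSet_expStrip
    (fun w _ => Complex.hasDerivAt_exp w) injOn_exp_expStrip, image_exp_expStrip,
    setIntegral_congr_set (sdiff_null_ae_eq_self (measure_singleton 0))]

lemma integrableOn_ball_iff_expStrip (g : ℂ → ℝ) :
    IntegrableOn g (ball (0 : ℂ) 1) ↔
      IntegrableOn (fun w => ‖Complex.exp w‖ ^ 2 * g (Complex.exp w)) expStrip := by
  rw [← integrableOn_image_conformal measurableSet_expStrip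
    (fun w _ => Complex.hasDerivAt_exp w) injOn_exp_expStrip, image_exp_expStrip]
  exact (integrableOn_congr_set_ae (sdiff_null_ae_eq_self (measure_singleton 0))).symm

lemma tendsto_integral_rectangles {Φ : ℂ → ℝ} (hΦ : IntegrableOn Φ expStrip) :
    Tendsto (fun n : ℕ => ∫ s in (-((n : ℝ) + 1))..(-(1 / ((n : ℝ) + 1))),
      ∫ θ in (-Real.pi)..Real.pi, Φ (s + θ * Complex.I)) atTop (𝓝 (∫ w in expStrip, Φ w)) := by
  set R : ℕ → Set ℂ := fun n =>
    {w | (-((n : ℝ) + 1) < w.re ∧ w.re ≤ -(1 / ((n : ℝ) + 1))) ∧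
      -Real.pi < w.im ∧ w.im ≤ Real.pi} with hR
  have hRm : ∀ n, MeasurableSet (R n) := fun n =>
    ((measurableSet_lt measurable_const Complex.measurable_re).inter
      (measurableSet_le Complex.measurable_re measurable_const)).inter
    ((measurableSet_lt measurable_const Complex.measurable_im).inter
      (measurableSet_le Complex.measurable_im measurable_const))
  have hmono : Monotone R := by
    intro n m hnm w hw
    have h1 : (n : ℝ) ≤ m := by exact_mod_cast hnm
    refine ⟨⟨by linarith [hw.1.1], hw.1.2.trans ?_⟩, hw.2⟩
    have : 1 / ((m : ℝ) + 1) ≤ 1 / ((n : ℝ) + 1) := by gcongr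
    linarith
  have hU : ⋃ n, R n = expStrip := by
    ext w
    simp only [mem_iUnion]
    constructor
    · rintro ⟨n, hn⟩
      refine ⟨lt_of_le_of_lt hn.1.2 ?_, hn.2⟩
      have : 0 < 1 / ((n : ℝ) + 1) := by positivity
      linarith
    · intro hw
      obtain ⟨n, hn⟩ := exists_nat_gt (-w.re)
      obtain ⟨k, hk⟩ := exists_nat_one_div_lt (neg_pos.2 hw.1)
      refine ⟨max n k, ⟨?_, ?_⟩, hw.2⟩
      · have : (n : ℝ) ≤ (max n k : ℕ) := by exact_mod_cast le_max_left n k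
        linarith
      · have h1 : (k : ℝ) ≤ (max n k : ℕ) := by exact_mod_cast le_max_right n k
        have : 1 / (((max n k : ℕ) : ℝ) + 1) ≤ 1 / ((k : ℝ) + 1) := by gcongr
        linarith
  have key := tendsto_setIntegral_of_monotone hRm hmono (hU ▸ hΦ)
  rw [hU] at key
  refine key.congr fun n => ?_
  have h1 : -((n : ℝ) + 1) ≤ -(1 / ((n : ℝ) + 1)) := by
    have : 1 / ((n : ℝ) + 1) ≤ 1 := by rw [div_le_one (by positivity)]; linarith [n.cast_nonneg (α := ℝ)]
    linarith [n.cast_nonneg (α := ℝ)]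
  have hpre : R n = Complex.measurableEquivRealProd ⁻¹'
      (Ioc (-((n : ℝ) + 1)) (-(1 / ((n : ℝ) + 1))) ×ˢ Ioc (-Real.pi) Real.pi) := by
    ext w; simp [hR, Complex.measurableEquivRealProd_apply]
  have hInt : IntegrableOn Φ (R n) := hΦ.mono_set (hU ▸ subset_iUnion R n)
  have hcomp : Φ = (fun p : ℝ × ℝ => Φ (p.1 + p.2 * Complex.I)) ∘
      Complex.measurableEquivRealProd := by
    funext w; simp [Complex.measurableEquivRealProd_apply, Complex.re_add_im]
  have hmp := Complex.volume_preserving_equiv_real_prod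
  rw [hpre, hcomp] at hInt
  rw [hmp.integrableOn_comp_preimage Complex.measurableEquivRealProd.measurableEmbedding] at hInt
  rw [hpre]
  conv_lhs => rw [hcomp]
  have := hmp.setIntegral_preimage_emb Complex.measurableEquivRealProd.measurableEmbedding
    (fun p : ℝ × ℝ => Φ (p.1 + p.2 * Complex.I))
    (Ioc (-((n : ℝ) + 1)) (-(1 / ((n : ℝ) + 1))) ×ˢ Ioc (-Real.pi) Real.pi)
  simp only [Function.comp_def]
  rw [this]
  rw [Measure.volume_eq_prod] at hInt ⊢
  rw [setIntegral_prod _ hInt, intervalIntegral.integral_of_le h1]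
  refine setIntegral_congr_fun measurableSet_Ioc fun s _ => ?_
  rw [intervalIntegral.integral_of_le (by linarith [Real.pi_pos])]

lemma exp_mem_ball {w : ℂ} (hw : w.re < 0) : Complex.exp w ∈ ball (0 : ℂ) 1 := by
  rw [mem_ball_zero_iff, Complex.norm_exp, Real.exp_lt_one_iff]; exact hw

lemma fderiv_comp_exp {U : ℂ → ℝ} {w : ℂ} (hU : DifferentiableAt ℝ U (Complex.exp w)) (v : ℂ) :
    fderiv ℝ (fun y => U (Complex.exp y)) w v =
      fderiv ℝ U (Complex.exp w) (Complex.exp w * v) := by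
  have h1 := hU.hasFDerivAt.comp w ((Complex.hasDerivAt_exp w).hasFDerivAt.restrictScalars ℝ)
  have h2 : fderiv ℝ (fun y => U (Complex.exp y)) w = _ := h1.fderiv
  rw [h2]; simp [mul_comm]

/-- The flux in Green's identity through the vertical segment `Re w = s`. -/
noncomputable def flux (U H : ℂ → ℝ) (s : ℝ) : ℝ :=
  ∫ θ in (-Real.pi)..Real.pi, (H (s + θ * Complex.I) *
      fderiv ℝ U (Complex.exp (s + θ * Complex.I)) (Complex.exp (s + θ * Complex.I))
    - U (Complex.exp (s + θ * Complex.I)) * fderiv ℝ H (s + θ * Complex.I) 1)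

lemma integral_mul_eq_of_flux {U g H Hd : ℂ → ℝ} {l : ℝ}
    (hU : ∀ z ∈ ball (0 : ℂ) 1, ContDiffAt ℝ 2 U z)
    (hg : ∀ z ∈ ball (0 : ℂ) 1, lap U z = -g z)
    (hH : ContDiff ℝ 2 H) (hH0 : ∀ w, lap H w = 0) (hHd : ∀ w, H w = Hd (Complex.exp w))
    (hInt : IntegrableOn (fun z => g z * Hd z) (ball 0 1))
    (h0 : Tendsto (flux U H) (𝓝[<] 0) (𝓝 0)) (hl : Tendsto (flux U H) atBot (𝓝 l)) :
    ∫ z in ball (0 : ℂ) 1, g z * Hd z = l := by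
  have hc2 : ∀ w : ℂ, w.re < 0 → ContDiffAt ℝ 2 (fun y => U (Complex.exp y)) w := fun w hw =>
    (hU _ (exp_mem_ball hw)).comp w (Complex.contDiff_exp.contDiffAt)
  have hlap : ∀ w : ℂ, w.re < 0 → lap (fun y => U (Complex.exp y)) w =
      -(‖Complex.exp w‖ ^ 2 * g (Complex.exp w)) := by
    intro w hw
    rw [lap_comp_of_hasDerivAt (hU _ (exp_mem_ball hw))
      (Eventually.of_forall fun y => Complex.hasDerivAt_exp y) (Complex.hasDerivAt_exp w),
      hg _ (exp_mem_ball hw)]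
    ring
  have hexp : ∀ w : ℂ, Complex.exp (w + 2 * Real.pi * Complex.I) = Complex.exp w :=
    fun w => Complex.exp_periodic w
  rw [setIntegral_ball_eq_expStrip]
  have hInt' := (integrableOn_ball_iff_expStrip _).1 hInt
  have hlim := tendsto_integral_rectangles hInt'
  have hS : Tendsto (fun n : ℕ => -((n : ℝ) + 1)) atTop atBot :=
    tendsto_neg_atTop_atBot.comp (tendsto_natCast_atTop_atTop.atTop_add tendsto_const_nhds)
  have hT : Tendsto (fun n : ℕ => -(1 / ((n : ℝ) + 1))) atTop (𝓝[<] 0) := by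
    refine tendsto_nhdsWithin_iff.2 ⟨by simpa using (tendsto_one_div_add_atTop_nhds_zero_nat (𝕜 := ℝ)).neg, ?_⟩
    refine Eventually.of_forall fun n => ?_
    have : 0 < 1 / ((n : ℝ) + 1) := by positivity
    simpa using this
  have hlim2 := (hl.comp hS).sub (h0.comp hT)
  rw [sub_zero] at hlim2
  refine tendsto_nhds_unique hlim (hlim2.congr fun n => ?_)
  have hn : (0 : ℝ) < 1 / ((n : ℝ) + 1) := by positivity
  have h1 : -((n : ℝ) + 1) ≤ -(1 / ((n : ℝ) + 1)) := by
    have : 1 / ((n : ℝ) + 1) ≤ 1 := by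
      rw [div_le_one (by positivity)]; linarith [n.cast_nonneg (α := ℝ)]
    linarith [n.cast_nonneg (α := ℝ)]
  have key := green_rectangle hc2 (fun w _ => hH.contDiffAt) (fun w => by rw [hexp])
    (fun w => by rw [hHd, hHd, hexp]) h1 (by linarith)
  have hfl : ∀ s : ℝ, s < 0 → flux U H s = ∫ θ in (-Real.pi)..Real.pi, (H (s + θ * Complex.I) *
      fderiv ℝ (fun y => U (Complex.exp y)) (s + θ * Complex.I) 1
    - U (Complex.exp (s + θ * Complex.I)) * fderiv ℝ H (s + θ * Complex.I) 1) := by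
    intro s hs
    refine intervalIntegral.integral_congr fun θ _ => ?_
    have := (hU _ (exp_mem_ball (w := s + θ * Complex.I) (by simpa using hs))).differentiableAt
      (by norm_num)
    simp only [fderiv_comp_exp this, mul_one]
  rw [← hfl _ (by linarith), ← hfl _ (by linarith)] at key
  simp only [Function.comp_apply]
  rw [← neg_sub, ← key, ← intervalIntegral.integral_neg]
  refine intervalIntegral.integral_congr fun s hs => ?_
  rw [← intervalIntegral.integral_neg]
  refine intervalIntegral.integral_congr fun θ _ => ?_
  have hs0 : (s + θ * Complex.I : ℂ).re < 0 := by
    rw [uIcc_of_le h1] at hs; simpa using lt_of_le_of_lt hs.2 (by linarith)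
  simp only [hlap _ hs0, hH0, ← hHd]
  ring

lemma tendsto_flux_zero {U H : ℂ → ℝ} {M c : ℝ}
    (hM : ∀ z ∈ ball (0 : ℂ) 1, ‖fderiv ℝ U z‖ ≤ M)
    (hbd : ∀ z ∈ ball (0 : ℂ) 1, |U z| ≤ M * (1 - ‖z‖))
    (hH : ∀ w : ℂ, -1 < w.re → w.re < 0 → |H w| ≤ c * (-w.re))
    (hH1 : ∀ w : ℂ, -1 < w.re → w.re < 0 → |fderiv ℝ H w 1| ≤ c) :
    Tendsto (flux U H) (𝓝[<] 0) (𝓝 0) := by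
  have hM0 : 0 ≤ M := (norm_nonneg _).trans (hM 0 (by simp))
  have hc0 : 0 ≤ c := (abs_nonneg _).trans (hH1 ((-1/2 : ℝ) : ℂ)
    (by rw [Complex.ofReal_re]; norm_num) (by rw [Complex.ofReal_re]; norm_num))
  have hlim : Tendsto (fun s : ℝ => 2 * M * c * (-s) * |Real.pi - -Real.pi|) (𝓝[<] 0) (𝓝 0) := by
    have : Continuous (fun s : ℝ => 2 * M * c * (-s) * |Real.pi - -Real.pi|) := by fun_prop
    simpa using (this.tendsto 0).mono_left nhdsWithin_le_nhds
  refine squeeze_zero_norm' ?_ hlim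
  filter_upwards [Ioo_mem_nhdsLT (show (-1 : ℝ) < 0 by norm_num)] with s hs
  refine intervalIntegral.norm_integral_le_of_norm_le_const fun θ _ => ?_
  have hre : (s + θ * Complex.I : ℂ).re = s := by simp
  set w : ℂ := s + θ * Complex.I
  have hw0 : w.re < 0 := hre ▸ hs.2
  have hw1 : -1 < w.re := hre ▸ hs.1
  have hn : ‖Complex.exp w‖ = Real.exp s := by rw [Complex.norm_exp, hre]
  have e1 : Real.exp s ≤ 1 := Real.exp_le_one_iff.2 hs.2.le
  have e2 : 1 - Real.exp s ≤ -s := by linarith [Real.add_one_le_exp s]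
  have h1 : |fderiv ℝ U (Complex.exp w) (Complex.exp w)| ≤ M := by
    refine ((fderiv ℝ U (Complex.exp w)).le_opNorm _).trans ?_
    rw [hn]
    calc _ ≤ M * 1 := mul_le_mul (hM _ (exp_mem_ball hw0)) e1 (Real.exp_pos _).le hM0
      _ = M := mul_one _
  have h2 : |U (Complex.exp w)| ≤ M * (-s) := by
    refine (hbd _ (exp_mem_ball hw0)).trans ?_
    rw [hn]; gcongr
  have h3 := hH w hw1 hw0
  rw [hre] at h3
  have h4 := hH1 w hw1 hw0
  have hs' : 0 ≤ -s := by linarith [hs.2]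
  calc ‖_‖ ≤ |H w| * |fderiv ℝ U (Complex.exp w) (Complex.exp w)|
        + |U (Complex.exp w)| * |fderiv ℝ H w 1| := by
        rw [← abs_mul, ← abs_mul]; exact abs_sub _ _
    _ ≤ (c * (-s)) * M + (M * (-s)) * c := by gcongr
    _ = _ := by ring

lemma lap_re (w : ℂ) : lap Complex.re w = 0 := by
  have h : ∀ v : ℂ, (fun y => fderiv ℝ Complex.re y v) = fun _ => v.re := by
    intro v; funext y
    have : fderiv ℝ Complex.re y = Complex.reCLM := Complex.reCLM.fderiv
    rw [this]; rfl
  simp [lap, h]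

lemma lap_re_comp {G G' G'' : ℂ → ℂ} (hG : ∀ w, HasDerivAt G (G' w) w)
    (hG' : ∀ w, HasDerivAt G' (G'' w) w) (w : ℂ) : lap (fun y => (G y).re) w = 0 := by
  rw [lap_comp_of_hasDerivAt (u := Complex.re) Complex.reCLM.contDiff.contDiffAt
    (Eventually.of_forall hG) (hG' w), lap_re, mul_zero]

lemma fderiv_re_comp {G : ℂ → ℂ} {G' w : ℂ} (hG : HasDerivAt G G' w) :
    fderiv ℝ (fun y => (G y).re) w 1 = G'.re := by
  have h := Complex.reCLM.hasFDerivAt.comp w (hG.hasFDerivAt.restrictScalars ℝ)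
  have h2 : fderiv ℝ (fun y => (G y).re) w = _ := h.fderiv
  rw [h2]; simp

lemma tendsto_intervalIntegral_of_bounded {Φ : ℝ → ℝ → ℝ} {L : ℝ → ℝ} {K : ℝ}
    (hc : ∀ s < 0, Continuous (Φ s)) (hb : ∀ s < 0, ∀ θ, |Φ s θ| ≤ K)
    (hL : ∀ θ, Tendsto (fun s => Φ s θ) atBot (𝓝 (L θ))) :
    Tendsto (fun s => ∫ θ in (-Real.pi)..Real.pi, Φ s θ) atBot
      (𝓝 (∫ θ in (-Real.pi)..Real.pi, L θ)) := by
  refine intervalIntegral.tendsto_integral_filter_of_dominated_convergence (fun _ => K) ?_ ?_ ?_ ?_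
  · filter_upwards [eventually_lt_atBot 0] with s hs using (hc s hs).aestronglyMeasurable
  · filter_upwards [eventually_lt_atBot 0] with s hs using Eventually.of_forall fun θ _ => hb s hs θ
  · exact intervalIntegrable_const
  · exact Eventually.of_forall fun θ _ => hL θ

section origin

variable {U g : ℂ → ℝ} {M : ℝ}

lemma abs_sub_zero_le (hU : ∀ z ∈ ball (0 : ℂ) 1, ContDiffAt ℝ 2 U z)
    (hM : ∀ z ∈ ball (0 : ℂ) 1, ‖fderiv ℝ U z‖ ≤ M) {z : ℂ} (hz : z ∈ ball (0 : ℂ) 1) :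
    |U z - U 0| ≤ M * ‖z‖ := by
  have := (convex_ball (0 : ℂ) 1).norm_image_sub_le_of_norm_fderiv_le (𝕜 := ℝ)
    (fun y hy => (hU y hy).differentiableAt (by norm_num)) hM (mem_ball_self one_pos) hz
  simpa using this

lemma tendsto_exp_line (θ : ℝ) :
    Tendsto (fun s : ℝ => Complex.exp (s + θ * Complex.I)) atBot (𝓝 0) := by
  rw [tendsto_zero_iff_norm_tendsto_zero]
  simpa [Complex.norm_exp] using Real.tendsto_exp_atBot

lemma continuous_line (s : ℝ) (hs : s < 0) {f : ℂ → ℝ}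
    (hf : ∀ w : ℂ, w.re < 0 → ContinuousAt f w) :
    Continuous fun θ : ℝ => f (s + θ * Complex.I) := by
  rw [continuous_iff_continuousAt]
  intro θ
  exact ContinuousAt.comp (f := fun θ : ℝ => (s + θ * Complex.I : ℂ)) (hf _ (by simpa using hs))
    (by fun_prop)

lemma two_pi_mul_value_zero (hU : ∀ z ∈ ball (0 : ℂ) 1, ContDiffAt ℝ 2 U z)
    (hg : ∀ z ∈ ball (0 : ℂ) 1, lap U z = -g z)
    (hM : ∀ z ∈ ball (0 : ℂ) 1, ‖fderiv ℝ U z‖ ≤ M)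
    (hbd : ∀ z ∈ ball (0 : ℂ) 1, |U z| ≤ M * (1 - ‖z‖))
    (hInt : IntegrableOn (fun z => g z * -Real.log ‖z‖) (ball 0 1)) :
    ∫ z in ball (0 : ℂ) 1, g z * -Real.log ‖z‖ = 2 * Real.pi * U 0 := by
  have hM0 : 0 ≤ M := (norm_nonneg _).trans (hM 0 (by simp))
  have hG : ∀ w : ℂ, HasDerivAt (fun y : ℂ => -y) (-1) w := fun w => (hasDerivAt_id w).neg
  have hH1 : ∀ w : ℂ, fderiv ℝ (fun y : ℂ => (-y).re) w 1 = -1 := fun w => by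
    rw [fderiv_re_comp (hG w)]; simp
  refine integral_mul_eq_of_flux (H := fun w => (-w).re) hU hg ?_
    (lap_re_comp hG (fun w => hasDerivAt_const w _)) ?_ hInt ?_ ?_
  · exact Complex.reCLM.contDiff.comp contDiff_neg
  · intro w; simp [Complex.norm_exp]
  · refine tendsto_flux_zero (c := 1) hM hbd (fun w _ h0 => ?_) (fun w _ _ => ?_)
    · rw [Complex.neg_re, abs_of_pos (by linarith), one_mul]
    · rw [hH1]; simp
  · have hz : ∀ s : ℝ, s < 0 → ∀ θ : ℝ, Complex.exp (s + θ * Complex.I) ∈ ball (0 : ℂ) 1 :=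
      fun s hs θ => exp_mem_ball (by simpa using hs)
    have hbnd : ∀ s : ℝ, s < 0 → ∀ θ : ℝ,
        |-s * fderiv ℝ U (Complex.exp (s + θ * Complex.I)) (Complex.exp (s + θ * Complex.I))| ≤
          M * (-s * Real.exp s) := by
      intro s hs θ
      have hn : ‖Complex.exp (s + θ * Complex.I)‖ = Real.exp s := by simp [Complex.norm_exp]
      rw [abs_mul, abs_of_pos (neg_pos.2 hs)]
      have := ((fderiv ℝ U (Complex.exp (s + θ * Complex.I))).le_opNorm
        (Complex.exp (s + θ * Complex.I))).trans
        (mul_le_mul_of_nonneg_right (hM _ (hz s hs θ)) (norm_nonneg _))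
      rw [hn, Real.norm_eq_abs] at this
      calc _ ≤ -s * (M * Real.exp s) := mul_le_mul_of_nonneg_left this (by linarith)
        _ = _ := by ring
    have key := tendsto_intervalIntegral_of_bounded (K := M + M) (L := fun _ => U 0)
      (Φ := fun s θ => -s * fderiv ℝ U (Complex.exp (s + θ * Complex.I))
        (Complex.exp (s + θ * Complex.I)) + U (Complex.exp (s + θ * Complex.I))) ?_ ?_ ?_
    · have h2 : (∫ _ in (-Real.pi)..Real.pi, U 0) = 2 * Real.pi * U 0 := by
        rw [intervalIntegral.integral_const, smul_eq_mul]; ring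
      rw [h2] at key
      refine key.congr fun s => ?_
      refine intervalIntegral.integral_congr fun θ _ => ?_
      simp only [hH1]; simp
    · intro s hs
      refine (continuous_const.mul (continuous_line s hs
        (f := fun w => fderiv ℝ U (Complex.exp w) (Complex.exp w)) fun w hw => ?_)).add
        (continuous_line s hs (f := fun w => U (Complex.exp w)) fun w hw => ?_)
      · have h1 := ((hU _ (exp_mem_ball hw)).fderiv_right (m := 1) (by norm_num)).continuousAt
        exact (h1.comp Complex.continuous_exp.continuousAt).clm_apply
          Complex.continuous_exp.continuousAt
      · exact (hU _ (exp_mem_ball hw)).continuousAt.comp Complex.continuous_exp.continuousAt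
    · intro s hs θ
      refine (abs_add_le _ _).trans (add_le_add ((hbnd s hs θ).trans ?_)
        ((hbd _ (hz s hs θ)).trans ?_))
      · have h1 : -s * Real.exp s ≤ 1 := by
          have h2 := Real.add_one_le_exp (-s)
          have h3 : Real.exp (-s) * Real.exp s = 1 := by rw [← Real.exp_add]; simp
          nlinarith [Real.exp_pos s]
        nlinarith
      · nlinarith [norm_nonneg (Complex.exp (s + θ * Complex.I))]
    · intro θ
      have h1 : Tendsto (fun s : ℝ => -s * fderiv ℝ U (Complex.exp (s + θ * Complex.I))
        (Complex.exp (s + θ * Complex.I))) atBot (𝓝 0) := by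
        have h2 : Tendsto (fun s : ℝ => M * (-s * Real.exp s)) atBot (𝓝 0) := by
          have h3 := (Real.tendsto_pow_mul_exp_neg_atTop_nhds_zero 1).comp tendsto_neg_atBot_atTop
          simpa [Function.comp_def] using h3.const_mul M
        refine squeeze_zero_norm' ?_ h2
        filter_upwards [eventually_lt_atBot 0] with s hs using hbnd s hs θ
      have h2 := (hU 0 (by simp)).continuousAt.tendsto.comp (tendsto_exp_line θ)
      simpa using h1.add h2

lemma integral_trig_product (a b p q : ℝ) :
    ∫ θ in (-Real.pi)..Real.pi, 2 * ((a * Real.cos θ + b * Real.sin θ) *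
      (p * Real.cos θ + q * Real.sin θ)) = 2 * Real.pi * (a * p + b * q) := by
  have h : ∀ θ : ℝ, 2 * ((a * Real.cos θ + b * Real.sin θ) * (p * Real.cos θ + q * Real.sin θ)) =
      (2 * (a * p)) * Real.cos θ ^ 2 + (2 * (b * q)) * Real.sin θ ^ 2 +
        (2 * (a * q + b * p)) * (Real.sin θ * Real.cos θ) := fun θ => by ring
  simp_rw [h]
  rw [intervalIntegral.integral_add, intervalIntegral.integral_add,
    intervalIntegral.integral_const_mul, intervalIntegral.integral_const_mul,
    intervalIntegral.integral_const_mul, integral_cos_sq, integral_sin_sq,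
    integral_sin_mul_cos₁]
  · simp; ring
  all_goals exact Continuous.intervalIntegrable (by fun_prop) _ _

lemma two_pi_mul_fderiv_zero (hU : ∀ z ∈ ball (0 : ℂ) 1, ContDiffAt ℝ 2 U z)
    (hg : ∀ z ∈ ball (0 : ℂ) 1, lap U z = -g z)
    (hM : ∀ z ∈ ball (0 : ℂ) 1, ‖fderiv ℝ U z‖ ≤ M)
    (hbd : ∀ z ∈ ball (0 : ℂ) 1, |U z| ≤ M * (1 - ‖z‖)) (v : ℂ)
    (hInt : IntegrableOn (fun z => g z * (v * z⁻¹ - conj v * z).re) (ball 0 1)) :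
    ∫ z in ball (0 : ℂ) 1, g z * (v * z⁻¹ - conj v * z).re = 2 * Real.pi * fderiv ℝ U 0 v := by
  have hM0 : 0 ≤ M := (norm_nonneg _).trans (hM 0 (by simp))
  set Q : ℝ → ℝ := fun θ => v.re * Real.cos θ + v.im * Real.sin θ with hQ
  have hQv : ∀ θ, |Q θ| ≤ 2 * ‖v‖ := by
    intro θ
    have h1 := Complex.abs_re_le_norm v
    have h2 := Complex.abs_im_le_norm v
    calc |Q θ| ≤ |v.re| * |Real.cos θ| + |v.im| * |Real.sin θ| := by
          rw [← abs_mul, ← abs_mul]; exact abs_add_le _ _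
      _ ≤ ‖v‖ * 1 + ‖v‖ * 1 := by
          gcongr
          · exact Real.abs_cos_le_one θ
          · exact Real.abs_sin_le_one θ
      _ = _ := by ring
  set G : ℂ → ℂ := fun w => v * Complex.exp (-w) - conj v * Complex.exp w with hGdef
  set G' : ℂ → ℂ := fun w => -(v * Complex.exp (-w)) - conj v * Complex.exp w with hG'def
  have hexpn : ∀ w : ℂ, HasDerivAt (fun y : ℂ => Complex.exp (-y)) (-Complex.exp (-w)) w := by
    intro w
    simpa using (hasDerivAt_id w).neg.cexp
  have hG : ∀ w, HasDerivAt G (G' w) w := by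
    intro w
    refine (((hexpn w).const_mul v).sub
      ((Complex.hasDerivAt_exp w).const_mul (conj v))).congr_deriv ?_
    simp only [hG'def]; ring
  have hG' : ∀ w, HasDerivAt G' (G w) w := by
    intro w
    refine (((hexpn w).const_mul v).neg.sub
      ((Complex.hasDerivAt_exp w).const_mul (conj v))).congr_deriv ?_
    simp only [hGdef]; ring
  have eG : ∀ s θ : ℝ, (G (s + θ * Complex.I)).re = (Real.exp (-s) - Real.exp s) * Q θ := by
    intro s θ
    simp [hGdef, hQ, Complex.exp_re, Complex.exp_im]; ring
  have eG' : ∀ s θ : ℝ, (G' (s + θ * Complex.I)).re = -(Real.exp (-s) + Real.exp s) * Q θ := by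
    intro s θ
    simp [hG'def, hQ, Complex.exp_re, Complex.exp_im]; ring
  have hsplit : ∀ w : ℂ, w = (w.re : ℂ) + (w.im : ℂ) * Complex.I := fun w => (Complex.re_add_im w).symm
  refine integral_mul_eq_of_flux (H := fun w => (G w).re) hU hg ?_ (lap_re_comp hG hG') ?_ hInt ?_ ?_
  · refine Complex.reCLM.contDiff.comp (f := G) ?_
    simp only [hGdef]
    fun_prop
  · intro w; simp only [hGdef, Complex.exp_neg]
  · have hE : (1 : ℝ) ≤ Real.exp 1 := Real.one_le_exp (by norm_num)
    refine tendsto_flux_zero (c := 4 * Real.exp 1 * ‖v‖) hM hbd (fun w h1 h0 => ?_)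
      (fun w h1 h0 => ?_)
    · rw [hsplit w, eG, abs_mul]
      simp only [← hsplit w]
      set s := w.re
      have a1 : Real.exp (-s) ≤ Real.exp 1 := Real.exp_le_exp.2 (by linarith)
      have a2 : Real.exp s = Real.exp (-s) * Real.exp (2 * s) := by rw [← Real.exp_add]; ring_nf
      have a3 := Real.add_one_le_exp (2 * s)
      have a4 : Real.exp s ≤ Real.exp (-s) := Real.exp_le_exp.2 (by linarith)
      have a5 : |Real.exp (-s) - Real.exp s| ≤ 2 * Real.exp 1 * (-s) := by
        rw [abs_of_nonneg (by linarith), a2]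
        have : Real.exp (-s) * (1 - Real.exp (2 * s)) ≤ Real.exp 1 * (-(2 * s)) :=
          mul_le_mul a1 (by linarith) (by
            have : Real.exp (2 * s) ≤ 1 := Real.exp_le_one_iff.2 (by linarith)
            linarith) (by positivity)
        linarith
      calc _ ≤ (2 * Real.exp 1 * (-s)) * (2 * ‖v‖) := by
            gcongr
            · have := neg_pos.2 h0; positivity
            · exact hQv _
        _ = _ := by ring
    · rw [fderiv_re_comp (hG w), hsplit w, eG', abs_mul, abs_neg]
      set s := w.re
      have a1 : Real.exp (-s) ≤ Real.exp 1 := Real.exp_le_exp.2 (by linarith)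
      have a2 : Real.exp s ≤ 1 := Real.exp_le_one_iff.2 (by linarith)
      rw [abs_of_pos (by positivity)]
      calc _ ≤ (2 * Real.exp 1) * (2 * ‖v‖) := by
            gcongr
            · linarith
            · exact hQv _
        _ = _ := by ring
  · have hz : ∀ s : ℝ, s < 0 → ∀ θ : ℝ, Complex.exp (s + θ * Complex.I) ∈ ball (0 : ℂ) 1 :=
      fun s hs θ => exp_mem_ball (by simpa using hs)
    have hn : ∀ s θ : ℝ, ‖Complex.exp (s + θ * Complex.I)‖ = Real.exp s := fun s θ => by
      simp [Complex.norm_exp]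
    have hce : Continuous Complex.exp := Complex.continuous_exp
    have hcU : ∀ s : ℝ, s < 0 → Continuous fun θ : ℝ => U (Complex.exp (s + θ * Complex.I)) := fun s hs =>
      continuous_line s hs (f := fun w => U (Complex.exp w)) fun w hw =>
        (hU _ (exp_mem_ball hw)).continuousAt.comp hce.continuousAt
    have hcD : ∀ s : ℝ, s < 0 → Continuous fun θ : ℝ => fderiv ℝ U (Complex.exp (s + θ * Complex.I))
        (Complex.exp (s + θ * Complex.I)) := fun s hs =>
      continuous_line s hs (f := fun w => fderiv ℝ U (Complex.exp w) (Complex.exp w)) fun w hw =>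
        (((hU _ (exp_mem_ball hw)).fderiv_right (m := 1) (by norm_num)).continuousAt.comp
          hce.continuousAt).clm_apply hce.continuousAt
    have hcQ : Continuous Q := by simp only [hQ]; fun_prop
    have key := tendsto_intervalIntegral_of_bounded (K := 6 * (‖v‖ * M))
      (L := fun θ => 2 * (Q θ * (fderiv ℝ U 0 1 * Real.cos θ + fderiv ℝ U 0 Complex.I * Real.sin θ)))
      (Φ := fun s θ => (Real.exp (-s) - Real.exp s) * Q θ *
        fderiv ℝ U (Complex.exp (s + θ * Complex.I)) (Complex.exp (s + θ * Complex.I)) +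
        (U (Complex.exp (s + θ * Complex.I)) - U 0) * ((Real.exp (-s) + Real.exp s) * Q θ)) ?_ ?_ ?_
    · have h2 := integral_trig_product v.re v.im (fderiv ℝ U 0 1) (fderiv ℝ U 0 Complex.I)
      have h3 : fderiv ℝ U 0 v = v.re * fderiv ℝ U 0 1 + v.im * fderiv ℝ U 0 Complex.I := by
        conv_lhs => rw [show v = v.re • (1 : ℂ) + v.im • Complex.I by
          simp [Complex.re_add_im]]
        rw [map_add, map_smul, map_smul, smul_eq_mul, smul_eq_mul]
      rw [h3, ← h2]
      refine Tendsto.congr' ?_ key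
      filter_upwards [eventually_lt_atBot 0] with s hs
      have h0 : ∫ θ in (-Real.pi)..Real.pi, U 0 * ((Real.exp (-s) + Real.exp s) * Q θ) = 0 := by
        rw [intervalIntegral.integral_const_mul, intervalIntegral.integral_const_mul]
        have : ∫ θ in (-Real.pi)..Real.pi, Q θ = 0 := by
          simp only [hQ]
          rw [intervalIntegral.integral_add, intervalIntegral.integral_const_mul,
            intervalIntegral.integral_const_mul]
          · simp
          all_goals exact Continuous.intervalIntegrable (by fun_prop) _ _
        rw [this]; simp
      rw [← add_zero (∫ θ in _.._, _), ← h0, ← intervalIntegral.integral_add]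
      · refine intervalIntegral.integral_congr fun θ _ => ?_
        simp only [fderiv_re_comp (hG _), eG, eG']
        ring
      · exact Continuous.intervalIntegrable ((((continuous_const.mul hcQ).mul (hcD s hs))).add
          (((hcU s hs).sub continuous_const).mul (continuous_const.mul hcQ))) _ _
      · exact Continuous.intervalIntegrable (continuous_const.mul (continuous_const.mul hcQ)) _ _
    · intro s hs
      exact (((continuous_const.mul hcQ).mul (hcD s hs))).add
          (((hcU s hs).sub continuous_const).mul (continuous_const.mul hcQ))
    · intro s hs θ
      have b1 : Real.exp (-s) * Real.exp s = 1 := by rw [← Real.exp_add]; simp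
      have b2 : Real.exp s < 1 := Real.exp_lt_one_iff.2 hs
      have b3 := Real.exp_pos s
      have b4 := Real.exp_pos (-s)
      have c1 := ((fderiv ℝ U (Complex.exp (s + θ * Complex.I))).le_opNorm
        (Complex.exp (s + θ * Complex.I))).trans
        (mul_le_mul_of_nonneg_right (hM _ (hz s hs θ)) (norm_nonneg _))
      have c2 := abs_sub_zero_le hU hM (hz s hs θ)
      rw [hn, Real.norm_eq_abs] at c1
      rw [hn] at c2
      have d1 : |Real.exp (-s) - Real.exp s| ≤ Real.exp (-s) := by
        rw [abs_of_nonneg (by nlinarith)]; linarith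
      have d2 : |Real.exp (-s) + Real.exp s| ≤ 2 * Real.exp (-s) := by
        rw [abs_of_nonneg (by linarith)]; nlinarith
      calc _ ≤ |Real.exp (-s) - Real.exp s| * |Q θ| * |fderiv ℝ U (Complex.exp (s + θ * Complex.I))
            (Complex.exp (s + θ * Complex.I))| + |U (Complex.exp (s + θ * Complex.I)) - U 0| *
            (|Real.exp (-s) + Real.exp s| * |Q θ|) := by
            rw [← abs_mul, ← abs_mul, ← abs_mul, ← abs_mul]; exact abs_add_le _ _
        _ ≤ Real.exp (-s) * (2 * ‖v‖) * (M * Real.exp s) +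
            (M * Real.exp s) * ((2 * Real.exp (-s)) * (2 * ‖v‖)) := by
            gcongr <;> exact hQv θ
        _ = (Real.exp (-s) * Real.exp s) * (6 * (‖v‖ * M)) := by ring
        _ = _ := by rw [b1, one_mul]
    · intro θ
      set e : ℂ := Complex.exp (θ * Complex.I) with he
      have hze : ∀ s : ℝ, Complex.exp (s + θ * Complex.I) = Real.exp s • e := fun s => by
        rw [Complex.exp_add, ← Complex.ofReal_exp]; simp [he]
      have hDe : fderiv ℝ U 0 e =
          fderiv ℝ U 0 1 * Real.cos θ + fderiv ℝ U 0 Complex.I * Real.sin θ := by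
        rw [show e = Real.cos θ • (1 : ℂ) + Real.sin θ • Complex.I by
          rw [he, Complex.exp_mul_I]; simp]
        rw [map_add, map_smul, map_smul, smul_eq_mul, smul_eq_mul]; ring
      have hexp0 : Tendsto Real.exp atBot (𝓝 0) := Real.tendsto_exp_atBot
      have t1 : Tendsto (fun s : ℝ => fderiv ℝ U (Complex.exp (s + θ * Complex.I)) e) atBot
          (𝓝 (fderiv ℝ U 0 e)) := by
        have h1 : ContinuousAt (fun z => fderiv ℝ U z e) 0 :=
          (contDiffAt_fderiv_apply (hU 0 (by simp)) e).continuousAt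
        exact h1.tendsto.comp (tendsto_exp_line θ)
      have t2 : Tendsto (fun s : ℝ => Real.exp (-s) * (U (Complex.exp (s + θ * Complex.I)) - U 0))
          atBot (𝓝 (fderiv ℝ U 0 e)) := by
        have h1 := ((hU 0 (by simp)).differentiableAt (by norm_num)).hasFDerivAt.hasLineDerivAt e
        have h2 := HasDerivAt.tendsto_slope_zero_right (f := fun t : ℝ => U (0 + t • e)) h1
        have h3 : Tendsto Real.exp atBot (𝓝[>] 0) := tendsto_nhdsWithin_iff.2
          ⟨hexp0, Eventually.of_forall fun s => Real.exp_pos s⟩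
        refine (h2.comp h3).congr fun s => ?_
        simp [hze, Real.exp_neg]
      have t3 : Tendsto (fun s => (1 - Real.exp s ^ 2) * Q θ *
          fderiv ℝ U (Complex.exp (s + θ * Complex.I)) e +
          Real.exp (-s) * (U (Complex.exp (s + θ * Complex.I)) - U 0) * ((1 + Real.exp s ^ 2) * Q θ))
          atBot (𝓝 ((1 - 0 ^ 2) * Q θ * fderiv ℝ U 0 e + fderiv ℝ U 0 e * ((1 + 0 ^ 2) * Q θ))) :=
        (((tendsto_const_nhds.sub (hexp0.pow 2)).mul tendsto_const_nhds).mul t1).add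
          (t2.mul ((tendsto_const_nhds.add (hexp0.pow 2)).mul tendsto_const_nhds))
      rw [← hDe, show 2 * (Q θ * fderiv ℝ U 0 e) = (1 - 0 ^ 2) * Q θ * fderiv ℝ U 0 e +
        fderiv ℝ U 0 e * ((1 + 0 ^ 2) * Q θ) by ring]
      refine t3.congr fun s => ?_
      have b1 : Real.exp (-s) * Real.exp s = 1 := by rw [← Real.exp_add]; simp
      have b5 : fderiv ℝ U (Complex.exp (s + θ * Complex.I)) (Complex.exp (s + θ * Complex.I)) =
          Real.exp s * fderiv ℝ U (Complex.exp (s + θ * Complex.I)) e := by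
        conv_lhs => rw [hze, map_smul, smul_eq_mul]
        rw [hze]
      rw [b5]
      set D := fderiv ℝ U (Complex.exp (s + θ * Complex.I)) e
      set W := U (Complex.exp (s + θ * Complex.I)) - U 0
      linear_combination (-(Q θ * D) + W * Q θ * Real.exp s) * b1

end origin

/-- The disk automorphism sending `0` to `x`. -/
noncomputable def diskAut (x z : ℂ) : ℂ := (z + x) / (1 + conj x * z)

/-- `2π` times the Green function of the unit disk. -/
noncomputable def greenLog (x y : ℂ) : ℝ := -Real.log ‖diskAut (-x) y‖

/-- `Re (v * gradKernel x y)` is `2π` times the derivative in `x` of the Green function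
of the unit disk in the direction `v`. -/
noncomputable def gradKernel (x y : ℂ) : ℂ := (1 - (‖y‖ : ℂ) ^ 2) / ((y - x) * (1 - x * conj y))

lemma norm_add_sq_identity (x z : ℂ) :
    ‖1 + conj x * z‖ ^ 2 - ‖z + x‖ ^ 2 = (1 - ‖x‖ ^ 2) * (1 - ‖z‖ ^ 2) := by
  simp only [← Complex.normSq_eq_norm_sq, Complex.normSq_apply]
  simp
  ring

lemma one_sub_norm_le {x z : ℂ} (hz : ‖z‖ ≤ 1) : 1 - ‖x‖ ≤ ‖1 + conj x * z‖ := by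
  have h1 : ‖conj x * z‖ ≤ ‖x‖ := by
    rw [norm_mul, RCLike.norm_conj]; exact mul_le_of_le_one_right (norm_nonneg _) hz
  have h2 := norm_sub_norm_le (1 : ℂ) (-(conj x * z))
  rw [norm_neg, sub_neg_eq_add, norm_one] at h2
  linarith

lemma one_add_conj_mul_ne_zero {x z : ℂ} (hx : ‖x‖ < 1) (hz : ‖z‖ ≤ 1) : 1 + conj x * z ≠ 0 := by
  have := one_sub_norm_le (x := x) hz
  rw [← norm_pos_iff]; linarith

lemma one_sub_norm_diskAut_sq {x z : ℂ} (hx : ‖x‖ < 1) (hz : ‖z‖ ≤ 1) :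
    1 - ‖diskAut x z‖ ^ 2 = (1 - ‖x‖ ^ 2) * (1 - ‖z‖ ^ 2) / ‖1 + conj x * z‖ ^ 2 := by
  have h := norm_pos_iff.2 (one_add_conj_mul_ne_zero hx hz)
  rw [← norm_add_sq_identity, diskAut, norm_div, sub_div, div_pow, div_self (by positivity)]

lemma diskAut_mem_ball {x z : ℂ} (hx : ‖x‖ < 1) (hz : z ∈ ball (0 : ℂ) 1) :
    diskAut x z ∈ ball (0 : ℂ) 1 := by
  rw [mem_ball_zero_iff] at hz ⊢
  have h := one_sub_norm_diskAut_sq hx hz.le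
  have h1 := norm_pos_iff.2 (one_add_conj_mul_ne_zero hx hz.le)
  have : 0 < 1 - ‖diskAut x z‖ ^ 2 := by
    rw [h]
    have := norm_nonneg x; have := norm_nonneg z
    apply div_pos (mul_pos _ _) (by positivity) <;> nlinarith
  nlinarith [norm_nonneg (diskAut x z)]

lemma diskAut_neg_diskAut {x z : ℂ} (hx : ‖x‖ < 1) (hz : z ∈ ball (0 : ℂ) 1) :
    diskAut (-x) (diskAut x z) = z := by
  rw [mem_ball_zero_iff] at hz
  have h := one_add_conj_mul_ne_zero hx hz.le
  have h2 : 1 - conj x * x ≠ 0 := by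
    have := one_add_conj_mul_ne_zero (x := x) (z := -x) hx (by rw [norm_neg]; exact hx.le)
    rwa [mul_neg, ← sub_eq_add_neg] at this
  have e : 1 + conj (-x) * diskAut x z = (1 - conj x * x) / (1 + conj x * z) := by
    rw [diskAut, map_neg, eq_div_iff h, add_mul, mul_assoc, div_mul_cancel₀ _ h]; ring
  have e2 : diskAut x z + -x = z * (1 - conj x * x) / (1 + conj x * z) := by
    rw [diskAut, eq_div_iff h, add_mul, div_mul_cancel₀ _ h]; ring
  rw [diskAut, e, e2, mul_div_assoc, mul_div_cancel_right₀ _ (div_ne_zero h2 h)]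

lemma image_diskAut {x : ℂ} (hx : ‖x‖ < 1) : diskAut x '' ball 0 1 = ball 0 1 := by
  apply Subset.antisymm
  · rintro _ ⟨z, hz, rfl⟩; exact diskAut_mem_ball hx hz
  · intro y hy
    have hx' : ‖-x‖ < 1 := by rwa [norm_neg]
    exact ⟨diskAut (-x) y, diskAut_mem_ball hx' hy,
      by simpa using diskAut_neg_diskAut hx' hy⟩

lemma injOn_diskAut {x : ℂ} (hx : ‖x‖ < 1) : InjOn (diskAut x) (ball 0 1) := fun z hz z' hz' h => by
  rw [← diskAut_neg_diskAut hx hz, h, diskAut_neg_diskAut hx hz']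

/-- The derivative of `diskAut x`. -/
noncomputable def diskAutDeriv (x z : ℂ) : ℂ := (1 - conj x * x) / (1 + conj x * z) ^ 2

lemma hasDerivAt_diskAut {x z : ℂ} (h : 1 + conj x * z ≠ 0) :
    HasDerivAt (diskAut x) (diskAutDeriv x z) z := by
  have h1 := ((hasDerivAt_id z).add_const x).div
    (((hasDerivAt_id z).const_mul (conj x)).const_add 1) h
  refine h1.congr_deriv ?_
  simp only [id, diskAutDeriv]
  congr 1; ring

lemma hasDerivAt_diskAutDeriv {x z : ℂ} (h : 1 + conj x * z ≠ 0) :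
    ∃ d, HasDerivAt (diskAutDeriv x) d z :=
  ⟨_, (hasDerivAt_const z (1 - conj x * x)).div
    ((((hasDerivAt_id z).const_mul (conj x)).const_add 1).pow 2) (pow_ne_zero 2 h)⟩

lemma norm_one_sub_conj_mul_self {x : ℂ} (hx : ‖x‖ < 1) : ‖1 - conj x * x‖ = 1 - ‖x‖ ^ 2 := by
  rw [Complex.conj_mul']
  norm_cast
  rw [Real.norm_of_nonneg (by nlinarith [norm_nonneg x])]

lemma norm_diskAutDeriv_le {x z : ℂ} (hx : ‖x‖ < 1) (hz : ‖z‖ ≤ 1) :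
    ‖diskAutDeriv x z‖ ≤ 1 / (1 - ‖x‖) ^ 2 := by
  rw [diskAutDeriv, norm_div, norm_pow, norm_one_sub_conj_mul_self hx]
  have h := one_sub_norm_le (x := x) hz
  have h0 : 0 < 1 - ‖x‖ := by linarith
  apply div_le_div₀ zero_le_one (by nlinarith [norm_nonneg x]) (by positivity)
  gcongr

lemma setIntegral_diskAut {x : ℂ} (hx : ‖x‖ < 1) (g : ℂ → ℝ) :
    ∫ y in ball (0 : ℂ) 1, g y =
      ∫ z in ball (0 : ℂ) 1, ‖diskAutDeriv x z‖ ^ 2 * g (diskAut x z) := by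
  conv_lhs => rw [← image_diskAut hx]
  exact integral_image_conformal measurableSet_ball (fun z hz => hasDerivAt_diskAut
    (one_add_conj_mul_ne_zero hx (mem_ball_zero_iff.1 hz).le)) (injOn_diskAut hx) g

lemma integrableOn_diskAut {x : ℂ} (hx : ‖x‖ < 1) (g : ℂ → ℝ) :
    IntegrableOn g (ball (0 : ℂ) 1) ↔
      IntegrableOn (fun z => ‖diskAutDeriv x z‖ ^ 2 * g (diskAut x z)) (ball 0 1) := by
  conv_lhs => rw [← image_diskAut hx]
  exact integrableOn_image_conformal measurableSet_ball (fun z hz => hasDerivAt_diskAut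
    (one_add_conj_mul_ne_zero hx (mem_ball_zero_iff.1 hz).le)) (injOn_diskAut hx) g

lemma diskAut_kernel {x y : ℂ} (hx : ‖x‖ < 1) (hy : ‖y‖ < 1) (v : ℂ) :
    (v * (diskAut (-x) y)⁻¹ - conj v * diskAut (-x) y).re =
      (1 - ‖x‖ ^ 2) * (v * gradKernel x y).re := by
  by_cases hxy : y = x
  · simp [hxy, diskAut, gradKernel]
  have h1 : 1 - conj x * y ≠ 0 := by
    have := one_add_conj_mul_ne_zero (x := -x) (z := y) (by rwa [norm_neg]) hy.le
    simpa [sub_eq_add_neg] using this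
  have h1' : 1 - x * conj y ≠ 0 := by
    have := (map_ne_zero (starRingEnd ℂ)).2 h1
    simpa using this
  have h2 : y - x ≠ 0 := sub_ne_zero.2 hxy
  have e1 : (conj v * diskAut (-x) y).re = (v * conj (diskAut (-x) y)).re := by
    rw [← Complex.conj_re (conj v * _), map_mul, Complex.conj_conj]
  have e2 : (diskAut (-x) y)⁻¹ - conj (diskAut (-x) y) =
      ((1 - ‖x‖ ^ 2 : ℝ) : ℂ) * gradKernel x y := by
    have hz : diskAut (-x) y = (y - x) / (1 - conj x * y) := by
      simp [diskAut, sub_eq_add_neg]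
    rw [hz, gradKernel]
    simp only [map_div₀, map_sub, map_mul, map_one, Complex.conj_conj]
    push_cast
    rw [← Complex.mul_conj', ← Complex.mul_conj']
    field_simp
    ring
  rw [Complex.sub_re, e1, ← Complex.sub_re, ← mul_sub, e2]
  rw [mul_left_comm, Complex.re_ofReal_mul]

section representation

variable {u f : ℂ → ℝ} {M : ℝ} {x : ℂ}

lemma pullback_hyps (hu : ∀ z ∈ ball (0 : ℂ) 1, ContDiffAt ℝ 2 u z)
    (hf : ∀ z ∈ ball (0 : ℂ) 1, lap u z = -f z)
    (hM : ∀ z ∈ ball (0 : ℂ) 1, ‖fderiv ℝ u z‖ ≤ M)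
    (hbd : ∀ z ∈ ball (0 : ℂ) 1, |u z| ≤ M * (1 - ‖z‖)) (hx : ‖x‖ < 1) :
    (∀ z ∈ ball (0 : ℂ) 1, ContDiffAt ℝ 2 (fun y => u (diskAut x y)) z) ∧
    (∀ z ∈ ball (0 : ℂ) 1, lap (fun y => u (diskAut x y)) z =
      -(‖diskAutDeriv x z‖ ^ 2 * f (diskAut x z))) ∧
    (∀ z ∈ ball (0 : ℂ) 1, fderiv ℝ (fun y => u (diskAut x y)) z =
      (fderiv ℝ u (diskAut x z)).comp
        ((ContinuousLinearMap.toSpanSingleton ℂ (diskAutDeriv x z)).restrictScalars ℝ)) ∧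
    (∀ z ∈ ball (0 : ℂ) 1, ‖fderiv ℝ (fun y => u (diskAut x y)) z‖ ≤ M * (2 / (1 - ‖x‖) ^ 2)) ∧
    (∀ z ∈ ball (0 : ℂ) 1, |u (diskAut x z)| ≤ M * (2 / (1 - ‖x‖) ^ 2) * (1 - ‖z‖)) := by
  have hM0 : 0 ≤ M := (norm_nonneg _).trans (hM 0 (by simp))
  have hx0 : 0 < 1 - ‖x‖ := by linarith
  have hne : ∀ z ∈ ball (0 : ℂ) 1, 1 + conj x * z ≠ 0 := fun z hz =>
    one_add_conj_mul_ne_zero hx (mem_ball_zero_iff.1 hz).le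
  have hderiv : ∀ z ∈ ball (0 : ℂ) 1, HasDerivAt (diskAut x) (diskAutDeriv x z) z := fun z hz =>
    hasDerivAt_diskAut (hne z hz)
  have hfd : ∀ z ∈ ball (0 : ℂ) 1, fderiv ℝ (fun y => u (diskAut x y)) z =
      (fderiv ℝ u (diskAut x z)).comp
        ((ContinuousLinearMap.toSpanSingleton ℂ (diskAutDeriv x z)).restrictScalars ℝ) := by
    intro z hz
    exact (((hu _ (diskAut_mem_ball hx hz)).differentiableAt (by norm_num)).hasFDerivAt.comp z
      ((hderiv z hz).hasFDerivAt.restrictScalars ℝ)).fderiv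
  refine ⟨fun z hz => ?_, fun z hz => ?_, hfd, fun z hz => ?_, fun z hz => ?_⟩
  · refine (hu _ (diskAut_mem_ball hx hz)).comp z ?_
    have h1 : ContDiffAt ℂ 2 (fun y : ℂ => y + x) z := by fun_prop
    have h2 : ContDiffAt ℂ 2 (fun y : ℂ => 1 + conj x * y) z := by fun_prop
    exact (h1.fun_div h2 (hne z hz)).restrict_scalars ℝ
  · obtain ⟨d, hd⟩ := hasDerivAt_diskAutDeriv (hne z hz)
    have hev : ∀ᶠ y in 𝓝 z, HasDerivAt (diskAut x) (diskAutDeriv x y) y := by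
      filter_upwards [isOpen_ball.mem_nhds hz] with y hy using hderiv y hy
    rw [lap_comp_of_hasDerivAt (hu _ (diskAut_mem_ball hx hz)) hev hd,
      hf _ (diskAut_mem_ball hx hz)]
    ring
  · rw [hfd z hz]
    refine (ContinuousLinearMap.opNorm_comp_le _ _).trans ?_
    have h1 : ‖((ContinuousLinearMap.toSpanSingleton ℂ (diskAutDeriv x z)).restrictScalars ℝ :
        ℂ →L[ℝ] ℂ)‖ ≤ 2 / (1 - ‖x‖) ^ 2 := by
      rw [ContinuousLinearMap.norm_restrictScalars, ContinuousLinearMap.norm_toSpanSingleton]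
      refine (norm_diskAutDeriv_le hx (mem_ball_zero_iff.1 hz).le).trans ?_
      gcongr; norm_num
    exact mul_le_mul (hM _ (diskAut_mem_ball hx hz)) h1 (norm_nonneg _) hM0
  · refine (hbd _ (diskAut_mem_ball hx hz)).trans ?_
    rw [mul_assoc]
    refine mul_le_mul_of_nonneg_left ?_ hM0
    have hψ := mem_ball_zero_iff.1 (diskAut_mem_ball hx hz)
    have hz1 := mem_ball_zero_iff.1 hz
    calc 1 - ‖diskAut x z‖ ≤ 1 - ‖diskAut x z‖ ^ 2 := by nlinarith [norm_nonneg (diskAut x z)]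
      _ = (1 - ‖x‖ ^ 2) * (1 - ‖z‖ ^ 2) / ‖1 + conj x * z‖ ^ 2 :=
          one_sub_norm_diskAut_sq hx hz1.le
      _ ≤ 1 * (2 * (1 - ‖z‖)) / (1 - ‖x‖) ^ 2 := by
          have := norm_nonneg z
          gcongr
          · nlinarith
          · nlinarith [norm_nonneg x]
          · nlinarith
          · exact one_sub_norm_le hz1.le
      _ = _ := by ring

/-- Green's representation formula in the unit disk. -/
lemma green_representation (hu : ∀ z ∈ ball (0 : ℂ) 1, ContDiffAt ℝ 2 u z)
    (hf : ∀ z ∈ ball (0 : ℂ) 1, lap u z = -f z)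
    (hM : ∀ z ∈ ball (0 : ℂ) 1, ‖fderiv ℝ u z‖ ≤ M)
    (hbd : ∀ z ∈ ball (0 : ℂ) 1, |u z| ≤ M * (1 - ‖z‖)) (hx : ‖x‖ < 1)
    (hInt : IntegrableOn (fun y => f y * greenLog x y) (ball 0 1)) :
    ∫ y in ball (0 : ℂ) 1, f y * greenLog x y = 2 * Real.pi * u x := by
  obtain ⟨h1, h2, -, h4, h5⟩ := pullback_hyps hu hf hM hbd hx
  have hkey : ∀ z ∈ ball (0 : ℂ) 1, ‖diskAutDeriv x z‖ ^ 2 *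
      (f (diskAut x z) * greenLog x (diskAut x z)) =
      ‖diskAutDeriv x z‖ ^ 2 * f (diskAut x z) * -Real.log ‖z‖ := fun z hz => by
    rw [greenLog, diskAut_neg_diskAut hx hz, mul_assoc]
  rw [integrableOn_diskAut hx, integrableOn_congr_fun hkey measurableSet_ball] at hInt
  rw [setIntegral_diskAut hx, setIntegral_congr_fun measurableSet_ball hkey,
    two_pi_mul_value_zero h1 h2 h4 h5 hInt]
  simp [diskAut]

/-- The representation formula for the gradient in the unit disk. -/
lemma fderiv_representation (hu : ∀ z ∈ ball (0 : ℂ) 1, ContDiffAt ℝ 2 u z)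
    (hf : ∀ z ∈ ball (0 : ℂ) 1, lap u z = -f z)
    (hM : ∀ z ∈ ball (0 : ℂ) 1, ‖fderiv ℝ u z‖ ≤ M)
    (hbd : ∀ z ∈ ball (0 : ℂ) 1, |u z| ≤ M * (1 - ‖z‖)) (hx : ‖x‖ < 1) (v : ℂ)
    (hInt : IntegrableOn (fun y => f y * (v * gradKernel x y).re) (ball 0 1)) :
    ∫ y in ball (0 : ℂ) 1, f y * (v * gradKernel x y).re = 2 * Real.pi * fderiv ℝ u x v := by
  obtain ⟨h1, h2, h3, h4, h5⟩ := pullback_hyps hu hf hM hbd hx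
  have hx2 : (1 - ‖x‖ ^ 2) ≠ 0 := by nlinarith [norm_nonneg x]
  have hkey : ∀ z ∈ ball (0 : ℂ) 1, ‖diskAutDeriv x z‖ ^ 2 * ((1 - ‖x‖ ^ 2) *
      (f (diskAut x z) * (v * gradKernel x (diskAut x z)).re)) =
      ‖diskAutDeriv x z‖ ^ 2 * f (diskAut x z) * (v * z⁻¹ - conj v * z).re := fun z hz => by
    have := diskAut_kernel hx (mem_ball_zero_iff.1 (diskAut_mem_ball hx hz)) v
    rw [diskAut_neg_diskAut hx hz] at this
    rw [this]; ring
  have hint2 : IntegrableOn (fun y => (1 - ‖x‖ ^ 2) * (f y * (v * gradKernel x y).re))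
    (ball 0 1) := hInt.const_mul _
  rw [integrableOn_diskAut hx, integrableOn_congr_fun hkey measurableSet_ball] at hint2
  have e := two_pi_mul_fderiv_zero h1 h2 h4 h5 v hint2
  rw [← setIntegral_congr_fun measurableSet_ball hkey,
    ← setIntegral_diskAut hx (fun y => (1 - ‖x‖ ^ 2) * (f y * (v * gradKernel x y).re)),
    integral_const_mul, h3 0 (by simp)] at e
  have e3 : (fderiv ℝ u (diskAut x 0)) (diskAutDeriv x 0 * v) = (1 - ‖x‖ ^ 2) * fderiv ℝ u x v := by
    have : diskAutDeriv x 0 * v = (1 - ‖x‖ ^ 2) • v := by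
      simp [diskAutDeriv, Complex.conj_mul']
    rw [this, map_smul, smul_eq_mul]; simp [diskAut]
  have e2 : ((fderiv ℝ u (diskAut x 0)).comp ((ContinuousLinearMap.toSpanSingleton ℂ
      (diskAutDeriv x 0)).restrictScalars ℝ)) v = (1 - ‖x‖ ^ 2) * fderiv ℝ u x v := by
    rw [← e3]; simp [mul_comm]
  rw [e2] at e
  apply mul_left_cancel₀ hx2
  rw [e]; ring

end representation

lemma exists_sphere_dist_eq {z : ℂ} (hz : z ∈ ball (0 : ℂ) 1) :
    ∃ p ∈ sphere (0 : ℂ) 1, ‖z - p‖ = 1 - ‖z‖ := by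
  by_cases hz0 : z = 0
  · exact ⟨1, by simp, by simp [hz0]⟩
  · have hn : ‖z‖ ≠ 0 := norm_ne_zero_iff.2 hz0
    refine ⟨(‖z‖⁻¹ : ℝ) • z, by simp [hn], ?_⟩
    rw [mem_ball_zero_iff] at hz
    have : z - (‖z‖⁻¹ : ℝ) • z = (1 - ‖z‖⁻¹) • z := by rw [sub_smul, one_smul]
    rw [this, norm_smul, Real.norm_of_nonpos]
    · field_simp; ring
    · rw [sub_nonpos]; exact (one_le_inv₀ (norm_pos_iff.2 hz0)).2 hz.le

/-- A classical solution has bounded gradient and decays linearly at the boundary. -/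
lemma exists_gradient_bound {u : ℂ → ℝ} (hu : ContDiffOn ℝ 1 u (closedBall 0 1))
    (h0 : ∀ x ∈ sphere (0 : ℂ) 1, u x = 0) :
    ∃ M : ℝ, (∀ z ∈ ball (0 : ℂ) 1, ‖fderiv ℝ u z‖ ≤ M) ∧
      ∀ z ∈ ball (0 : ℂ) 1, |u z| ≤ M * (1 - ‖z‖) := by
  have hud : UniqueDiffOn ℝ (closedBall (0 : ℂ) 1) :=
    uniqueDiffOn_convex (convex_closedBall 0 1)
      (by rw [interior_closedBall _ one_ne_zero]; exact ⟨0, by simp⟩)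
  have hc := (hu.continuousOn_fderivWithin hud le_rfl).norm
  obtain ⟨M, hM⟩ := (isCompact_closedBall (0 : ℂ) 1).exists_bound_of_continuousOn hc
  have hM' : ∀ z ∈ closedBall (0 : ℂ) 1, ‖fderivWithin ℝ u (closedBall 0 1) z‖ ≤ M := fun z hz => by
    simpa using hM z hz
  refine ⟨M, fun z hz => ?_, fun z hz => ?_⟩
  · rw [← fderivWithin_of_mem_nhds (mem_of_superset (isOpen_ball.mem_nhds hz) ball_subset_closedBall)]
    exact hM' z (ball_subset_closedBall hz)
  · obtain ⟨p, hp, hpz⟩ := exists_sphere_dist_eq hz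
    have := (convex_closedBall (0 : ℂ) 1).norm_image_sub_le_of_norm_fderivWithin_le (𝕜 := ℝ)
      (hu.differentiableOn one_ne_zero) hM' (sphere_subset_closedBall hp) (ball_subset_closedBall hz)
    rwa [h0 p hp, sub_zero, hpz] at this

/-- The integral of `‖y - c‖ ^ (-γ)` over the ball of radius `R` about `c`. -/
noncomputable def radialMass (γ R : ℝ) : ℝ := 2 * Real.pi * (R ^ (2 - γ) / (2 - γ))

lemma radialMass_nonneg {γ R : ℝ} (hγ : γ < 2) (hR : 0 ≤ R) : 0 ≤ radialMass γ R := by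
  have : 0 < 2 - γ := by linarith
  have := Real.pi_pos
  rw [radialMass]; positivity

lemma integrableOn_norm_rpow_ball (c : ℂ) {γ R : ℝ} (hγ : γ < 2) (hR : 0 ≤ R) :
    IntegrableOn (fun y : ℂ => ‖y - c‖ ^ (-γ)) (ball c R) ∧
      ∫ y in ball c R, ‖y - c‖ ^ (-γ) = radialMass γ R := by
  set φ : ℝ → ℝ := (Iio R).indicator fun t => t ^ (-γ) with hφ
  have hind : (fun y : ℂ => φ ‖y - c‖) = (ball c R).indicator fun y => ‖y - c‖ ^ (-γ) := by
    funext y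
    simp only [hφ, indicator, mem_Iio, mem_ball_iff_norm]
  have hdim : Module.finrank ℝ ℂ - 1 = 1 := by rw [Complex.finrank_real_complex]
  have hrad : ∀ y ∈ Ioi (0 : ℝ), y ^ (Module.finrank ℝ ℂ - 1) • φ y =
      (Ioo 0 R).indicator (fun t => t ^ (1 - γ)) y := by
    intro y hy
    rw [hdim, pow_one, smul_eq_mul]
    simp only [hφ, indicator, mem_Iio, mem_Ioo, mem_Ioi.1 hy, true_and]
    split_ifs
    · rw [sub_eq_add_neg, Real.rpow_add (mem_Ioi.1 hy), Real.rpow_one]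
    · simp
  have hII : IntervalIntegrable (fun t : ℝ => t ^ (1 - γ)) volume 0 R :=
    intervalIntegral.intervalIntegrable_rpow' (by linarith)
  have hIoo : IntegrableOn (fun t : ℝ => t ^ (1 - γ)) (Ioo 0 R) :=
    (intervalIntegrable_iff_integrableOn_Ioo_of_le hR).1 hII
  have hInt : Integrable (fun y : ℂ => φ ‖y‖) := by
    rw [integrable_fun_norm_addHaar volume, integrableOn_congr_fun hrad measurableSet_Ioi]
    exact (integrable_indicator_iff measurableSet_Ioo |>.2 hIoo).integrableOn
  constructor
  · rw [← integrable_indicator_iff measurableSet_ball, ← hind]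
    exact hInt.comp_sub_right c
  · rw [← integral_indicator measurableSet_ball, ← hind,
      integral_sub_right_eq_self (fun y : ℂ => φ ‖y‖) c, integral_fun_norm_addHaar volume,
      setIntegral_congr_fun measurableSet_Ioi hrad, setIntegral_indicator measurableSet_Ioo,
      inter_eq_self_of_subset_right Ioo_subset_Ioi_self, ← integral_Ioc_eq_integral_Ioo,
      ← intervalIntegral.integral_of_le hR, integral_rpow (Or.inl (by linarith)),
      Complex.finrank_real_complex, Measure.real, Complex.volume_ball, radialMass]
    have h1 : (1 - γ + 1) = 2 - γ := by ring
    rw [h1, Real.zero_rpow (by linarith)]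
    simp
    ring

/-- Splitting a product of two singularities. -/
lemma rpow_mul_inv_le {a ρ t γ : ℝ} (hγ : 0 ≤ γ) (hρ : 0 ≤ ρ) (ht : 0 ≤ t) (hta : t < a) :
    ρ ^ (-γ) * t⁻¹ ≤ t ^ (-(γ + 1)) + (Iio a).indicator (fun t => t ^ (-(γ + 1))) ρ := by
  have hpow : ∀ r : ℝ, 0 < r → r ^ (-(γ + 1)) = r ^ (-γ) * r⁻¹ := fun r hr => by
    rw [neg_add, Real.rpow_add hr, Real.rpow_neg_one]
  have hi : 0 ≤ (Iio a).indicator (fun t : ℝ => t ^ (-(γ + 1))) ρ := by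
    rw [indicator]; split_ifs
    · positivity
    · exact le_rfl
  have ht' : 0 ≤ t ^ (-(γ + 1)) := by positivity
  rcases ht.eq_or_lt with rfl | ht0
  · rw [inv_zero, mul_zero]; linarith
  rcases le_or_gt t ρ with h | h
  · rw [hpow t ht0]
    have : ρ ^ (-γ) ≤ t ^ (-γ) := Real.rpow_le_rpow_of_nonpos ht0 h (by linarith)
    have := mul_le_mul_of_nonneg_right this (inv_nonneg.2 ht)
    linarith
  · rw [indicator_of_mem (mem_Iio.2 (h.trans hta))] at *
    rcases hρ.eq_or_lt with rfl | hρ0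
    · rcases hγ.eq_or_lt with rfl | hγ0
      · have : t ^ (-(0 + 1) : ℝ) = t⁻¹ := by rw [zero_add, Real.rpow_neg_one]
        rw [this]; simp
      · rw [Real.zero_rpow (by linarith), zero_mul]; exact add_nonneg ht' hi
    · rw [hpow ρ hρ0]
      have : t⁻¹ ≤ ρ⁻¹ := inv_anti₀ hρ0 h.le
      have := mul_le_mul_of_nonneg_left this (Real.rpow_nonneg hρ (-γ))
      linarith

lemma measurable_singular (p x : ℂ) (γ : ℝ) :
    Measurable fun y : ℂ => ‖y - p‖ ^ (-γ) * ‖y - x‖⁻¹ := by fun_prop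

/-- Integrability of a product of two singularities. -/
lemma integrableOn_rpow_mul_inv (p x : ℂ) {γ R : ℝ} (hγ : 0 ≤ γ) (hγ1 : γ < 1) (hR : 0 ≤ R) :
    IntegrableOn (fun y : ℂ => ‖y - p‖ ^ (-γ) * ‖y - x‖⁻¹) (ball x R) ∧
      ∫ y in ball x R, ‖y - p‖ ^ (-γ) * ‖y - x‖⁻¹ ≤ 2 * radialMass (γ + 1) R := by
  obtain ⟨hx1, hx2⟩ := integrableOn_norm_rpow_ball x (γ := γ + 1) (by linarith) hR
  obtain ⟨hp1, hp2⟩ := integrableOn_norm_rpow_ball p (γ := γ + 1) (by linarith) hR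
  have hle : ∀ y ∈ ball x R, ‖y - p‖ ^ (-γ) * ‖y - x‖⁻¹ ≤ ‖y - x‖ ^ (-(γ + 1)) +
      (ball p R).indicator (fun y => ‖y - p‖ ^ (-(γ + 1))) y := by
    intro y hy
    have := rpow_mul_inv_le hγ (norm_nonneg (y - p)) (norm_nonneg (y - x)) (mem_ball_iff_norm.1 hy)
    simpa only [indicator, mem_Iio, mem_ball_iff_norm] using this
  have hpi : Integrable ((ball p R).indicator (fun y => ‖y - p‖ ^ (-(γ + 1)))) :=
    (integrable_indicator_iff measurableSet_ball).2 hp1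
  have hsum : IntegrableOn (fun y => ‖y - x‖ ^ (-(γ + 1)) +
      (ball p R).indicator (fun y => ‖y - p‖ ^ (-(γ + 1))) y) (ball x R) :=
    hx1.add hpi.integrableOn
  have hInt : IntegrableOn (fun y : ℂ => ‖y - p‖ ^ (-γ) * ‖y - x‖⁻¹) (ball x R) := by
    refine Integrable.mono' hsum (measurable_singular p x γ).aestronglyMeasurable ?_
    refine (ae_restrict_iff' measurableSet_ball).2 (Eventually.of_forall fun y hy => ?_)
    rw [Real.norm_of_nonneg (by positivity)]
    exact hle y hy
  refine ⟨hInt, ?_⟩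
  calc _ ≤ ∫ y in ball x R, (‖y - x‖ ^ (-(γ + 1)) +
        (ball p R).indicator (fun y => ‖y - p‖ ^ (-(γ + 1))) y) :=
        setIntegral_mono_on hInt hsum measurableSet_ball hle
    _ = radialMass (γ + 1) R + ∫ y in ball x R,
        (ball p R).indicator (fun y => ‖y - p‖ ^ (-(γ + 1))) y := by
        rw [integral_add hx1 hpi.integrableOn, hx2]
    _ ≤ radialMass (γ + 1) R + ∫ y, (ball p R).indicator (fun y => ‖y - p‖ ^ (-(γ + 1))) y := by
        gcongr
        · exact Eventually.of_forall fun y => indicator_nonneg (fun y _ => by positivity) y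
        · exact Measure.restrict_le_self
    _ = _ := by rw [integral_indicator measurableSet_ball, hp2]; ring

lemma ball_subset_ball_two {x : ℂ} (hx : ‖x‖ ≤ 1) : ball (0 : ℂ) 1 ⊆ ball x 2 := by
  intro y hy
  rw [mem_ball_zero_iff] at hy
  rw [mem_ball_iff_norm]
  linarith [norm_sub_le y x]

lemma norm_gradKernel_le {x y : ℂ} (hx : ‖x‖ < 1) (hy : ‖y‖ < 1) :
    ‖gradKernel x y‖ ≤ 2 * ‖y - x‖⁻¹ := by
  have h1 : 1 - ‖y‖ ≤ ‖1 - x * conj y‖ := by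
    have := norm_sub_norm_le (1 : ℂ) (x * conj y)
    rw [norm_one, norm_mul, RCLike.norm_conj] at this
    nlinarith [norm_nonneg x, norm_nonneg y]
  have h2 : 0 < 1 - ‖y‖ := by linarith
  have h3 : ‖(1 - (‖y‖ : ℂ) ^ 2)‖ = 1 - ‖y‖ ^ 2 := by
    norm_cast; rw [Real.norm_of_nonneg (by nlinarith [norm_nonneg y])]
  rw [gradKernel, norm_div, norm_mul, h3, div_eq_mul_inv, mul_inv, ← mul_assoc, mul_right_comm]
  refine mul_le_mul_of_nonneg_right ?_ (by positivity)
  rw [← div_eq_mul_inv, div_le_iff₀ (by linarith)]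
  nlinarith [norm_nonneg y]

lemma greenLog_nonneg {x y : ℂ} (hx : ‖x‖ < 1) (hy : ‖y‖ < 1) : 0 ≤ greenLog x y := by
  have := mem_ball_zero_iff.1 (diskAut_mem_ball (x := -x) (by rwa [norm_neg])
    (mem_ball_zero_iff.2 hy))
  rw [greenLog, neg_nonneg]
  exact Real.log_nonpos (norm_nonneg _) this.le

lemma greenLog_eq (x y : ℂ) : greenLog x y = Real.log (‖1 - conj x * y‖ / ‖y - x‖) := by
  rw [greenLog, diskAut, norm_div, ← Real.log_inv, inv_div]
  simp [sub_eq_add_neg]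

lemma greenLog_le {x y : ℂ} (hx : ‖x‖ < 1) (hy : ‖y‖ < 1) : greenLog x y ≤ 2 * ‖y - x‖⁻¹ := by
  rw [greenLog_eq]
  refine (Real.log_le_self (by positivity)).trans ?_
  rw [div_eq_mul_inv]
  refine mul_le_mul_of_nonneg_right ?_ (by positivity)
  refine (norm_sub_le _ _).trans ?_
  rw [norm_one, norm_mul, RCLike.norm_conj]
  nlinarith [norm_nonneg x, norm_nonneg y]

lemma measurable_gradKernel : Measurable fun p : ℂ × ℂ => gradKernel p.1 p.2 := by
  unfold gradKernel
  have : Measurable fun p : ℂ × ℂ => conj p.2 := Complex.continuous_conj.measurable.comp measurable_snd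
  fun_prop

lemma measurable_greenLog (x : ℂ) : Measurable (greenLog x) := by
  unfold greenLog diskAut
  fun_prop

lemma measurable_re_mul_gradKernel (x v : ℂ) : Measurable fun y => (v * gradKernel x y).re := by
  have h1 : Measurable (gradKernel x) := by
    unfold gradKernel
    have : Measurable fun p : ℂ => conj p := Complex.continuous_conj.measurable
    fun_prop
  have h2 : Measurable fun y => v * gradKernel x y := h1.const_mul v
  exact Complex.measurable_re.comp h2

/-- The right hand side of the equation. -/
noncomputable def dens (α : ℝ) (x₀ : ℂ) (V u : ℂ → ℝ) (y : ℂ) : ℝ :=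
  ‖y - x₀‖ ^ (-(2 * α)) * V y * Real.exp (u y)

/-- A classical solution with Hölder coefficient and bounded mass. -/
structure BoundedSol (α : ℝ) (x₀ : ℂ) (b C A s : ℝ) (V u : ℂ → ℝ) : Prop where
  α_pos : 0 < α
  α_lt : α < 1 / 2
  norm_x₀ : ‖x₀‖ = 1
  b_pos : 0 < b
  A_pos : 0 < A
  s_gt : 1 / 2 < s
  s_le : s ≤ 1
  V_nonneg : ∀ y ∈ closedBall (0 : ℂ) 1, 0 ≤ V y
  V_le : ∀ y ∈ closedBall (0 : ℂ) 1, V y ≤ b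
  holder : ∀ y ∈ closedBall (0 : ℂ) 1, ∀ z ∈ closedBall (0 : ℂ) 1, |V y - V z| ≤ A * ‖y - z‖ ^ s
  contDiffAt : ∀ z ∈ ball (0 : ℂ) 1, ContDiffAt ℝ 2 u z
  continuousOn : ContinuousOn u (closedBall 0 1)
  boundary : ∀ z ∈ sphere (0 : ℂ) 1, u z = 0
  exists_bound : ∃ M : ℝ, (∀ z ∈ ball (0 : ℂ) 1, ‖fderiv ℝ u z‖ ≤ M) ∧
    ∀ z ∈ ball (0 : ℂ) 1, |u z| ≤ M * (1 - ‖z‖)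
  lap_eq : ∀ z ∈ ball (0 : ℂ) 1, lap u z = -dens α x₀ V u z
  exp_mass : ∫ y in ball (0 : ℂ) 1, ‖y - x₀‖ ^ (-(2 * α)) * Real.exp (u y) ≤ C
  mass : ∫ y in ball (0 : ℂ) 1, dens α x₀ V u y ≤ 16 * Real.pi

lemma decay_of_gradient_bound {u : ℂ → ℝ} {L : ℝ} (hu : ∀ z ∈ ball (0 : ℂ) 1, ContDiffAt ℝ 2 u z)
    (hc : ContinuousOn u (closedBall 0 1)) (h0 : ∀ z ∈ sphere (0 : ℂ) 1, u z = 0)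
    (hL : ∀ z ∈ ball (0 : ℂ) 1, ‖fderiv ℝ u z‖ ≤ L) :
    ∀ z ∈ ball (0 : ℂ) 1, |u z| ≤ L * (1 - ‖z‖) := by
  have hL0 : 0 ≤ L := (norm_nonneg _).trans (hL 0 (by simp))
  have h1 : LipschitzOnWith ⟨L, hL0⟩ u (ball 0 1) :=
    (convex_ball (0 : ℂ) 1).lipschitzOnWith_of_nnnorm_fderiv_le (𝕜 := ℝ)
      (fun z hz => (hu z hz).differentiableAt (by norm_num)) fun z hz => hL z hz
  have hcl : closure (ball (0 : ℂ) 1) = closedBall 0 1 := closure_ball 0 one_ne_zero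
  have h2 : LipschitzOnWith ⟨L, hL0⟩ u (closedBall 0 1) := by
    rw [← hcl] at hc ⊢; exact h1.closure hc
  intro z hz
  obtain ⟨p, hp, hpz⟩ := exists_sphere_dist_eq hz
  have h3 := h2.norm_sub_le (ball_subset_closedBall hz) (sphere_subset_closedBall hp)
  rwa [h0 p hp, sub_zero, hpz] at h3

/-- The constant in the estimate of the singular part of the potential. -/
noncomputable def nearConst (α b : ℝ) : ℝ := 2 * Real.pi * b * (1 + 2 / (1 - 2 * α))

/-- The constant in the gradient estimate. -/
noncomputable def gradConst (α b : ℝ) : ℝ := (nearConst α b + 16 * Real.pi) / Real.pi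

lemma nearConst_nonneg {α b : ℝ} (hα : α < 1 / 2) (hb : 0 < b) : 0 ≤ nearConst α b := by
  have : 0 < 1 - 2 * α := by linarith
  have := Real.pi_pos
  unfold nearConst; positivity

lemma gradConst_ge {α b : ℝ} (hα : α < 1 / 2) (hb : 0 < b) : 16 ≤ gradConst α b := by
  rw [gradConst, le_div_iff₀ Real.pi_pos]
  linarith [nearConst_nonneg hα hb]

namespace BoundedSol

variable {α b C A s : ℝ} {x₀ : ℂ} {V u : ℂ → ℝ}

lemma dist_pos (h : BoundedSol α x₀ b C A s V u)
    {y : ℂ} (hy : y ∈ ball (0 : ℂ) 1) : 0 < ‖y - x₀‖ := by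
  rw [mem_ball_zero_iff] at hy
  have := norm_sub_norm_le x₀ y
  rw [h.norm_x₀, norm_sub_rev] at this
  linarith

lemma dist_le (h : BoundedSol α x₀ b C A s V u)
    {y : ℂ} (hy : y ∈ closedBall (0 : ℂ) 1) : ‖y - x₀‖ ≤ 2 := by
  rw [mem_closedBall_zero_iff] at hy
  linarith [norm_sub_le y x₀, h.norm_x₀]

lemma dens_nonneg (h : BoundedSol α x₀ b C A s V u)
    {y : ℂ} (hy : y ∈ ball (0 : ℂ) 1) : 0 ≤ dens α x₀ V u y := by
  have := h.V_nonneg y (ball_subset_closedBall hy)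
  unfold dens; positivity

lemma continuousOn_V (h : BoundedSol α x₀ b C A s V u) : ContinuousOn V (closedBall 0 1) := by
  intro x hx
  have hs : 0 < s := by linarith [h.s_gt]
  rw [ContinuousWithinAt, tendsto_iff_dist_tendsto_zero]
  have h1 : Tendsto (fun y => A * ‖y - x‖ ^ s) (𝓝[closedBall 0 1] x) (𝓝 0) := by
    have : Continuous fun y : ℂ => A * ‖y - x‖ ^ s :=
      continuous_const.mul ((continuous_id.sub continuous_const).norm.rpow_const
        fun _ => Or.inr hs.le)
    have h2 := (this.tendsto x).mono_left (nhdsWithin_le_nhds (s := closedBall 0 1))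
    simpa [Real.zero_rpow hs.ne'] using h2
  refine squeeze_zero' (Eventually.of_forall fun y => dist_nonneg) ?_ h1
  filter_upwards [self_mem_nhdsWithin] with y hy
  rw [Real.dist_eq]; exact h.holder y hy x hx

lemma continuousOn_weight (h : BoundedSol α x₀ b C A s V u) :
    ContinuousOn (fun y : ℂ => ‖y - x₀‖ ^ (-(2 * α))) (ball 0 1) :=
  ContinuousOn.rpow_const (by fun_prop) fun y hy => Or.inl (h.dist_pos hy).ne'

lemma continuousOn_dens (h : BoundedSol α x₀ b C A s V u) :
    ContinuousOn (dens α x₀ V u) (ball 0 1) :=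
  (h.continuousOn_weight.mul (h.continuousOn_V.mono ball_subset_closedBall)).mul
    (h.continuousOn.mono ball_subset_closedBall).rexp

lemma aestronglyMeasurable_dens (h : BoundedSol α x₀ b C A s V u) :
    AEStronglyMeasurable (dens α x₀ V u) (volume.restrict (ball (0 : ℂ) 1)) :=
  h.continuousOn_dens.aestronglyMeasurable measurableSet_ball

lemma exists_exp_bound (h : BoundedSol α x₀ b C A s V u) :
    ∃ B : ℝ, 0 ≤ B ∧ ∀ y ∈ closedBall (0 : ℂ) 1, Real.exp (u y) ≤ B := by
  obtain ⟨B, hB⟩ := (isCompact_closedBall (0 : ℂ) 1).exists_bound_of_continuousOn h.continuousOn.rexp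
  have hB' : ∀ y ∈ closedBall (0 : ℂ) 1, Real.exp (u y) ≤ B := fun y hy =>
    (le_abs_self _).trans (hB y hy)
  exact ⟨B, (Real.exp_pos _).le.trans (hB' 0 (by simp)), hB'⟩

lemma integrableOn_weight (h : BoundedSol α x₀ b C A s V u) :
    IntegrableOn (fun y : ℂ => ‖y - x₀‖ ^ (-(2 * α))) (ball 0 1) :=
  (integrableOn_norm_rpow_ball x₀ (by linarith [h.α_lt]) zero_le_two).1.mono_set
    (ball_subset_ball_two h.norm_x₀.le)

lemma integrableOn_weight_exp (h : BoundedSol α x₀ b C A s V u) :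
    IntegrableOn (fun y : ℂ => ‖y - x₀‖ ^ (-(2 * α)) * Real.exp (u y)) (ball 0 1) := by
  obtain ⟨B, hB0, hB⟩ := h.exists_exp_bound
  refine Integrable.mono' (h.integrableOn_weight.mul_const B)
    ((h.continuousOn_weight.mul (h.continuousOn.mono ball_subset_closedBall).rexp
      ).aestronglyMeasurable measurableSet_ball) ?_
  refine (ae_restrict_iff' measurableSet_ball).2 (Eventually.of_forall fun y hy => ?_)
  rw [Real.norm_of_nonneg (by positivity)]
  exact mul_le_mul_of_nonneg_left (hB y (ball_subset_closedBall hy)) (by positivity)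

lemma dens_le (h : BoundedSol α x₀ b C A s V u) {y : ℂ} (hy : y ∈ ball (0 : ℂ) 1) :
    dens α x₀ V u y ≤ b * (‖y - x₀‖ ^ (-(2 * α)) * Real.exp (u y)) := by
  have h1 := h.V_le y (ball_subset_closedBall hy)
  rw [dens, mul_right_comm, mul_comm]
  exact mul_le_mul_of_nonneg_right h1 (by positivity)

lemma integrableOn_dens (h : BoundedSol α x₀ b C A s V u) :
    IntegrableOn (dens α x₀ V u) (ball 0 1) := by
  refine Integrable.mono' (h.integrableOn_weight_exp.const_mul b) h.aestronglyMeasurable_dens ?_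
  refine (ae_restrict_iff' measurableSet_ball).2 (Eventually.of_forall fun y hy => ?_)
  rw [Real.norm_of_nonneg (h.dens_nonneg hy)]
  exact h.dens_le hy

lemma exists_potential_bound (h : BoundedSol α x₀ b C A s V u) :
    ∃ K : ℝ, 0 ≤ K ∧ ∀ x ∈ closedBall (0 : ℂ) 1,
    IntegrableOn (fun y => dens α x₀ V u y * ‖y - x‖⁻¹) (ball 0 1) ∧
      ∫ y in ball (0 : ℂ) 1, dens α x₀ V u y * ‖y - x‖⁻¹ ≤ K := by
  obtain ⟨B, hB0, hB⟩ := h.exists_exp_bound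
  have hα : 2 * α < 1 := by linarith [h.α_lt]
  have hα0 : 0 ≤ 2 * α := by linarith [h.α_pos]
  have hb := h.b_pos
  refine ⟨b * B * (2 * radialMass (2 * α + 1) 2), mul_nonneg (by positivity)
    (mul_nonneg zero_le_two (radialMass_nonneg (by linarith) zero_le_two)), fun x hx => ?_⟩
  have hsub := ball_subset_ball_two (mem_closedBall_zero_iff.1 hx)
  obtain ⟨hi, hle⟩ := integrableOn_rpow_mul_inv x₀ x hα0 hα zero_le_two
  have hle2 : ∀ y ∈ ball (0 : ℂ) 1, dens α x₀ V u y * ‖y - x‖⁻¹ ≤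
      b * B * (‖y - x₀‖ ^ (-(2 * α)) * ‖y - x‖⁻¹) := by
    intro y hy
    have h1 : dens α x₀ V u y ≤ b * B * ‖y - x₀‖ ^ (-(2 * α)) := by
      refine (h.dens_le hy).trans ?_
      rw [mul_assoc, mul_comm B]
      exact mul_le_mul_of_nonneg_left (mul_le_mul_of_nonneg_left
        (hB y (ball_subset_closedBall hy)) (by positivity)) hb.le
    rw [← mul_assoc]
    exact mul_le_mul_of_nonneg_right h1 (by positivity)
  have hi2 : IntegrableOn (fun y => b * B * (‖y - x₀‖ ^ (-(2 * α)) * ‖y - x‖⁻¹)) (ball x 2) :=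
    hi.const_mul _
  have hInt : IntegrableOn (fun y => dens α x₀ V u y * ‖y - x‖⁻¹) (ball 0 1) := by
    refine Integrable.mono' (hi2.mono_set hsub)
      (h.aestronglyMeasurable_dens.mul (by fun_prop)) ?_
    refine (ae_restrict_iff' measurableSet_ball).2 (Eventually.of_forall fun y hy => ?_)
    rw [Real.norm_of_nonneg (mul_nonneg (h.dens_nonneg hy) (by positivity))]
    exact hle2 y hy
  refine ⟨hInt, ?_⟩
  calc _ ≤ ∫ y in ball (0 : ℂ) 1, b * B * (‖y - x₀‖ ^ (-(2 * α)) * ‖y - x‖⁻¹) :=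
        setIntegral_mono_on hInt (hi2.mono_set hsub) measurableSet_ball hle2
    _ ≤ ∫ y in ball x 2, b * B * (‖y - x₀‖ ^ (-(2 * α)) * ‖y - x‖⁻¹) :=
        setIntegral_mono_set hi2 (Eventually.of_forall fun y => by positivity)
          hsub.eventuallyLE
    _ ≤ _ := by
        rw [integral_const_mul]; gcongr

lemma integrableOn_dens_mul_inv (h : BoundedSol α x₀ b C A s V u)
    {x : ℂ} (hx : x ∈ closedBall (0 : ℂ) 1) :
    IntegrableOn (fun y => dens α x₀ V u y * ‖y - x‖⁻¹) (ball 0 1) := by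
  obtain ⟨K, -, hK⟩ := h.exists_potential_bound
  exact (hK x hx).1

lemma integrableOn_dens_greenLog (h : BoundedSol α x₀ b C A s V u)
    {x : ℂ} (hx : x ∈ ball (0 : ℂ) 1) :
    IntegrableOn (fun y => dens α x₀ V u y * greenLog x y) (ball 0 1) := by
  refine Integrable.mono' ((h.integrableOn_dens_mul_inv (ball_subset_closedBall hx)).const_mul 2)
    (h.aestronglyMeasurable_dens.mul (measurable_greenLog x).aestronglyMeasurable) ?_
  refine (ae_restrict_iff' measurableSet_ball).2 (Eventually.of_forall fun y hy => ?_)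
  rw [mem_ball_zero_iff] at hx
  have hy' := mem_ball_zero_iff.1 hy
  rw [Real.norm_of_nonneg (mul_nonneg (h.dens_nonneg hy) (greenLog_nonneg hx hy')), mul_left_comm]
  exact mul_le_mul_of_nonneg_left (greenLog_le hx hy') (h.dens_nonneg hy)

lemma abs_dens_gradKernel_le (h : BoundedSol α x₀ b C A s V u)
    {x y : ℂ} (hx : x ∈ ball (0 : ℂ) 1) (hy : y ∈ ball (0 : ℂ) 1) (v : ℂ) :
    |dens α x₀ V u y * (v * gradKernel x y).re| ≤
      2 * ‖v‖ * (dens α x₀ V u y * ‖y - x‖⁻¹) := by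
  rw [abs_mul, abs_of_nonneg (h.dens_nonneg hy), mul_left_comm]
  refine mul_le_mul_of_nonneg_left ((Complex.abs_re_le_norm _).trans ?_) (h.dens_nonneg hy)
  rw [norm_mul, mul_comm 2, mul_assoc]
  exact mul_le_mul_of_nonneg_left (norm_gradKernel_le (mem_ball_zero_iff.1 hx)
    (mem_ball_zero_iff.1 hy)) (norm_nonneg v)

lemma integrableOn_dens_gradKernel (h : BoundedSol α x₀ b C A s V u)
    {x : ℂ} (hx : x ∈ ball (0 : ℂ) 1) (v : ℂ) :
    IntegrableOn (fun y => dens α x₀ V u y * (v * gradKernel x y).re) (ball 0 1) := by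
  have h3 : AEStronglyMeasurable (fun y => dens α x₀ V u y * (v * gradKernel x y).re)
      (volume.restrict (ball (0 : ℂ) 1)) :=
    h.aestronglyMeasurable_dens.mul (measurable_re_mul_gradKernel x v).aestronglyMeasurable
  have h4 : IntegrableOn (fun y => 2 * ‖v‖ * (dens α x₀ V u y * ‖y - x‖⁻¹)) (ball 0 1) :=
    (h.integrableOn_dens_mul_inv (ball_subset_closedBall hx)).const_mul (2 * ‖v‖)
  refine Integrable.mono' h4 h3 ?_
  refine (ae_restrict_iff' measurableSet_ball).2 (Eventually.of_forall fun y hy => ?_)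
  rw [Real.norm_eq_abs]
  exact h.abs_dens_gradKernel_le hx hy v

lemma representation (h : BoundedSol α x₀ b C A s V u) {x : ℂ} (hx : x ∈ ball (0 : ℂ) 1) :
    ∫ y in ball (0 : ℂ) 1, dens α x₀ V u y * greenLog x y = 2 * Real.pi * u x := by
  obtain ⟨M, hM, hM'⟩ := h.exists_bound
  exact green_representation h.contDiffAt h.lap_eq hM hM' (mem_ball_zero_iff.1 hx)
    (h.integrableOn_dens_greenLog hx)

lemma gradient_representation (h : BoundedSol α x₀ b C A s V u)
    {x : ℂ} (hx : x ∈ ball (0 : ℂ) 1) (v : ℂ) :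
    ∫ y in ball (0 : ℂ) 1, dens α x₀ V u y * (v * gradKernel x y).re =
      2 * Real.pi * fderiv ℝ u x v := by
  obtain ⟨M, hM, hM'⟩ := h.exists_bound
  exact fderiv_representation h.contDiffAt h.lap_eq hM hM' (mem_ball_zero_iff.1 hx) v
    (h.integrableOn_dens_gradKernel hx v)

lemma nonneg (h : BoundedSol α x₀ b C A s V u) {x : ℂ} (hx : x ∈ ball (0 : ℂ) 1) : 0 ≤ u x := by
  have h1 : 0 ≤ ∫ y in ball (0 : ℂ) 1, dens α x₀ V u y * greenLog x y :=
    setIntegral_nonneg measurableSet_ball fun y hy => mul_nonneg (h.dens_nonneg hy)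
      (greenLog_nonneg (mem_ball_zero_iff.1 hx) (mem_ball_zero_iff.1 hy))
  rw [h.representation hx] at h1
  have := Real.pi_pos
  by_contra hcon
  push Not at hcon
  nlinarith

end BoundedSol

/-- `r` is the concentration scale of `u`, attained at the point `c`. -/
structure ScaledAt (α : ℝ) (x₀ : ℂ) (u : ℂ → ℝ) (r : ℝ) (c : ℂ) : Prop where
  r_pos : 0 < r
  r_lt : r < 1
  mem : c ∈ ball (0 : ℂ) 1
  weight_exp_le : ∀ x ∈ ball (0 : ℂ) 1, ‖x - x₀‖ ^ (-(2 * α)) * Real.exp (u x) ≤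
    (r ^ 2)⁻¹ * (1 + r ^ (2 * α) * ‖x - x₀‖ ^ (-(2 * α)))
  exp_le : ∀ x ∈ ball (0 : ℂ) 1, Real.exp (u x) ≤ 4 * (r ^ 2)⁻¹
  exp_ge : (r ^ 2)⁻¹ * ‖c - x₀‖ ^ (2 * α) ≤ Real.exp (u c)
  exp_ge' : (2 - 2 * α) * Real.log r⁻¹ ≤ u c

namespace BoundedSol

variable {α b C A s : ℝ} {x₀ : ℂ} {V u : ℂ → ℝ}

lemma exists_scale (h : BoundedSol α x₀ b C A s V u) {R : ℝ} (hR : 0 < R) (hR1 : R ≤ 1) :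
    (∀ x ∈ ball (0 : ℂ) 1, Real.exp (u x) ≤ 4 * (R ^ 2)⁻¹) ∨
      ∃ r c, r < R ∧ ScaledAt α x₀ u r c := by
  have hα := h.α_pos
  have hα' := h.α_lt
  set g : ℂ → ℝ := fun x => max (Real.exp (-u x / (2 - 2 * α)))
    (Real.exp (-u x / 2) * ‖x - x₀‖ ^ α) with hg
  have hgc : ContinuousOn g (closedBall 0 1) := by
    have hu := h.continuousOn
    have h1 : Continuous fun x : ℂ => ‖x - x₀‖ ^ α :=
      (continuous_id.sub continuous_const).norm.rpow_const fun _ => Or.inr hα.le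
    exact ContinuousOn.sup ((hu.neg.div_const _).rexp)
      (((hu.neg.div_const _).rexp).mul h1.continuousOn)
  obtain ⟨c, hc, hmin⟩ := (isCompact_closedBall (0 : ℂ) 1).exists_isMinOn ⟨0, by simp⟩ hgc
  have hmin' : ∀ x ∈ closedBall (0 : ℂ) 1, g c ≤ g x := fun x hx => hmin hx
  set r := g c with hr
  have hr0 : 0 < r := lt_max_of_lt_left (Real.exp_pos _)
  have hx₀ : x₀ ∈ sphere (0 : ℂ) 1 := by simp [h.norm_x₀]
  have hr1 : r ≤ 1 := by
    have h1 := hmin' x₀ (sphere_subset_closedBall hx₀)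
    simpa [hg, h.boundary x₀ hx₀, hα.ne'] using h1
  have key : ∀ x ∈ ball (0 : ℂ) 1, Real.exp (u x) ≤ (r ^ 2)⁻¹ * r ^ (2 * α) ∨
      Real.exp (u x) ≤ (r ^ 2)⁻¹ * ‖x - x₀‖ ^ (2 * α) := by
    intro x hx
    have hd := h.dist_pos hx
    rcases le_max_iff.1 (hmin' x (ball_subset_closedBall hx)) with h1 | h1
    · left
      have h2 := Real.log_le_log hr0 h1
      rw [Real.log_exp] at h2
      rw [← Real.le_log_iff_exp_le (by positivity), Real.log_mul (by positivity) (by positivity),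
        Real.log_inv, Real.log_pow, Real.log_rpow hr0]
      rw [le_div_iff₀ (by linarith)] at h2
      push_cast; nlinarith
    · right
      have h2 := Real.log_le_log hr0 h1
      rw [Real.log_mul (Real.exp_pos _).ne' (by positivity), Real.log_exp, Real.log_rpow hd] at h2
      rw [← Real.le_log_iff_exp_le (by positivity), Real.log_mul (by positivity) (by positivity),
        Real.log_inv, Real.log_pow, Real.log_rpow hd]
      push_cast; nlinarith
  have hexp : ∀ x ∈ ball (0 : ℂ) 1, Real.exp (u x) ≤ 4 * (r ^ 2)⁻¹ := by
    intro x hx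
    have hd := h.dist_pos hx
    have hd2 := h.dist_le (ball_subset_closedBall hx)
    have hp : (0 : ℝ) < (r ^ 2)⁻¹ := by positivity
    rcases key x hx with h1 | h1
    · have : r ^ (2 * α) ≤ 1 := Real.rpow_le_one hr0.le hr1 (by linarith)
      nlinarith
    · have : ‖x - x₀‖ ^ (2 * α) ≤ 2 ^ (2 : ℝ) :=
        (Real.rpow_le_rpow hd.le hd2 (by linarith)).trans
          (Real.rpow_le_rpow_of_exponent_le one_le_two (by linarith))
      norm_num at this
      nlinarith
  rcases le_or_gt R r with hRr | hRr
  · left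
    intro x hx
    refine (hexp x hx).trans ?_
    gcongr
  right
  have hc' : c ∈ ball (0 : ℂ) 1 := by
    rw [mem_ball_zero_iff]
    refine lt_of_le_of_ne (mem_closedBall_zero_iff.1 hc) fun hcon => ?_
    have h1 : (1 : ℝ) ≤ r := by
      refine le_max_of_le_left ?_
      simp [h.boundary c (by simpa using hcon)]
    linarith
  have hdc := h.dist_pos hc'
  refine ⟨r, c, hRr, hr0, hRr.trans_le hR1, hc', fun x hx => ?_, hexp, ?_, ?_⟩
  · have hd := h.dist_pos hx
    have hw : 0 < ‖x - x₀‖ ^ (-(2 * α)) := by positivity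
    have hp : (0 : ℝ) < (r ^ 2)⁻¹ := by positivity
    have hw2 : ‖x - x₀‖ ^ (-(2 * α)) * ‖x - x₀‖ ^ (2 * α) = 1 := by
      rw [← Real.rpow_add hd]; simp
    rcases key x hx with h1 | h1
    · calc _ ≤ ‖x - x₀‖ ^ (-(2 * α)) * ((r ^ 2)⁻¹ * r ^ (2 * α)) := by gcongr
        _ ≤ _ := by nlinarith
    · calc _ ≤ ‖x - x₀‖ ^ (-(2 * α)) * ((r ^ 2)⁻¹ * ‖x - x₀‖ ^ (2 * α)) := by gcongr
        _ = (r ^ 2)⁻¹ * 1 := by rw [mul_left_comm, hw2]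
        _ ≤ _ := by gcongr; have : 0 < r ^ (2 * α) := by positivity
                    nlinarith
  · have h1 : Real.exp (-u c / 2) * ‖c - x₀‖ ^ α ≤ r := le_max_right _ _
    have h2 := Real.log_le_log (by positivity) h1
    rw [Real.log_mul (Real.exp_pos _).ne' (by positivity), Real.log_exp, Real.log_rpow hdc] at h2
    rw [← Real.log_le_iff_le_exp (by positivity), Real.log_mul (by positivity) (by positivity),
      Real.log_inv, Real.log_pow, Real.log_rpow hdc]
    push_cast; nlinarith
  · have h1 : Real.exp (-u c / (2 - 2 * α)) ≤ r := le_max_left _ _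
    have h2 := Real.log_le_log (by positivity) h1
    rw [Real.log_exp, div_le_iff₀ (by linarith)] at h2
    rw [Real.log_inv]
    nlinarith

lemma near_potential (h : BoundedSol α x₀ b C A s V u) {r : ℝ} {c x : ℂ}
    (hr : ScaledAt α x₀ u r c) (hx : x ∈ closedBall (0 : ℂ) 1) :
    ∫ y in ball (0 : ℂ) 1 ∩ ball x r, dens α x₀ V u y * ‖y - x‖⁻¹ ≤ nearConst α b / r := by
  have hα := h.α_pos
  have hα' := h.α_lt
  have hb := h.b_pos
  have hr0 := hr.r_pos
  obtain ⟨hi0, h0⟩ := integrableOn_norm_rpow_ball x (γ := 1) (by norm_num) hr0.le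
  obtain ⟨hi1, h1⟩ := integrableOn_rpow_mul_inv x₀ x (γ := 2 * α) (by linarith) (by linarith) hr0.le
  have hi0' : IntegrableOn (fun y => ‖y - x‖⁻¹) (ball x r) := by
    simpa only [Real.rpow_neg_one] using hi0
  have h0' : ∫ y in ball x r, ‖y - x‖⁻¹ = 2 * Real.pi * r := by
    have : ∫ y in ball x r, ‖y - x‖⁻¹ = radialMass 1 r := by
      simpa only [Real.rpow_neg_one] using h0
    rw [this, radialMass]; norm_num
  have hI : IntegrableOn (fun y => b * (r ^ 2)⁻¹ * (‖y - x‖⁻¹ +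
      r ^ (2 * α) * (‖y - x₀‖ ^ (-(2 * α)) * ‖y - x‖⁻¹))) (ball x r) :=
    (hi0'.add (hi1.const_mul _)).const_mul _
  calc _ ≤ ∫ y in ball (0 : ℂ) 1 ∩ ball x r, b * (r ^ 2)⁻¹ * (‖y - x‖⁻¹ +
          r ^ (2 * α) * (‖y - x₀‖ ^ (-(2 * α)) * ‖y - x‖⁻¹)) := by
        refine setIntegral_mono_on ((h.integrableOn_dens_mul_inv hx).mono_set inter_subset_left)
          (hI.mono_set inter_subset_right) (measurableSet_ball.inter measurableSet_ball) ?_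
        intro y hy
        have h2 : dens α x₀ V u y ≤ b * ((r ^ 2)⁻¹ * (1 + r ^ (2 * α) * ‖y - x₀‖ ^ (-(2 * α)))) :=
          (h.dens_le hy.1).trans (mul_le_mul_of_nonneg_left (hr.weight_exp_le y hy.1) hb.le)
        calc _ ≤ b * ((r ^ 2)⁻¹ * (1 + r ^ (2 * α) * ‖y - x₀‖ ^ (-(2 * α)))) * ‖y - x‖⁻¹ :=
              mul_le_mul_of_nonneg_right h2 (by positivity)
          _ = _ := by ring
    _ ≤ ∫ y in ball x r, b * (r ^ 2)⁻¹ * (‖y - x‖⁻¹ +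
          r ^ (2 * α) * (‖y - x₀‖ ^ (-(2 * α)) * ‖y - x‖⁻¹)) :=
        setIntegral_mono_set hI (Eventually.of_forall fun y => by positivity)
          inter_subset_right.eventuallyLE
    _ = b * (r ^ 2)⁻¹ * (2 * Real.pi * r +
          r ^ (2 * α) * ∫ y in ball x r, ‖y - x₀‖ ^ (-(2 * α)) * ‖y - x‖⁻¹) := by
        rw [integral_const_mul, integral_add hi0' (hi1.const_mul _), h0', integral_const_mul]
    _ ≤ b * (r ^ 2)⁻¹ * (2 * Real.pi * r + r ^ (2 * α) * (2 * radialMass (2 * α + 1) r)) := by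
        gcongr
    _ = nearConst α b / r := by
        have h3 : r ^ (2 * α) * r ^ (2 - (2 * α + 1)) = r := by
          rw [← Real.rpow_add hr0]; ring_nf; simp
        have h4 : r ^ (2 * α) * (2 * radialMass (2 * α + 1) r) =
            4 * Real.pi * r / (1 - 2 * α) := by
          rw [radialMass]
          calc _ = 4 * Real.pi * (r ^ (2 * α) * r ^ (2 - (2 * α + 1))) / (2 - (2 * α + 1)) := by ring
            _ = _ := by rw [h3]; ring_nf
        rw [h4, nearConst]
        have : 1 - 2 * α ≠ 0 := by linarith
        field_simp
        ring

lemma potential_le (h : BoundedSol α x₀ b C A s V u) {r : ℝ} {c x : ℂ}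
    (hr : ScaledAt α x₀ u r c) (hx : x ∈ closedBall (0 : ℂ) 1) :
    ∫ y in ball (0 : ℂ) 1, dens α x₀ V u y * ‖y - x‖⁻¹ ≤ (nearConst α b + 16 * Real.pi) / r := by
  have hr0 := hr.r_pos
  have hI := h.integrableOn_dens_mul_inv hx
  rw [← integral_inter_add_sdiff (measurableSet_ball (x := x) (ε := r)) hI, add_div]
  refine add_le_add (h.near_potential hr hx) ?_
  have hI2 : IntegrableOn (fun y => r⁻¹ * dens α x₀ V u y) (ball 0 1) :=
    h.integrableOn_dens.const_mul r⁻¹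
  calc _ ≤ ∫ y in ball (0 : ℂ) 1 \ ball x r, r⁻¹ * dens α x₀ V u y := by
        refine setIntegral_mono_on (hI.mono_set sdiff_subset) (hI2.mono_set sdiff_subset)
          (measurableSet_ball.diff measurableSet_ball) fun y hy => ?_
        rw [mul_comm]
        refine mul_le_mul_of_nonneg_right ?_ (h.dens_nonneg hy.1)
        have : r ≤ ‖y - x‖ := by simpa [dist_eq_norm] using hy.2
        gcongr
    _ ≤ ∫ y in ball (0 : ℂ) 1, r⁻¹ * dens α x₀ V u y :=
        setIntegral_mono_set hI2 ((ae_restrict_iff' measurableSet_ball).2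
          (Eventually.of_forall fun y hy => mul_nonneg (by positivity) (h.dens_nonneg hy)))
          sdiff_subset.eventuallyLE
    _ ≤ _ := by
        rw [integral_const_mul, div_eq_inv_mul]
        exact mul_le_mul_of_nonneg_left h.mass (by positivity)

lemma norm_fderiv_le (h : BoundedSol α x₀ b C A s V u) {r : ℝ} {c x : ℂ}
    (hr : ScaledAt α x₀ u r c) (hx : x ∈ ball (0 : ℂ) 1) :
    ‖fderiv ℝ u x‖ ≤ gradConst α b / r := by
  have hr0 := hr.r_pos
  have hpi := Real.pi_pos
  have hN := nearConst_nonneg h.α_lt h.b_pos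
  have hΛ := gradConst_ge h.α_lt h.b_pos
  refine ContinuousLinearMap.opNorm_le_bound _ (by positivity) fun v => ?_
  have hx' := ball_subset_closedBall hx
  have h1 : |2 * Real.pi * fderiv ℝ u x v| ≤
      2 * ‖v‖ * ((nearConst α b + 16 * Real.pi) / r) := by
    rw [← h.gradient_representation hx v]
    calc |∫ y in ball (0 : ℂ) 1, dens α x₀ V u y * (v * gradKernel x y).re| ≤
        ∫ y in ball (0 : ℂ) 1, 2 * ‖v‖ * (dens α x₀ V u y * ‖y - x‖⁻¹) := by
          rw [← Real.norm_eq_abs]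
          refine norm_integral_le_of_norm_le ((h.integrableOn_dens_mul_inv hx').const_mul _) ?_
          refine (ae_restrict_iff' measurableSet_ball).2 (Eventually.of_forall fun y hy => ?_)
          exact h.abs_dens_gradKernel_le hx hy v
      _ ≤ _ := by
          rw [integral_const_mul]
          exact mul_le_mul_of_nonneg_left (h.potential_le hr hx') (by positivity)
  rw [abs_mul, abs_of_pos (by positivity)] at h1
  rw [Real.norm_eq_abs, gradConst, ← mul_le_mul_iff_of_pos_left (show 0 < 2 * Real.pi by positivity)]
  refine h1.trans_eq ?_
  field_simp

lemma le_gradConst_mul (h : BoundedSol α x₀ b C A s V u) {r : ℝ} {c x : ℂ}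
    (hr : ScaledAt α x₀ u r c) (hx : x ∈ ball (0 : ℂ) 1) :
    u x ≤ gradConst α b / r * (1 - ‖x‖) :=
  (le_abs_self _).trans (decay_of_gradient_bound h.contDiffAt h.continuousOn h.boundary
    (fun _ hz => h.norm_fderiv_le hr hz) x hx)

end BoundedSol

/-- The constant in the lower bound for the exponential mass near the concentration point. -/
noncomputable def harnackConst (α b : ℝ) : ℝ :=
  Real.pi / 8 * Real.exp (-(8 * Real.log 4 + nearConst α b / (2 * Real.pi)))

/-- The number of scales that carry a unit of mass. -/
noncomputable def concConst (α b C : ℝ) : ℝ := C / harnackConst α b + 1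

lemma harnackConst_pos (α b : ℝ) : 0 < harnackConst α b := by
  have := Real.pi_pos
  unfold harnackConst; positivity

lemma one_sub_norm_le_norm {x y : ℂ} (hy : ‖y‖ ≤ 1) : 1 - ‖x‖ ≤ ‖1 - conj x * y‖ := by
  have h1 := norm_sub_norm_le (1 : ℂ) (conj x * y)
  rw [norm_mul, Complex.norm_conj, norm_one] at h1
  nlinarith [norm_nonneg x, norm_nonneg y]

lemma greenLog_sub_le {c x y : ℂ} {R : ℝ} (hR : 0 < R) (hc : R ≤ 1 - ‖c‖) (hx : ‖x - c‖ < R / 2)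
    (hy : ‖y‖ < 1) (hyc : y ≠ c) (hyx : y ≠ x) :
    greenLog c y ≤ greenLog x y + Real.log 4 + Real.log (max (R / ‖y - c‖) 1) := by
  have hx1 : ‖x‖ ≤ 1 - R / 2 := by
    have := norm_add_le (x - c) c
    rw [sub_add_cancel] at this; linarith
  have hn1 : 0 < ‖y - c‖ := norm_pos_iff.2 (sub_ne_zero.2 hyc)
  have hn2 : 0 < ‖y - x‖ := norm_pos_iff.2 (sub_ne_zero.2 hyx)
  have h1 : R / 2 ≤ ‖1 - conj x * y‖ := by linarith [one_sub_norm_le_norm (x := x) hy.le]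
  have h2 : R ≤ ‖1 - conj c * y‖ := hc.trans (one_sub_norm_le_norm hy.le)
  have h3 : ‖1 - conj c * y‖ ≤ 2 * ‖1 - conj x * y‖ := by
    have h4 : 1 - conj c * y = (1 - conj x * y) + conj (x - c) * y := by
      rw [map_sub]; ring
    have h5 := norm_add_le (1 - conj x * y) (conj (x - c) * y)
    rw [← h4, norm_mul, Complex.norm_conj] at h5
    nlinarith [norm_nonneg (x - c), norm_nonneg y]
  have h6 : ‖y - x‖ ≤ 2 * (‖y - c‖ * max (R / ‖y - c‖) 1) := by
    have h7 : ‖y - c‖ * max (R / ‖y - c‖) 1 = max R ‖y - c‖ := by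
      rw [mul_max_of_nonneg _ _ hn1.le, mul_div_cancel₀ _ hn1.ne', mul_one]
    have h8 := norm_sub_le_norm_sub_add_norm_sub y c x
    rw [norm_sub_rev c x] at h8
    rw [h7]
    linarith [le_max_left R ‖y - c‖, le_max_right R ‖y - c‖]
  have hp1 : 0 < ‖1 - conj x * y‖ := by linarith
  have hp2 : 0 < ‖1 - conj c * y‖ := by linarith
  have hm : 0 < max (R / ‖y - c‖) 1 := lt_max_of_lt_right one_pos
  rw [greenLog_eq, greenLog_eq, ← Real.log_mul (by positivity) (by positivity),
    ← Real.log_mul (by positivity) (by positivity)]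
  refine Real.log_le_log (by positivity) ?_
  rw [div_le_iff₀ hn1]
  calc _ ≤ 2 * ‖1 - conj x * y‖ := h3
    _ = 2 * ‖1 - conj x * y‖ / ‖y - x‖ * ‖y - x‖ := by field_simp
    _ ≤ 2 * ‖1 - conj x * y‖ / ‖y - x‖ * (2 * (‖y - c‖ * max (R / ‖y - c‖) 1)) := by gcongr
    _ = _ := by ring

namespace BoundedSol

variable {α b C A s : ℝ} {x₀ : ℂ} {V u : ℂ → ℝ}

lemma ball_subset_of_le {c : ℂ} {R : ℝ} (hc : R ≤ 1 - ‖c‖) : ball c R ⊆ ball (0 : ℂ) 1 := by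
  refine ball_subset_ball' ?_
  rw [dist_zero_right]; linarith

lemma harnack (h : BoundedSol α x₀ b C A s V u) {r K : ℝ} {c x : ℂ}
    (hr : ScaledAt α x₀ u r c) (hK : 1 ≤ K) (hKr : K * r ≤ 1 - ‖c‖) (hx : x ∈ ball c (K * r / 2)) :
    2 * Real.pi * u c ≤ 2 * Real.pi * u x + 16 * Real.pi * Real.log 4 +
      Real.log K * (∫ y in ball c (K * r), dens α x₀ V u y) + nearConst α b := by
  have hr0 := hr.r_pos
  have hR : 0 < K * r := by positivity
  have hx' : ‖x - c‖ < K * r / 2 := by rwa [mem_ball, dist_eq_norm] at hx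
  have hxD : x ∈ ball (0 : ℂ) 1 := ball_subset_of_le (R := K * r / 2) (by linarith) hx
  have hlogK := Real.log_nonneg hK
  set f := dens α x₀ V u with hf
  have i0 : IntegrableOn (fun y => f y * greenLog c y) (ball 0 1) := h.integrableOn_dens_greenLog hr.mem
  have i1 : IntegrableOn (fun y => f y * greenLog x y) (ball 0 1) := h.integrableOn_dens_greenLog hxD
  have i2 : IntegrableOn (fun y => Real.log 4 * f y) (ball 0 1) := h.integrableOn_dens.const_mul _
  have i3 : IntegrableOn ((ball c (K * r)).indicator fun y => Real.log K * f y) (ball 0 1) :=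
    Integrable.indicator (h.integrableOn_dens.const_mul _) measurableSet_ball
  have i4 : IntegrableOn ((ball c r).indicator fun y => r * (f y * ‖y - c‖⁻¹)) (ball 0 1) :=
    Integrable.indicator ((h.integrableOn_dens_mul_inv (ball_subset_closedBall hr.mem)).const_mul _)
      measurableSet_ball
  have hae : ∀ᵐ y ∂(volume.restrict (ball (0 : ℂ) 1)), f y * greenLog c y ≤
      f y * greenLog x y + Real.log 4 * f y + (ball c (K * r)).indicator (fun y => Real.log K * f y) y +
        (ball c r).indicator (fun y => r * (f y * ‖y - c‖⁻¹)) y := by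
    refine (ae_restrict_iff' measurableSet_ball).2 ?_
    filter_upwards [Measure.ae_ne volume c, Measure.ae_ne volume x] with y hyc hyx hy
    have h1 := greenLog_sub_le hR hKr hx' (mem_ball_zero_iff.1 hy) hyc hyx
    have hfy : 0 ≤ f y := h.dens_nonneg hy
    have hn : 0 < ‖y - c‖ := norm_pos_iff.2 (sub_ne_zero.2 hyc)
    have h2 : Real.log (max (K * r / ‖y - c‖) 1) * f y ≤
        (ball c (K * r)).indicator (fun y => Real.log K * f y) y +
        (ball c r).indicator (fun y => r * (f y * ‖y - c‖⁻¹)) y := by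
      by_cases hy1 : y ∈ ball c (K * r)
      · rw [indicator_of_mem hy1]
        rw [mem_ball, dist_eq_norm] at hy1
        rw [max_eq_left ((one_le_div hn).2 hy1.le), mul_div_assoc,
          Real.log_mul (by positivity) (by positivity), add_mul]
        gcongr
        by_cases hy2 : y ∈ ball c r
        · rw [indicator_of_mem hy2]
          have := Real.log_le_sub_one_of_pos (show 0 < r / ‖y - c‖ by positivity)
          calc _ ≤ r / ‖y - c‖ * f y := by gcongr; linarith
            _ = _ := by ring
        · rw [indicator_of_notMem hy2]
          rw [mem_ball, dist_eq_norm, not_lt] at hy2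
          exact mul_nonpos_of_nonpos_of_nonneg (Real.log_nonpos (by positivity)
            ((div_le_one hn).2 hy2)) hfy
      · have hy2 : y ∉ ball c r := fun hcon => hy1 (ball_subset_ball (by nlinarith) hcon)
        rw [indicator_of_notMem hy1, indicator_of_notMem hy2]
        rw [mem_ball, dist_eq_norm, not_lt] at hy1
        rw [max_eq_right ((div_le_one hn).2 hy1)]
        simp
    nlinarith
  have h1 := integral_mono_ae i0 (((i1.add i2).add i3).add i4) hae
  rw [integral_add' ((i1.add i2).add i3) i4] at h1
  rw [integral_add' (i1.add i2) i3] at h1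
  rw [integral_add' i1 i2] at h1
  rw [h.representation hr.mem, h.representation hxD, setIntegral_indicator measurableSet_ball,
    setIntegral_indicator measurableSet_ball, integral_const_mul, integral_const_mul,
    integral_const_mul, inter_eq_self_of_subset_right (ball_subset_of_le hKr)] at h1
  have h2 := h.near_potential hr (ball_subset_closedBall hr.mem)
  rw [le_div_iff₀' hr0] at h2
  have h3 := mul_le_mul_of_nonneg_left h.mass (Real.log_nonneg (show (1 : ℝ) ≤ 4 by norm_num))
  linarith

lemma exp_mass_nonneg (h : BoundedSol α x₀ b C A s V u) : 0 ≤ C :=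
  le_trans (setIntegral_nonneg measurableSet_ball fun y _ => by positivity) h.exp_mass

lemma concConst_ge (h : BoundedSol α x₀ b C A s V u) : 1 ≤ concConst α b C := by
  have hC := h.exp_mass_nonneg
  have := harnackConst_pos α b
  rw [concConst, le_add_iff_nonneg_left]
  positivity

lemma one_sub_norm_le_dist (h : BoundedSol α x₀ b C A s V u) (c : ℂ) : 1 - ‖c‖ ≤ ‖c - x₀‖ := by
  have := norm_sub_norm_le x₀ c
  rwa [h.norm_x₀, norm_sub_rev] at this

lemma one_le_local_mass (h : BoundedSol α x₀ b C A s V u) {r : ℝ} {c : ℂ}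
    (hr : ScaledAt α x₀ u r c) (hKr : concConst α b C * r ≤ 1 - ‖c‖) :
    1 ≤ ∫ y in ball c (concConst α b C * r), dens α x₀ V u y := by
  by_contra! hcon
  have hK := h.concConst_ge
  set K := concConst α b C with hKdef
  have hr0 := hr.r_pos
  have hpi := Real.pi_pos
  have hα := h.α_pos
  have hα' := h.α_lt
  have hc0 := harnackConst_pos α b
  have hdc := h.dist_pos hr.mem
  have hR : 0 < K * r := by positivity
  set B := ball c (K * r / 2) with hB
  have hBD : B ⊆ ball (0 : ℂ) 1 := ball_subset_of_le (by linarith)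
  have hlow : ∀ x ∈ B, (r ^ 2)⁻¹ * (K⁻¹ * (8 / Real.pi * harnackConst α b) / 2) ≤
      ‖x - x₀‖ ^ (-(2 * α)) * Real.exp (u x) := by
    intro x hx
    have h1 := h.harnack hr hK hKr hx
    have hlogK := Real.log_nonneg hK
    have h2 : u c - Real.log K - (8 * Real.log 4 + nearConst α b / (2 * Real.pi)) ≤ u x := by
      have h3 : Real.log K * (∫ y in ball c (K * r), dens α x₀ V u y) ≤
          2 * Real.pi * Real.log K := by
        nlinarith [Real.pi_gt_three]
      have h4 : nearConst α b = 2 * Real.pi * (nearConst α b / (2 * Real.pi)) := by field_simp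
      nlinarith
    have h3 : Real.exp (u c) * K⁻¹ * (8 / Real.pi * harnackConst α b) ≤ Real.exp (u x) := by
      refine le_trans (le_of_eq ?_) (Real.exp_le_exp.2 h2)
      rw [sub_eq_add_neg, sub_eq_add_neg, Real.exp_add, Real.exp_add, Real.exp_neg (Real.log K),
        Real.exp_log (by positivity), harnackConst]
      field_simp
    have hd := h.dist_pos (hBD hx)
    have h5 : ‖x - x₀‖ ≤ 3 / 2 * ‖c - x₀‖ := by
      have h6 := norm_sub_le_norm_sub_add_norm_sub x c x₀
      rw [hB, mem_ball, dist_eq_norm] at hx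
      linarith [h.one_sub_norm_le_dist c]
    have h6 : ‖c - x₀‖ ^ (-(2 * α)) / 2 ≤ ‖x - x₀‖ ^ (-(2 * α)) := by
      have h7 : (3 / 2 * ‖c - x₀‖) ^ (-(2 * α)) ≤ ‖x - x₀‖ ^ (-(2 * α)) :=
        Real.rpow_le_rpow_of_nonpos hd h5 (by linarith)
      rw [Real.mul_rpow (by norm_num) hdc.le] at h7
      have h8 : (1 / 2 : ℝ) ≤ (3 / 2 : ℝ) ^ (-(2 * α)) := by
        rw [Real.rpow_neg (by norm_num), one_div]
        refine inv_anti₀ (by positivity) ?_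
        calc (3 / 2 : ℝ) ^ (2 * α) ≤ (3 / 2 : ℝ) ^ (1 : ℝ) :=
              Real.rpow_le_rpow_of_exponent_le (by norm_num) (by linarith)
          _ ≤ 2 := by norm_num
      have : 0 < ‖c - x₀‖ ^ (-(2 * α)) := by positivity
      nlinarith
    calc _ = ‖c - x₀‖ ^ (-(2 * α)) / 2 * (((r ^ 2)⁻¹ * ‖c - x₀‖ ^ (2 * α)) * K⁻¹ *
          (8 / Real.pi * harnackConst α b)) := by
          rw [Real.rpow_neg hdc.le]
          have : 0 < ‖c - x₀‖ ^ (2 * α) := by positivity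
          field_simp
      _ ≤ ‖c - x₀‖ ^ (-(2 * α)) / 2 * (Real.exp (u c) * K⁻¹ *
          (8 / Real.pi * harnackConst α b)) := by
          gcongr; exact hr.exp_ge
      _ ≤ ‖x - x₀‖ ^ (-(2 * α)) * Real.exp (u x) := by gcongr
  have hvol : volume.real B = Real.pi * (K * r / 2) ^ 2 := by
    rw [hB, Measure.real, Complex.volume_ball, ENNReal.toReal_mul, ENNReal.toReal_pow,
      ENNReal.toReal_ofReal (show 0 ≤ K * r / 2 by positivity), mul_comm]
    simp
  have h1 := setIntegral_ge_of_const_le_real measurableSet_ball measure_ball_lt_top.ne hlow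
    (h.integrableOn_weight_exp.mono_set hBD)
  have h2 : ∫ x in B, ‖x - x₀‖ ^ (-(2 * α)) * Real.exp (u x) ≤ C :=
    (setIntegral_mono_set h.integrableOn_weight_exp (Eventually.of_forall fun y => by positivity)
      hBD.eventuallyLE).trans h.exp_mass
  rw [← hB, hvol] at h1
  have h3 : (r ^ 2)⁻¹ * (K⁻¹ * (8 / Real.pi * harnackConst α b) / 2) * (Real.pi * (K * r / 2) ^ 2) =
      K * harnackConst α b := by
    field_simp
    norm_num
  have h4 : K * harnackConst α b = C + harnackConst α b := by
    rw [hKdef, concConst]; field_simp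
  linarith

lemma local_mass_mul_log_le (h : BoundedSol α x₀ b C A s V u) {c : ℂ} (hc : c ∈ ball (0 : ℂ) 1)
    {R : ℝ} (hR0 : 0 < R) (hR : R ≤ 1 - ‖c‖) :
    (∫ y in ball c R, dens α x₀ V u y) * Real.log ((1 - ‖c‖) / R) ≤ 2 * Real.pi * u c := by
  have hD := ball_subset_of_le hR
  have hc' := mem_ball_zero_iff.1 hc
  rw [← h.representation hc, ← integral_mul_const]
  refine le_trans ?_ (setIntegral_mono_set (h.integrableOn_dens_greenLog hc) ?_ hD.eventuallyLE)
  · refine integral_mono_ae ((h.integrableOn_dens.mono_set hD).mul_const _)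
      ((h.integrableOn_dens_greenLog hc).mono_set hD) ?_
    refine (ae_restrict_iff' measurableSet_ball).2 ?_
    filter_upwards [Measure.ae_ne volume c] with y hyc hy
    have hn : 0 < ‖y - c‖ := norm_pos_iff.2 (sub_ne_zero.2 hyc)
    refine mul_le_mul_of_nonneg_left ?_ (h.dens_nonneg (hD hy))
    have h1 := one_sub_norm_le_norm (x := c) (mem_ball_zero_iff.1 (hD hy)).le
    rw [mem_ball, dist_eq_norm] at hy
    rw [greenLog_eq]
    have : 0 < 1 - ‖c‖ := by linarith
    refine Real.log_le_log (by positivity) ?_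
    gcongr
  · exact (ae_restrict_iff' measurableSet_ball).2 (Eventually.of_forall fun y hy =>
      mul_nonneg (h.dens_nonneg hy) (greenLog_nonneg hc' (mem_ball_zero_iff.1 hy)))

end BoundedSol

lemma exists_unit_mollifier : ∃ κ : ℝ, 0 ≤ κ ∧ ∀ (U : ℂ → ℝ) (a : ℝ), Continuous U →
    (∀ x y, ‖x - y‖ ≤ 1 → |U x - U y| ≤ a) →
    ∃ W : ℂ → ℝ, ContDiff ℝ 1 W ∧ (∀ x, |U x - W x| ≤ a) ∧ ∀ x, ‖fderiv ℝ W x‖ ≤ κ * a := by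
  let ψ : ContDiffBump (0 : ℂ) := ⟨1 / 2, 1, by norm_num, by norm_num⟩
  set f : ℂ → ℝ := ψ.normed volume with hf
  have hfs : HasCompactSupport f := ψ.hasCompactSupport_normed
  have hfc : ContDiff ℝ 1 f := ψ.contDiff_normed
  have hf' : Continuous (fderiv ℝ f) := hfc.continuous_fderiv one_ne_zero
  have hfs' : HasCompactSupport (fderiv ℝ f) := hfs.fderiv ℝ
  have hfi : Integrable fun t => ‖fderiv ℝ f t‖ :=
    (hf'.integrable_of_hasCompactSupport hfs').norm
  have hsupp : ∀ t, 1 < ‖t‖ → fderiv ℝ f t = 0 := by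
    intro t ht
    have h1 : tsupport f = closedBall 0 1 := ψ.tsupport_normed_eq
    refine Function.notMem_support.1 fun hcon => ?_
    have h2 := support_fderiv_subset ℝ hcon
    rw [h1, mem_closedBall_zero_iff] at h2
    linarith
  refine ⟨∫ t, ‖fderiv ℝ f t‖, integral_nonneg fun _ => norm_nonneg _, fun U a hU hosc => ?_⟩
  have ha : 0 ≤ a := (abs_nonneg _).trans (hosc 0 0 (by simp))
  set L := ContinuousLinearMap.lsmul ℝ ℝ (E := ℝ) with hL
  refine ⟨convolution f U L volume, ?_, fun x => ?_, fun x => ?_⟩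
  · exact hfs.contDiff_convolution_left L hfc hU.locallyIntegrable
  · rw [abs_sub_comm, ← Real.dist_eq]
    refine ψ.dist_normed_convolution_le hU.aestronglyMeasurable fun y hy => ?_
    rw [Real.dist_eq]
    refine hosc y x ?_
    rw [← dist_eq_norm]; exact (mem_ball.1 hy).le
  · set G : ℂ → ℝ := fun y => U y - U x with hG
    have hGc : Continuous G := hU.sub continuous_const
    have h1 : convolution f U L volume = fun z => convolution f G L volume z + U x := by
      ext z
      have e1 : convolution f (fun _ => U x) L volume z = U x := by
        simp only [convolution_def, hL, ContinuousLinearMap.lsmul_apply, smul_eq_mul]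
        rw [integral_mul_const, hf, ψ.integral_normed, one_mul]
      have e2 : U = G + fun _ => U x := by ext y; simp [hG]
      conv_lhs => rw [e2]
      rw [ConvolutionExistsAt.distrib_add]
      · rw [e1]
      · exact hfs.convolutionExists_left L hfc.continuous hGc.locallyIntegrable z
      · exact hfs.convolutionExists_left L hfc.continuous continuous_const.locallyIntegrable z
    have h2 := hfs.hasFDerivAt_convolution_left L hfc hGc.locallyIntegrable (μ := volume) x
    rw [h1, fderiv_add_const, h2.fderiv, convolution_def]
    rw [← integral_mul_const]
    refine norm_integral_le_of_norm_le (hfi.mul_const a) (Eventually.of_forall fun t => ?_)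
    refine ContinuousLinearMap.opNorm_le_bound _ (by positivity) fun v => ?_
    rw [ContinuousLinearMap.precompL_apply, hL, ContinuousLinearMap.lsmul_apply, smul_eq_mul, norm_mul]
    by_cases ht : ‖t‖ ≤ 1
    · have h3 : ‖G (x - t)‖ ≤ a := by
        rw [hG, Real.norm_eq_abs]; exact hosc _ _ (by simpa using ht)
      calc _ ≤ ‖fderiv ℝ f t‖ * ‖v‖ * a := by
            gcongr; exact ContinuousLinearMap.le_opNorm _ _
        _ = _ := by ring
    · rw [hsupp t (not_le.1 ht)]; simp

/-- The radial retraction onto the closed unit disk. -/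
noncomputable def retract (x : ℂ) : ℂ := (max 1 ‖x‖)⁻¹ • x

lemma retract_mem (x : ℂ) : retract x ∈ closedBall (0 : ℂ) 1 := by
  have h1 : 0 < max 1 ‖x‖ := lt_max_of_lt_left one_pos
  rw [mem_closedBall_zero_iff, retract, norm_smul, norm_inv, Real.norm_of_nonneg h1.le,
    inv_mul_le_one₀ h1]
  exact le_max_right _ _

lemma retract_of_mem {x : ℂ} (hx : x ∈ closedBall (0 : ℂ) 1) : retract x = x := by
  rw [mem_closedBall_zero_iff] at hx
  rw [retract, max_eq_left hx]; simp

lemma norm_retract_sub_le (x y : ℂ) : ‖retract x - retract y‖ ≤ 2 * ‖x - y‖ := by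
  set m := max 1 ‖x‖ with hm
  set n := max 1 ‖y‖ with hn
  have hm1 : 1 ≤ m := le_max_left _ _
  have hn1 : 1 ≤ n := le_max_left _ _
  have hm0 : m ≠ 0 := by positivity
  have hn0 : n ≠ 0 := by positivity
  have hy : ‖y‖ ≤ n := le_max_right _ _
  have e : retract x - retract y = m⁻¹ • (x - y) + ((n - m) * (m⁻¹ * n⁻¹)) • y := by
    have : (n - m) * (m⁻¹ * n⁻¹) = m⁻¹ - n⁻¹ := by field_simp
    rw [this, retract, retract, smul_sub, sub_smul]; abel
  have hnm : |n - m| ≤ ‖x - y‖ := by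
    rw [hm, hn, abs_sub_comm]
    exact (abs_max_sub_max_le_max 1 ‖x‖ 1 ‖y‖).trans (by simpa using abs_norm_sub_norm_le x y)
  rw [e, two_mul]
  refine (norm_add_le _ _).trans (add_le_add ?_ ?_)
  · rw [norm_smul, Real.norm_of_nonneg (by positivity)]
    exact mul_le_of_le_one_left (norm_nonneg _) (inv_le_one_of_one_le₀ hm1)
  · rw [norm_smul, norm_mul, Real.norm_eq_abs, Real.norm_of_nonneg (by positivity)]
    calc _ = |n - m| * (m⁻¹ * (n⁻¹ * ‖y‖)) := by ring
      _ ≤ |n - m| * 1 := by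
          refine mul_le_mul_of_nonneg_left ?_ (abs_nonneg _)
          refine mul_le_one₀ (inv_le_one_of_one_le₀ hm1) (by positivity) ?_
          rw [inv_mul_le_one₀ (by positivity)]; exact hy
      _ ≤ _ := by linarith

lemma exists_mollifier : ∃ κ : ℝ, 0 ≤ κ ∧ ∀ (V : ℂ → ℝ) (A s η : ℝ), 0 ≤ A → 0 < s → s ≤ 1 →
    0 < η → ContinuousOn V (closedBall 0 1) →
    (∀ y ∈ closedBall (0 : ℂ) 1, ∀ z ∈ closedBall (0 : ℂ) 1, |V y - V z| ≤ A * ‖y - z‖ ^ s) →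
    ∃ W : ℂ → ℝ, ContDiff ℝ 1 W ∧
      (∀ y ∈ closedBall (0 : ℂ) 1, |V y - W y| ≤ κ * (A * η ^ s)) ∧
      ∀ y, ‖fderiv ℝ W y‖ ≤ κ * (A * η ^ s) / η := by
  obtain ⟨κ, hκ, hmol⟩ := exists_unit_mollifier
  refine ⟨2 * (κ + 1), by positivity, fun V A s η hA hs hs1 hη hVc hV => ?_⟩
  have hrc : Continuous retract := by
    refine LipschitzWith.continuous (K := 2) (LipschitzWith.of_dist_le_mul fun x y => ?_)
    simpa [dist_eq_norm] using norm_retract_sub_le x y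
  have hUc : Continuous fun y : ℂ => V (retract (η • y)) :=
    hVc.comp_continuous (hrc.comp (continuous_const_smul η)) fun y => retract_mem _
  have hηs : 0 < η ^ s := by positivity
  obtain ⟨W, hW, hWV, hWd⟩ := hmol (fun y => V (retract (η • y))) (2 * (A * η ^ s)) hUc (by
    intro x y hxy
    refine (hV _ (retract_mem _) _ (retract_mem _)).trans ?_
    have h1 : ‖retract (η • x) - retract (η • y)‖ ≤ 2 * η := by
      refine (norm_retract_sub_le _ _).trans ?_
      rw [← smul_sub, norm_smul, Real.norm_of_nonneg hη.le]
      nlinarith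
    have h2 : ‖retract (η • x) - retract (η • y)‖ ^ s ≤ 2 * η ^ s := by
      refine (Real.rpow_le_rpow (norm_nonneg _) h1 hs.le).trans ?_
      rw [Real.mul_rpow zero_le_two hη.le]
      gcongr
      calc (2 : ℝ) ^ s ≤ 2 ^ (1 : ℝ) := Real.rpow_le_rpow_of_exponent_le one_le_two hs1
        _ = 2 := by norm_num
    nlinarith)
  refine ⟨fun y => W (η⁻¹ • y), hW.comp (contDiff_const_smul _), fun y hy => ?_, fun y => ?_⟩
  · have h1 := hWV (η⁻¹ • y)
    rw [smul_inv_smul₀ hη.ne', retract_of_mem hy] at h1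
    refine h1.trans ?_
    nlinarith [mul_nonneg hκ (mul_nonneg hA hηs.le)]
  · have h1 : HasFDerivAt (fun y : ℂ => W (η⁻¹ • y))
        ((fderiv ℝ W (η⁻¹ • y)).comp (η⁻¹ • ContinuousLinearMap.id ℝ ℂ)) y :=
      HasFDerivAt.comp y ((hW.differentiable one_ne_zero).differentiableAt.hasFDerivAt)
        ((hasFDerivAt_id y).const_smul η⁻¹)
    rw [h1.fderiv, div_eq_inv_mul]
    refine ContinuousLinearMap.opNorm_le_bound _ (by positivity) fun v => ?_
    have h2 := ContinuousLinearMap.le_of_opNorm_le _ (hWd (η⁻¹ • y)) (η⁻¹ • v)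
    rw [norm_smul, Real.norm_of_nonneg (by positivity : 0 ≤ η⁻¹)] at h2
    refine h2.trans ?_
    calc _ = η⁻¹ * (κ * (2 * (A * η ^ s))) * ‖v‖ := by ring
      _ ≤ _ := by
        refine mul_le_mul_of_nonneg_right (mul_le_mul_of_nonneg_left ?_ (by positivity))
          (norm_nonneg v)
        nlinarith [mul_nonneg hA hηs.le]

namespace BoundedSol

variable {α b C A s : ℝ} {x₀ : ℂ} {V u : ℂ → ℝ}

lemma integrable_prod_singular (h : BoundedSol α x₀ b C A s V u) (Ξ : ℝ) :
    Integrable (fun p : ℂ × ℂ => dens α x₀ V u p.1 * (Ξ * (dens α x₀ V u p.2 * ‖p.2 - p.1‖⁻¹)))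
      ((volume.restrict (ball (0 : ℂ) 1)).prod (volume.restrict (ball 0 1))) := by
  obtain ⟨K, hK0, hK⟩ := h.exists_potential_bound
  have hf := h.aestronglyMeasurable_dens
  have hm : AEStronglyMeasurable
      (fun p : ℂ × ℂ => dens α x₀ V u p.1 * (Ξ * (dens α x₀ V u p.2 * ‖p.2 - p.1‖⁻¹)))
      ((volume.restrict (ball (0 : ℂ) 1)).prod (volume.restrict (ball 0 1))) := by
    have h1 : Measurable fun p : ℂ × ℂ => ‖p.2 - p.1‖⁻¹ := by fun_prop
    exact hf.comp_fst.mul ((hf.comp_snd.mul h1.aestronglyMeasurable).const_mul Ξ)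
  rw [integrable_prod_iff hm]
  constructor
  · refine (ae_restrict_iff' measurableSet_ball).2 (Eventually.of_forall fun x hx => ?_)
    exact ((hK x (ball_subset_closedBall hx)).1.const_mul Ξ).const_mul (dens α x₀ V u x)
  · have hm2 : AEStronglyMeasurable (fun x => ∫ y in ball (0 : ℂ) 1,
        ‖dens α x₀ V u x * (Ξ * (dens α x₀ V u y * ‖y - x‖⁻¹))‖) (volume.restrict (ball 0 1)) :=
      hm.norm.integral_prod_right'
    refine Integrable.mono' (h.integrableOn_dens.mul_const (|Ξ| * K)) hm2 ?_
    refine (ae_restrict_iff' measurableSet_ball).2 (Eventually.of_forall fun x hx => ?_)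
    have hfx := h.dens_nonneg hx
    have e : ∀ y ∈ ball (0 : ℂ) 1, ‖dens α x₀ V u x * (Ξ * (dens α x₀ V u y * ‖y - x‖⁻¹))‖ =
        dens α x₀ V u x * |Ξ| * (dens α x₀ V u y * ‖y - x‖⁻¹) := by
      intro y hy
      have hfy := h.dens_nonneg hy
      rw [norm_mul, norm_mul, Real.norm_of_nonneg hfx, Real.norm_eq_abs Ξ,
        Real.norm_of_nonneg (by positivity), mul_assoc]
    rw [setIntegral_congr_fun measurableSet_ball e, integral_const_mul, ← mul_assoc,
      Real.norm_of_nonneg (mul_nonneg (by positivity) (setIntegral_nonneg measurableSet_ball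
        fun y hy => mul_nonneg (h.dens_nonneg hy) (by positivity)))]
    exact mul_le_mul_of_nonneg_left (hK x (ball_subset_closedBall hx)).2 (by positivity)

/-- The symmetrized interaction kernel of a vector field. -/
noncomputable def _root_.symKernel (X : ℂ → ℂ) (x y : ℂ) : ℝ :=
  (X x * gradKernel x y).re + (X y * gradKernel y x).re

lemma virial_ge (h : BoundedSol α x₀ b C A s V u) {X : ℂ → ℂ} {Ξ E : ℝ} {φ χ : ℂ → ℝ}
    (hX : ContinuousOn X (ball 0 1)) (hXb : ∀ x ∈ ball (0 : ℂ) 1, ‖X x‖ ≤ Ξ)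
    (hφ0 : ∀ x ∈ ball (0 : ℂ) 1, 0 ≤ φ x) (hχ0 : ∀ x ∈ ball (0 : ℂ) 1, 0 ≤ χ x) (hE : 0 ≤ E)
    (hφi : IntegrableOn (fun x => dens α x₀ V u x * φ x) (ball 0 1))
    (hχi : IntegrableOn (fun x => dens α x₀ V u x * χ x) (ball 0 1))
    (hker : ∀ x ∈ ball (0 : ℂ) 1, ∀ y ∈ ball (0 : ℂ) 1, x ≠ y →
      -(φ x * χ y + E) ≤ symKernel X x y) :
    -((∫ x in ball (0 : ℂ) 1, dens α x₀ V u x * φ x) *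
      (∫ x in ball (0 : ℂ) 1, dens α x₀ V u x * χ x)) -
      E * (∫ x in ball (0 : ℂ) 1, dens α x₀ V u x) ^ 2 ≤
    4 * Real.pi * ∫ x in ball (0 : ℂ) 1, dens α x₀ V u x * fderiv ℝ u x (X x) := by
  set f := dens α x₀ V u with hfdef
  set μ : Measure ℂ := volume.restrict (ball (0 : ℂ) 1) with hμ
  have hf : AEStronglyMeasurable f μ := h.aestronglyMeasurable_dens
  have hfi : Integrable f μ := h.integrableOn_dens
  have hXm : AEStronglyMeasurable X μ := hX.aestronglyMeasurable measurableSet_ball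
  have hprod : ∀ {P : ℂ × ℂ → Prop}, (∀ x ∈ ball (0 : ℂ) 1, ∀ y ∈ ball (0 : ℂ) 1, P (x, y)) →
      ∀ᵐ p ∂(μ.prod μ), P p := by
    intro P hP
    rw [hμ, Measure.prod_restrict]
    exact (ae_restrict_iff' (measurableSet_ball.prod measurableSet_ball)).2
      (Eventually.of_forall fun p hp => hP p.1 hp.1 p.2 hp.2)
  set T : ℂ × ℂ → ℝ := fun p => f p.1 * (f p.2 * (X p.1 * gradKernel p.1 p.2).re) with hT
  have hTm : AEStronglyMeasurable T (μ.prod μ) := by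
    have h1 : AEStronglyMeasurable (fun p : ℂ × ℂ => X p.1 * gradKernel p.1 p.2) (μ.prod μ) :=
      hXm.comp_fst.mul measurable_gradKernel.aestronglyMeasurable
    have h2 : AEStronglyMeasurable (fun p : ℂ × ℂ => (X p.1 * gradKernel p.1 p.2).re) (μ.prod μ) :=
      Complex.continuous_re.comp_aestronglyMeasurable h1
    exact hf.comp_fst.mul (hf.comp_snd.mul h2)
  have hTi : Integrable T (μ.prod μ) := by
    refine Integrable.mono' (h.integrable_prod_singular (2 * Ξ)) hTm (hprod fun x hx y hy => ?_)
    have hfx : 0 ≤ f x := h.dens_nonneg hx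
    have hfy : 0 ≤ f y := h.dens_nonneg hy
    rw [hT, norm_mul, Real.norm_of_nonneg hfx]
    refine mul_le_mul_of_nonneg_left ((h.abs_dens_gradKernel_le hx hy (X x)).trans ?_) hfx
    have := hXb x hx
    gcongr
  have hTint : ∫ p, T p ∂(μ.prod μ) =
      2 * Real.pi * ∫ x in ball (0 : ℂ) 1, f x * fderiv ℝ u x (X x) := by
    rw [integral_prod _ hTi, ← integral_const_mul]
    refine setIntegral_congr_fun measurableSet_ball fun x hx => ?_
    simp only [hT]
    rw [integral_const_mul, h.gradient_representation hx]
    ring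
  have hTs : Integrable (fun p : ℂ × ℂ => T p.swap) (μ.prod μ) := hTi.swap
  have hTsint : ∫ p, T p.swap ∂(μ.prod μ) = ∫ p, T p ∂(μ.prod μ) := integral_prod_swap T
  have hg1 : Integrable (fun p : ℂ × ℂ => (f p.1 * φ p.1) * (f p.2 * χ p.2)) (μ.prod μ) :=
    Integrable.mul_prod (f := fun x => f x * φ x) (g := fun x => f x * χ x) hφi hχi
  have hg1n : Integrable (fun p : ℂ × ℂ => -((f p.1 * φ p.1) * (f p.2 * χ p.2))) (μ.prod μ) :=
    hg1.neg
  have hg2 : Integrable (fun p : ℂ × ℂ => f p.1 * f p.2) (μ.prod μ) := hfi.mul_prod hfi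
  have hle : ∫ p, (-((f p.1 * φ p.1) * (f p.2 * χ p.2)) - E * (f p.1 * f p.2)) ∂(μ.prod μ) ≤
      ∫ p, (T p + T p.swap) ∂(μ.prod μ) := by
    refine integral_mono_ae (hg1n.sub (hg2.const_mul E)) (hTi.add hTs)
      (hprod fun x hx y hy => ?_)
    have hfx : 0 ≤ f x := h.dens_nonneg hx
    have hfy : 0 ≤ f y := h.dens_nonneg hy
    have h1 : -(φ x * χ y + E) ≤ symKernel X x y := by
      by_cases hxy : x = y
      · have h2 : symKernel X x y = 0 := by simp [symKernel, hxy, gradKernel]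
        rw [h2, neg_nonpos]
        exact add_nonneg (mul_nonneg (hφ0 x hx) (hχ0 y hy)) hE
      · exact hker x hx y hy hxy
    have h2 := mul_le_mul_of_nonneg_left h1 (mul_nonneg hfx hfy)
    simp only [hT, Prod.swap_prod_mk, symKernel] at h2 ⊢
    linarith
  rw [integral_add hTi hTs, hTsint, hTint, integral_sub hg1n (hg2.const_mul E), integral_neg,
    integral_const_mul, integral_prod_mul (fun x => f x * φ x) (fun x => f x * χ x),
    integral_prod_mul f f] at hle
  rw [pow_two]
  linarith

end BoundedSol

/-- The divergence of a planar vector field. -/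
noncomputable def divergence (X : ℂ → ℂ) (x : ℂ) : ℝ :=
  (fderiv ℝ X x 1).re + (fderiv ℝ X x Complex.I).im

lemma clm_apply_eq_re_im (L : ℂ →L[ℝ] ℝ) (v : ℂ) : L v = v.re * L 1 + v.im * L Complex.I := by
  conv_lhs => rw [← Complex.re_add_im v]
  have h1 : ((v.re : ℂ) + v.im * Complex.I) = v.re • (1 : ℂ) + v.im • Complex.I := by simp
  rw [h1, map_add, map_smul, map_smul, smul_eq_mul, smul_eq_mul]

lemma divergence_smul {g : ℂ → ℝ} {X : ℂ → ℂ} {x : ℂ} (hg : DifferentiableAt ℝ g x)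
    (hX : DifferentiableAt ℝ X x) :
    divergence (fun z => g z • X z) x = g x * divergence X x + fderiv ℝ g x (X x) := by
  have h1 := hg.hasFDerivAt.smul hX.hasFDerivAt
  have h2 : fderiv ℝ (fun z => g z • X z) x = g x • fderiv ℝ X x +
      (fderiv ℝ g x).smulRight (X x) := h1.fderiv
  rw [divergence, h2, clm_apply_eq_re_im _ (X x)]
  simp [divergence]
  ring

lemma integral_fderiv_apply_eq_zero {H : ℂ → ℝ} (hH : ContDiff ℝ 1 H) (hs : HasCompactSupport H)
    (v : ℂ) : ∫ x, fderiv ℝ H x v = 0 := by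
  have h1 : Integrable fun x => fderiv ℝ H x v := by
    refine Continuous.integrable_of_hasCompactSupport
      ((hH.continuous_fderiv one_ne_zero).clm_apply continuous_const) ?_
    exact (hs.fderiv_apply ℝ v)
  have h2 := integral_mul_fderiv_eq_neg_fderiv_mul_of_integrable (μ := volume)
    (f := fun _ : ℂ => (1 : ℝ)) (g := H) (v := v) (by simp) (by simpa using h1)
    (by simpa using hH.continuous.integrable_of_hasCompactSupport hs)
    (fun x _ => differentiableAt_const _) (fun x _ => hH.differentiable one_ne_zero x)
  simpa using h2

lemma integral_divergence_eq_zero {H : ℂ → ℂ} (hH : ContDiff ℝ 1 H) (hs : HasCompactSupport H) :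
    ∫ x, divergence H x = 0 := by
  have hre : ContDiff ℝ 1 fun x => (H x).re := Complex.reCLM.contDiff.comp hH
  have him : ContDiff ℝ 1 fun x => (H x).im := Complex.imCLM.contDiff.comp hH
  have hres : HasCompactSupport fun x => (H x).re := hs.comp_left (g := Complex.re) rfl
  have hims : HasCompactSupport fun x => (H x).im := hs.comp_left (g := Complex.im) rfl
  have e : ∀ x, divergence H x = fderiv ℝ (fun x => (H x).re) x 1 +
      fderiv ℝ (fun x => (H x).im) x Complex.I := by
    intro x
    have hd := (hH.differentiable one_ne_zero x).hasFDerivAt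
    have h1 : fderiv ℝ (fun x => (H x).re) x = Complex.reCLM.comp (fderiv ℝ H x) :=
      (Complex.reCLM.hasFDerivAt.comp x hd).fderiv
    have h2 : fderiv ℝ (fun x => (H x).im) x = Complex.imCLM.comp (fderiv ℝ H x) :=
      (Complex.imCLM.hasFDerivAt.comp x hd).fderiv
    rw [h1, h2, divergence]; rfl
  have i1 : Integrable fun x => fderiv ℝ (fun x => (H x).re) x 1 :=
    Continuous.integrable_of_hasCompactSupport
      ((hre.continuous_fderiv one_ne_zero).clm_apply continuous_const) (hres.fderiv_apply ℝ 1)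
  have i2 : Integrable fun x => fderiv ℝ (fun x => (H x).im) x Complex.I :=
    Continuous.integrable_of_hasCompactSupport
      ((him.continuous_fderiv one_ne_zero).clm_apply continuous_const)
      (hims.fderiv_apply ℝ Complex.I)
  simp only [e]
  rw [integral_add i1 i2, integral_fderiv_apply_eq_zero hre hres,
    integral_fderiv_apply_eq_zero him hims, add_zero]

lemma exists_deriv_smoothTransition_bound :
    ∃ L : ℝ, 0 ≤ L ∧ ∀ t, |deriv Real.smoothTransition t| ≤ L := by
  have hc : Continuous (deriv Real.smoothTransition) :=
    (Real.smoothTransition.contDiff (n := 1)).continuous_deriv le_rfl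
  obtain ⟨L, hL⟩ := (isCompact_Icc (a := (0 : ℝ)) (b := 1)).exists_bound_of_continuousOn hc.continuousOn
  have hL0 : 0 ≤ L := (norm_nonneg _).trans (hL 0 (by simp))
  refine ⟨L, hL0, fun t => ?_⟩
  by_cases ht : t ∈ Icc (0 : ℝ) 1
  · exact hL t ht
  · have h0 : deriv Real.smoothTransition t = 0 := by
      rw [mem_Icc, not_and_or, not_le, not_le] at ht
      rcases ht with ht | ht
      · have : Real.smoothTransition =ᶠ[𝓝 t] fun _ => 0 := by
          filter_upwards [Iio_mem_nhds ht] with z hz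
          exact Real.smoothTransition.zero_of_nonpos (le_of_lt hz)
        rw [this.deriv_eq, deriv_const]
      · have : Real.smoothTransition =ᶠ[𝓝 t] fun _ => 1 := by
          filter_upwards [Ioi_mem_nhds ht] with z hz
          exact Real.smoothTransition.one_of_one_le (le_of_lt hz)
        rw [this.deriv_eq, deriv_const]
    rwa [h0, abs_zero]

/-- A smooth cutoff function vanishing near the boundary of the unit disk. -/
noncomputable def diskCutoff (n : ℕ) (x : ℂ) : ℝ := Real.smoothTransition (n * (1 - ‖x‖ ^ 2) - 1)

lemma contDiff_diskCutoff (n : ℕ) : ContDiff ℝ 1 (diskCutoff n) := by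
  have h1 : ContDiff ℝ 1 fun x : ℂ => (n : ℝ) * (1 - ‖x‖ ^ 2) - 1 :=
    (contDiff_const.mul (contDiff_const.sub (contDiff_norm_sq ℝ))).sub contDiff_const
  exact (Real.smoothTransition.contDiff (n := 1)).comp h1

lemma diskCutoff_eq_zero {n : ℕ} {x : ℂ} (hx : n * (1 - ‖x‖ ^ 2) ≤ 1) : diskCutoff n x = 0 :=
  Real.smoothTransition.zero_of_nonpos (by linarith)

lemma diskCutoff_eventuallyEq_one {n : ℕ} {x : ℂ} (hx : 2 < n * (1 - ‖x‖ ^ 2)) :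
    diskCutoff n =ᶠ[𝓝 x] fun _ => 1 := by
  have h1 : Continuous fun x : ℂ => (n : ℝ) * (1 - ‖x‖ ^ 2) := by fun_prop
  filter_upwards [(h1.tendsto x).eventually (lt_mem_nhds hx)] with z hz
  exact Real.smoothTransition.one_of_one_le (by linarith)

lemma norm_fderiv_diskCutoff_le {L : ℝ}
    (hL : ∀ t, |deriv Real.smoothTransition t| ≤ L) (n : ℕ) (x : ℂ) :
    ‖fderiv ℝ (diskCutoff n) x‖ ≤ L * (2 * n * ‖x‖) := by
  have h1 : HasFDerivAt (fun x : ℂ => (n : ℝ) * (1 - ‖x‖ ^ 2) - 1)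
      ((n : ℝ) • -((2 : ℝ) • innerSL ℝ x)) x := by
    have h2 : HasFDerivAt (fun x : ℂ => ‖x‖ ^ 2) ((2 : ℝ) • innerSL ℝ x) x := by
      simpa [two_smul] using (hasStrictFDerivAt_norm_sq x).hasFDerivAt
    exact ((h2.const_sub 1).const_mul (n : ℝ)).sub_const 1
  have h3 : HasDerivAt Real.smoothTransition
      (deriv Real.smoothTransition ((n : ℝ) * (1 - ‖x‖ ^ 2) - 1)) ((n : ℝ) * (1 - ‖x‖ ^ 2) - 1) :=
    ((Real.smoothTransition.contDiff (n := 1)).differentiable one_ne_zero _).hasDerivAt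
  have h4 := (h3.comp_hasFDerivAt x h1).fderiv
  have h5 : fderiv ℝ (diskCutoff n) x =
      deriv Real.smoothTransition ((n : ℝ) * (1 - ‖x‖ ^ 2) - 1) •
        ((n : ℝ) • -((2 : ℝ) • innerSL ℝ x)) := h4
  rw [h5, norm_smul, norm_smul, norm_neg, norm_smul, innerSL_apply_norm, Real.norm_eq_abs,
    Real.norm_natCast, Real.norm_of_nonneg zero_le_two]
  calc _ ≤ L * (n * (2 * ‖x‖)) := by gcongr; exact hL _
    _ = _ := by ring

lemma integral_cutoff_divergence {g : ℂ → ℝ} {Y : ℂ → ℂ}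
    (hg : ContDiffOn ℝ 1 g (ball 0 1)) (hY : ContDiffOn ℝ 1 Y (ball 0 1)) (n : ℕ) :
    ∫ x in ball (0 : ℂ) 1, (diskCutoff n x * (g x * divergence Y x + fderiv ℝ g x (Y x)) +
      g x * fderiv ℝ (diskCutoff n) x (Y x)) = 0 := by
  set H : ℂ → ℂ := fun z => diskCutoff n z • (g z • Y z) with hH
  have hzero : ∀ x, n * (1 - ‖x‖ ^ 2) < 1 → H =ᶠ[𝓝 x] fun _ => 0 := by
    intro x hx
    have h1 : Continuous fun x : ℂ => (n : ℝ) * (1 - ‖x‖ ^ 2) := by fun_prop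
    filter_upwards [(h1.tendsto x).eventually (gt_mem_nhds hx)] with z hz
    simp [hH, diskCutoff_eq_zero hz.le]
  have hout : ∀ x ∉ ball (0 : ℂ) 1, n * (1 - ‖x‖ ^ 2) < 1 := by
    intro x hx
    rw [mem_ball_zero_iff, not_lt] at hx
    have : 1 - ‖x‖ ^ 2 ≤ 0 := by nlinarith
    have := mul_nonpos_of_nonneg_of_nonpos (Nat.cast_nonneg (α := ℝ) n) this
    linarith
  have hat : ∀ {E : Type} [NormedAddCommGroup E] [NormedSpace ℝ E] {k : ℂ → E},
      ContDiffOn ℝ 1 k (ball 0 1) → ∀ x ∈ ball (0 : ℂ) 1, ContDiffAt ℝ 1 k x :=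
    fun hk x hx => hk.contDiffAt (isOpen_ball.mem_nhds hx)
  have hHc : ContDiff ℝ 1 H := by
    rw [contDiff_iff_contDiffAt]
    intro x
    by_cases hx : x ∈ ball (0 : ℂ) 1
    · exact (contDiff_diskCutoff n).contDiffAt.smul ((hat hg x hx).smul (hat hY x hx))
    · exact (contDiffAt_const (c := (0 : ℂ))).congr_of_eventuallyEq (hzero x (hout x hx))
  have hHs : HasCompactSupport H := by
    refine HasCompactSupport.intro (isCompact_closedBall (0 : ℂ) 1) fun x hx => ?_
    exact (hzero x (hout x fun hcon => hx (ball_subset_closedBall hcon))).self_of_nhds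
  have h1 := integral_divergence_eq_zero hHc hHs
  rw [← setIntegral_eq_integral_of_forall_compl_eq_zero (s := ball (0 : ℂ) 1)] at h1
  · rw [← h1]
    refine setIntegral_congr_fun measurableSet_ball fun x hx => ?_
    have hgd := (hat hg x hx).differentiableAt one_ne_zero
    have hYd := (hat hY x hx).differentiableAt one_ne_zero
    have hcd := (contDiff_diskCutoff n).differentiable one_ne_zero x
    have hgY : DifferentiableAt ℝ (fun z => g z • Y z) x := hgd.smul hYd
    simp only [hH]
    rw [divergence_smul hcd hgY, divergence_smul hgd hYd, map_smul, smul_eq_mul]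
  · intro x hx
    rw [divergence, (hzero x (hout x hx)).fderiv_eq]
    simp

theorem integral_by_parts_disk {g : ℂ → ℝ} {Y : ℂ → ℂ} {M : ℝ}
    (hg : ContDiffOn ℝ 1 g (ball 0 1)) (hY : ContDiffOn ℝ 1 Y (ball 0 1))
    (hM : ∀ x ∈ ball (0 : ℂ) 1, |g x| ≤ M * (1 - ‖x‖))
    (hYi : IntegrableOn (fun x => ‖Y x‖) (ball 0 1))
    (h1i : IntegrableOn (fun x => g x * divergence Y x) (ball 0 1))
    (h2i : IntegrableOn (fun x => fderiv ℝ g x (Y x)) (ball 0 1)) :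
    ∫ x in ball (0 : ℂ) 1, fderiv ℝ g x (Y x) = -∫ x in ball (0 : ℂ) 1, g x * divergence Y x := by
  obtain ⟨L, hL0, hL⟩ := exists_deriv_smoothTransition_bound
  have hM0 : 0 ≤ M := by simpa using (abs_nonneg _).trans (hM 0 (by simp))
  have hlim := tendsto_integral_of_dominated_convergence (μ := volume.restrict (ball (0 : ℂ) 1))
    (F := fun (n : ℕ) x => diskCutoff n x * (g x * divergence Y x + fderiv ℝ g x (Y x)) +
      g x * fderiv ℝ (diskCutoff n) x (Y x))
    (f := fun x => g x * divergence Y x + fderiv ℝ g x (Y x))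
    (fun x => |g x * divergence Y x + fderiv ℝ g x (Y x)| + M * (4 * L) * ‖Y x‖) ?_ ?_ ?_ ?_
  · simp only [integral_cutoff_divergence hg hY] at hlim
    have h1 := tendsto_nhds_unique hlim tendsto_const_nhds
    rw [integral_add h1i h2i] at h1
    linarith
  · intro n
    refine ((contDiff_diskCutoff n).continuous.aestronglyMeasurable.mul
      (h1i.add h2i).aestronglyMeasurable).add ?_
    refine ContinuousOn.aestronglyMeasurable ?_ measurableSet_ball
    exact hg.continuousOn.mul (((contDiff_diskCutoff n).continuous_fderiv
      one_ne_zero).continuousOn.clm_apply hY.continuousOn)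
  · exact (h1i.add h2i).abs.add (hYi.const_mul _)
  · intro n
    refine (ae_restrict_iff' measurableSet_ball).2 (Eventually.of_forall fun x hx => ?_)
    have hx' := mem_ball_zero_iff.1 hx
    refine (norm_add_le _ _).trans (add_le_add ?_ ?_)
    · have hc : 0 ≤ diskCutoff n x := Real.smoothTransition.nonneg _
      rw [norm_mul, Real.norm_of_nonneg hc, Real.norm_eq_abs]
      exact mul_le_of_le_one_left (abs_nonneg _) (Real.smoothTransition.le_one _)
    · by_cases hn : 2 < n * (1 - ‖x‖ ^ 2)
      · rw [(diskCutoff_eventuallyEq_one hn).fderiv_eq]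
        simp
        positivity
      · rw [norm_mul, Real.norm_eq_abs]
        have h1 := ContinuousLinearMap.le_of_opNorm_le _
          (norm_fderiv_diskCutoff_le hL n x) (Y x)
        have h0 := norm_nonneg x
        calc _ ≤ M * (1 - ‖x‖) * (L * (2 * n * ‖x‖) * ‖Y x‖) :=
              mul_le_mul (hM x hx) h1 (norm_nonneg _) (mul_nonneg hM0 (by linarith))
          _ = M * (2 * L) * ((1 - ‖x‖) * (n * ‖x‖)) * ‖Y x‖ := by ring
          _ ≤ M * (2 * L) * 2 * ‖Y x‖ := by
              gcongr
              push Not at hn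
              refine le_trans ?_ hn
              rw [mul_left_comm]
              exact mul_le_mul_of_nonneg_left (by nlinarith) (Nat.cast_nonneg n)
          _ = _ := by ring
  · refine (ae_restrict_iff' measurableSet_ball).2 (Eventually.of_forall fun x hx => ?_)
    have hx' := mem_ball_zero_iff.1 hx
    have hp : 0 < 1 - ‖x‖ ^ 2 := by nlinarith [norm_nonneg x]
    refine tendsto_const_nhds.congr' ?_
    have h1 : ∀ᶠ n : ℕ in atTop, 2 < (n : ℝ) * (1 - ‖x‖ ^ 2) :=
      (tendsto_natCast_atTop_atTop.atTop_mul_const hp).eventually_gt_atTop 2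
    filter_upwards [h1] with n hn
    have h2 := diskCutoff_eventuallyEq_one hn
    rw [h2.fderiv_eq, h2.self_of_nhds]
    simp

/-- The divergence of a vector field with respect to the weight `‖x - x₀‖ ^ (-2α)`. -/
noncomputable def weightedDiv (α : ℝ) (x₀ : ℂ) (X : ℂ → ℂ) (x : ℂ) : ℝ :=
  divergence X x - 2 * α * ((X x * conj (x - x₀)).re / ‖x - x₀‖ ^ 2)

lemma hasFDerivAt_norm_sub_rpow {p x : ℂ} (hx : x ≠ p) (γ : ℝ) :
    ContDiffAt ℝ 1 (fun y : ℂ => ‖y - p‖ ^ γ) x ∧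
      ∀ v, fderiv ℝ (fun y : ℂ => ‖y - p‖ ^ γ) x v =
        ‖x - p‖ ^ γ * (γ * ((v * conj (x - p)).re / ‖x - p‖ ^ 2)) := by
  have hne : x - p ≠ 0 := sub_ne_zero.2 hx
  have hpos : 0 < ‖x - p‖ := norm_pos_iff.2 hne
  have e : (fun y : ℂ => ‖y - p‖ ^ γ) = fun y : ℂ => (‖y - p‖ ^ 2) ^ (γ / 2) := by
    funext y
    rw [← Real.rpow_natCast, ← Real.rpow_mul (norm_nonneg _)]
    congr 1; push_cast; ring
  have hsq : ‖x - p‖ ^ 2 ≠ 0 := by positivity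
  have h2 : HasFDerivAt (fun x : ℂ => ‖x - p‖ ^ 2) ((2 : ℝ) • innerSL ℝ (x - p)) x := by
    have h3 : HasFDerivAt (fun x : ℂ => ‖x‖ ^ 2) ((2 : ℝ) • innerSL ℝ (x - p)) (x - p) := by
      simpa [two_smul] using (hasStrictFDerivAt_norm_sq (x - p)).hasFDerivAt
    have h4 := h3.comp x ((hasFDerivAt_id x).sub_const p)
    rw [ContinuousLinearMap.comp_id] at h4
    exact h4
  constructor
  · rw [e]
    have : ContDiffAt ℝ 1 (fun y : ℂ => ‖y - p‖ ^ 2) x :=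
      ((contDiff_norm_sq ℝ).comp (contDiff_id.sub contDiff_const)).contDiffAt
    exact this.rpow_const_of_ne hsq
  · intro v
    have h5 := (h2.rpow_const (p := γ / 2) (Or.inl hsq)).fderiv
    rw [e, h5]
    have h6 : inner ℝ (x - p) v = (v * conj (x - p)).re := by
      rw [real_inner_comm, Complex.inner, mul_comm]; simp; ring
    have h7 : (‖x - p‖ ^ 2) ^ (γ / 2 - 1) = ‖x - p‖ ^ γ / ‖x - p‖ ^ 2 := by
      rw [Real.rpow_sub (by positivity), Real.rpow_one, ← Real.rpow_natCast,
        ← Real.rpow_mul (norm_nonneg _)]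
      congr 2; push_cast; ring
    simp only [_root_.smul_apply, innerSL_apply_apply, h6, h7, smul_eq_mul]
    ring

namespace BoundedSol

variable {α b C A s : ℝ} {x₀ : ℂ} {V u : ℂ → ℝ}

lemma ne_of_mem (h : BoundedSol α x₀ b C A s V u) {x : ℂ} (hx : x ∈ ball (0 : ℂ) 1) : x ≠ x₀ :=
  sub_ne_zero.1 (norm_pos_iff.1 (h.dist_pos hx))

lemma continuousOn_weightedDiv (h : BoundedSol α x₀ b C A s V u) {X : ℂ → ℂ}
    (hX : ContDiffOn ℝ 1 X (ball 0 1)) : ContinuousOn (weightedDiv α x₀ X) (ball 0 1) := by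
  have h1 : ContinuousOn (fderiv ℝ X) (ball 0 1) :=
    hX.continuousOn_fderiv_of_isOpen isOpen_ball le_rfl
  have hX' := hX.continuousOn
  have h2 : ContinuousOn (fun x => (X x * conj (x - x₀)).re / ‖x - x₀‖ ^ 2) (ball 0 1) := by
    refine ContinuousOn.div ?_ (by fun_prop) fun x hx => pow_ne_zero _ (h.dist_pos hx).ne'
    exact Complex.continuous_re.comp_continuousOn (hX'.mul
      (Complex.continuous_conj.comp_continuousOn (by fun_prop)))
  have h3 : ContinuousOn (divergence X) (ball 0 1) :=
    (Complex.continuous_re.comp_continuousOn (h1.clm_apply continuousOn_const)).add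
      (Complex.continuous_im.comp_continuousOn (h1.clm_apply continuousOn_const))
  exact h3.sub (continuousOn_const.mul h2)

lemma divergence_weight_smul (h : BoundedSol α x₀ b C A s V u) {X : ℂ → ℂ} {W : ℂ → ℝ}
    (hX : ContDiffOn ℝ 1 X (ball 0 1)) (hW : ContDiff ℝ 1 W) {x : ℂ} (hx : x ∈ ball (0 : ℂ) 1) :
    divergence (fun z => (‖z - x₀‖ ^ (-(2 * α)) * W z) • X z) x =
      ‖x - x₀‖ ^ (-(2 * α)) * (W x * weightedDiv α x₀ X x + fderiv ℝ W x (X x)) := by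
  obtain ⟨h1, h2⟩ := hasFDerivAt_norm_sub_rpow (h.ne_of_mem hx) (-(2 * α))
  have hw := h1.differentiableAt one_ne_zero
  have hWd := hW.differentiable one_ne_zero x
  have hXd := (hX.contDiffAt (isOpen_ball.mem_nhds hx)).differentiableAt one_ne_zero
  have hwW : DifferentiableAt ℝ (fun z => ‖z - x₀‖ ^ (-(2 * α)) * W z) x := hw.mul hWd
  rw [divergence_smul hwW hXd, fderiv_fun_mul hw hWd]
  simp only [_root_.add_apply, _root_.smul_apply, smul_eq_mul, h2,
    weightedDiv]
  ring

end BoundedSol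

open BoundedSol in
/-- The Pohozaev identity, with the error made by replacing the coefficient by a mollification. -/
theorem exists_pohozaev : ∃ κ : ℝ, 0 ≤ κ ∧ ∀ {α b C A s : ℝ} {x₀ : ℂ} {V u : ℂ → ℝ},
    BoundedSol α x₀ b C A s V u → ∀ {r : ℝ} {c : ℂ}, ScaledAt α x₀ u r c →
    ∀ {X : ℂ → ℂ} {Ξ N : ℝ}, ContDiffOn ℝ 1 X (ball 0 1) → 0 ≤ Ξ → 0 ≤ N →
    (∀ x ∈ ball (0 : ℂ) 1, ‖X x‖ ≤ Ξ) →
    (∀ x ∈ ball (0 : ℂ) 1,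
      (Real.exp (u x) - 1) * |weightedDiv α x₀ X x| ≤ N / r * Real.exp (u x)) →
    IntegrableOn (fun x => (Real.exp (u x) - 1) * V x * ‖x - x₀‖ ^ (-(2 * α)) *
      weightedDiv α x₀ X x) (ball 0 1) ∧
    (∫ x in ball (0 : ℂ) 1, (Real.exp (u x) - 1) * V x * ‖x - x₀‖ ^ (-(2 * α)) *
      weightedDiv α x₀ X x) ≤
      -(∫ x in ball (0 : ℂ) 1, dens α x₀ V u x * fderiv ℝ u x (X x)) +
      κ * A * C * (Ξ * gradConst α b + Ξ + N) * r ^ (s - 1) := by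
  obtain ⟨κ, hκ, hmol⟩ := exists_mollifier
  refine ⟨κ, hκ, ?_⟩
  intro α b C A s x₀ V u h r c hr X Ξ N hX hΞ hN hXb hdiv
  have hr0 := hr.r_pos
  obtain ⟨W, hWc, hWV, hWd⟩ := hmol V A s r h.A_pos.le (by linarith [h.s_gt]) h.s_le hr0
    h.continuousOn_V h.holder
  have hsub : ball (0 : ℂ) 1 ⊆ closedBall 0 1 := ball_subset_closedBall
  obtain ⟨BW, hBW⟩ := (isCompact_closedBall (0 : ℂ) 1).exists_bound_of_continuousOn
    hWc.continuous.continuousOn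
  have hBW0 : 0 ≤ BW := (norm_nonneg _).trans (hBW 0 (by simp))
  set w : ℂ → ℝ := fun x => ‖x - x₀‖ ^ (-(2 * α)) with hw
  set d := weightedDiv α x₀ X with hd
  have hw0 : ∀ x, 0 ≤ w x := fun x => by positivity
  have hwc : ContinuousOn w (ball 0 1) := h.continuousOn_weight
  have hdc : ContinuousOn d (ball 0 1) := h.continuousOn_weightedDiv hX
  have huc : ContinuousOn u (ball 0 1) := h.continuousOn.mono hsub
  have hVc : ContinuousOn V (ball 0 1) := h.continuousOn_V.mono hsub
  have hu2 : ContDiffOn ℝ 2 u (ball 0 1) := fun x hx => (h.contDiffAt x hx).contDiffWithinAt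
  have hu1 : ContDiffOn ℝ 1 u (ball 0 1) := hu2.of_le (by norm_num)
  have hfu : ContinuousOn (fderiv ℝ u) (ball 0 1) :=
    hu1.continuousOn_fderiv_of_isOpen isOpen_ball le_rfl
  have hufX : ContinuousOn (fun x => fderiv ℝ u x (X x)) (ball 0 1) :=
    hfu.clm_apply hX.continuousOn
  have hWfX : ContinuousOn (fun x => fderiv ℝ W x (X x)) (ball 0 1) :=
    (hWc.continuous_fderiv one_ne_zero).continuousOn.clm_apply hX.continuousOn
  have hg0 : ∀ x ∈ ball (0 : ℂ) 1, 0 ≤ Real.exp (u x) - 1 := fun x hx => by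
    linarith [Real.add_one_le_exp (u x), h.nonneg hx]
  have hΛ := gradConst_ge h.α_lt h.b_pos
  set Λ := gradConst α b with hΛd
  have hI := h.integrableOn_weight_exp
  -- dominated functions are integrable
  have hdom : ∀ {F : ℂ → ℝ} (Q : ℝ), ContinuousOn F (ball 0 1) →
      (∀ x ∈ ball (0 : ℂ) 1, |F x| ≤ Q * (w x * Real.exp (u x))) → IntegrableOn F (ball 0 1) := by
    intro F Q hF hFb
    refine Integrable.mono' (hI.const_mul Q) (hF.aestronglyMeasurable measurableSet_ball) ?_
    exact (ae_restrict_iff' measurableSet_ball).2 (Eventually.of_forall fun x hx => hFb x hx)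
  have hderu : ∀ x ∈ ball (0 : ℂ) 1, |fderiv ℝ u x (X x)| ≤ Λ / r * Ξ := fun x hx =>
    ((fderiv ℝ u x).le_opNorm (X x)).trans (mul_le_mul (h.norm_fderiv_le hr hx) (hXb x hx)
      (norm_nonneg _) (by positivity))
  set τ := κ * (A * r ^ s) with hτ
  have hτ0 : 0 ≤ τ := by have := h.A_pos; positivity
  have hderW : ∀ x ∈ ball (0 : ℂ) 1, |fderiv ℝ W x (X x)| ≤ τ / r * Ξ := fun x hx =>
    ((fderiv ℝ W x).le_opNorm (X x)).trans (mul_le_mul (hWd x) (hXb x hx)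
      (norm_nonneg _) (by positivity))
  set Y : ℂ → ℂ := fun z => (w z * W z) • X z with hY
  set g : ℂ → ℝ := fun x => Real.exp (u x) - 1 with hg
  have hgle : ∀ x, g x ≤ Real.exp (u x) := fun x => by simp [hg]
  have hgc : ContinuousOn g (ball 0 1) := huc.rexp.sub continuousOn_const
  have hdivY : ∀ x ∈ ball (0 : ℂ) 1, divergence Y x = w x * (W x * d x + fderiv ℝ W x (X x)) :=
    fun x hx => h.divergence_weight_smul hX hWc hx
  have hfg : ∀ x ∈ ball (0 : ℂ) 1, fderiv ℝ g x (Y x) =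
      Real.exp (u x) * (w x * W x * fderiv ℝ u x (X x)) := by
    intro x hx
    have h1 : HasFDerivAt g (Real.exp (u x) • fderiv ℝ u x) x :=
      (((h.contDiffAt x hx).differentiableAt (by norm_num)).hasFDerivAt.exp).sub_const 1
    rw [h1.fderiv, _root_.smul_apply, smul_eq_mul, hY, map_smul, smul_eq_mul]
  have hbF1 : ∀ x ∈ ball (0 : ℂ) 1, |dens α x₀ V u x * fderiv ℝ u x (X x)| ≤
      b * (Λ / r * Ξ) * (w x * Real.exp (u x)) := by
    intro x hx
    have h1 := h.dens_le hx
    rw [abs_mul, abs_of_nonneg (h.dens_nonneg hx)]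
    refine (mul_le_mul h1 (hderu x hx) (abs_nonneg _) ?_).trans_eq (by ring)
    have := h.b_pos; positivity
  have hF1 : IntegrableOn (fun x => dens α x₀ V u x * fderiv ℝ u x (X x)) (ball 0 1) :=
    hdom _ (h.continuousOn_dens.mul hufX) hbF1
  have hgd : ∀ x ∈ ball (0 : ℂ) 1, |g x * d x| ≤ N / r * Real.exp (u x) := fun x hx => by
    rw [abs_mul, abs_of_nonneg (hg0 x hx)]; exact hdiv x hx
  have hmulw : ∀ {a B e : ℝ} (x : ℂ), |a| ≤ B * Real.exp (u x) → |e| ≤ b →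
      |a * e * w x| ≤ b * B * (w x * Real.exp (u x)) := by
    intro a B e x ha he
    rw [abs_mul, abs_mul, abs_of_nonneg (hw0 x)]
    calc _ ≤ B * Real.exp (u x) * b * w x := by
          gcongr
          · exact (abs_nonneg _).trans ha
      _ = _ := by ring
  have hF2 : IntegrableOn (fun x => g x * V x * w x * d x) (ball 0 1) := by
    refine hdom (b * (N / r)) (((hgc.mul hVc).mul hwc).mul hdc) fun x hx => ?_
    have h1 : g x * V x * w x * d x = g x * d x * V x * w x := by ring
    rw [h1]
    refine hmulw x (hgd x hx) ?_
    rw [abs_of_nonneg (h.V_nonneg x (hsub hx))]; exact h.V_le x (hsub hx)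
  have hG2 : IntegrableOn (fun x => fderiv ℝ g x (Y x)) (ball 0 1) := by
    refine IntegrableOn.congr_fun (f := fun x => Real.exp (u x) * (w x * W x * fderiv ℝ u x (X x)))
      (hdom (BW * (Λ / r * Ξ)) (huc.rexp.mul
      ((hwc.mul hWc.continuous.continuousOn).mul hufX)) fun x hx => ?_)
      (fun x hx => (hfg x hx).symm) measurableSet_ball
    have h1 := hBW x (hsub hx)
    rw [Real.norm_eq_abs] at h1
    rw [abs_mul, abs_mul, abs_mul, abs_of_nonneg (hw0 x), Real.abs_exp]
    have h2 := hw0 x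
    calc _ ≤ Real.exp (u x) * (w x * BW * (Λ / r * Ξ)) := by
          gcongr
          exact hderu x hx
      _ = _ := by ring
  have hG1 : IntegrableOn (fun x => g x * divergence Y x) (ball 0 1) := by
    refine IntegrableOn.congr_fun (f := fun x => g x * (w x * (W x * d x + fderiv ℝ W x (X x))))
      (hdom (BW * (N / r) + τ / r * Ξ) (hgc.mul (hwc.mul
      ((hWc.continuous.continuousOn.mul hdc).add hWfX))) fun x hx => ?_)
      (fun x hx => by simp only [hdivY x hx]) measurableSet_ball
    have h1 := hBW x (hsub hx)
    rw [Real.norm_eq_abs] at h1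
    have e : g x * (w x * (W x * d x + fderiv ℝ W x (X x))) =
      w x * (W x * (g x * d x)) + w x * (g x * fderiv ℝ W x (X x)) := by ring
    rw [e]
    refine (abs_add_le _ _).trans ?_
    rw [abs_mul, abs_mul, abs_mul (w x), abs_mul (g x) (fderiv ℝ W x (X x)),
      abs_of_nonneg (hw0 x), abs_of_nonneg (hg0 x hx)]
    have h2 := hw0 x
    calc _ ≤ w x * (BW * (N / r * Real.exp (u x))) + w x * (Real.exp (u x) * (τ / r * Ξ)) := by
          gcongr
          · exact hgd x hx
          · exact hgle x
          · exact hderW x hx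
      _ = _ := by ring
  have hYi : IntegrableOn (fun x => ‖Y x‖) (ball 0 1) := by
    refine hdom (BW * Ξ) (((hwc.mul hWc.continuous.continuousOn).smul hX.continuousOn).norm)
      fun x hx => ?_
    have h1 := hBW x (hsub hx)
    rw [abs_norm, hY, norm_smul, norm_mul, Real.norm_of_nonneg (hw0 x)]
    have h2 := hw0 x
    have h3 : 1 ≤ Real.exp (u x) := by linarith [hg0 x hx]
    calc _ ≤ w x * BW * Ξ := by
          gcongr
          exact hXb x hx
      _ = BW * Ξ * (w x * 1) := by ring
      _ ≤ _ := by gcongr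
  obtain ⟨M, hM1, hM2⟩ := h.exists_bound
  obtain ⟨B, hB0, hB⟩ := h.exists_exp_bound
  have hparts := integral_by_parts_disk (g := g) (Y := Y) (M := B * M)
    (hu1.exp.sub contDiffOn_const)
    (((ContDiffOn.mul (fun x hx => (hasFDerivAt_norm_sub_rpow (h.ne_of_mem hx)
      (-(2 * α))).1.contDiffWithinAt) hWc.contDiffOn).smul hX)) (fun x hx => by
      rw [abs_of_nonneg (hg0 x hx)]
      have h1 := Real.one_sub_le_exp_neg (u x)
      have h2 : Real.exp (u x) * Real.exp (-u x) = 1 := by rw [← Real.exp_add]; simp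
      have h3 : g x ≤ Real.exp (u x) * u x := by
        have := mul_le_mul_of_nonneg_left h1 (Real.exp_pos (u x)).le
        simp only [hg]; linarith
      refine h3.trans ?_
      rw [mul_assoc]
      exact mul_le_mul (hB x (hsub hx)) ((le_abs_self _).trans (hM2 x hx)) (h.nonneg hx) hB0)
    hYi hG1 hG2
  refine ⟨hF2, ?_⟩
  have hkey : (∫ x in ball (0 : ℂ) 1, g x * V x * w x * d x) +
      (∫ x in ball (0 : ℂ) 1, dens α x₀ V u x * fderiv ℝ u x (X x)) =
      ∫ x in ball (0 : ℂ) 1, ((g x * V x * w x * d x + dens α x₀ V u x * fderiv ℝ u x (X x)) -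
        (g x * divergence Y x + fderiv ℝ g x (Y x))) := by
    have e := integral_sub (hF2.add hF1) (hG1.add hG2)
    have e1 := integral_add hF2 hF1
    have e2 := integral_add hG1 hG2
    simp only [Pi.add_apply] at e
    rw [e, e1, e2, hparts]
    ring
  have herr : ∀ x ∈ ball (0 : ℂ) 1,
      ((g x * V x * w x * d x + dens α x₀ V u x * fderiv ℝ u x (X x)) -
        (g x * divergence Y x + fderiv ℝ g x (Y x))) ≤
      τ / r * (Ξ * Λ + Ξ + N) * (w x * Real.exp (u x)) := by
    intro x hx
    rw [hdivY x hx, hfg x hx]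
    have hVW := hWV x (hsub hx)
    have e : (g x * V x * w x * d x + dens α x₀ V u x * fderiv ℝ u x (X x)) -
        (g x * (w x * (W x * d x + fderiv ℝ W x (X x))) +
          Real.exp (u x) * (w x * W x * fderiv ℝ u x (X x))) =
        w x * ((V x - W x) * (g x * d x)) +
        w x * ((V x - W x) * (Real.exp (u x) * fderiv ℝ u x (X x))) -
        w x * (g x * fderiv ℝ W x (X x)) := by
      simp only [dens, hw]; ring
    rw [e]
    have h2 := hw0 x
    have hge := hg0 x hx
    have a1 : (V x - W x) * (g x * d x) ≤ τ * (N / r * Real.exp (u x)) :=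
      (le_abs_self _).trans (by rw [abs_mul]; gcongr; exact hgd x hx)
    have a2 : (V x - W x) * (Real.exp (u x) * fderiv ℝ u x (X x)) ≤
        τ * (Real.exp (u x) * (Λ / r * Ξ)) :=
      (le_abs_self _).trans (by
        rw [abs_mul, abs_mul, Real.abs_exp]; gcongr; exact hderu x hx)
    have a3 : -(g x * fderiv ℝ W x (X x)) ≤ Real.exp (u x) * (τ / r * Ξ) :=
      (neg_le_abs _).trans (by
        rw [abs_mul, abs_of_nonneg (a := g x) hge]; gcongr
        · exact hgle x
        · exact hderW x hx)
    have b1 := mul_le_mul_of_nonneg_left a1 h2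
    have b2 := mul_le_mul_of_nonneg_left a2 h2
    have b3 := mul_le_mul_of_nonneg_left a3 h2
    calc _ ≤ w x * (τ * (N / r * Real.exp (u x))) + w x * (τ * (Real.exp (u x) * (Λ / r * Ξ))) +
          w x * (Real.exp (u x) * (τ / r * Ξ)) := by linarith
      _ = _ := by ring
  have hfin := setIntegral_mono_on ((hF2.add hF1).sub (hG1.add hG2))
    (hI.const_mul (τ / r * (Ξ * Λ + Ξ + N))) measurableSet_ball herr
  have hrs : τ / r = κ * A * r ^ (s - 1) := by
    rw [hτ, Real.rpow_sub_one hr0.ne']; ring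
  rw [integral_const_mul] at hfin
  have hC := mul_le_mul_of_nonneg_left h.exp_mass
    (show 0 ≤ τ / r * (Ξ * Λ + Ξ + N) by positivity)
  have hend : τ / r * (Ξ * Λ + Ξ + N) * C = κ * A * C * (Ξ * Λ + Ξ + N) * r ^ (s - 1) := by
    rw [hrs]; ring
  have := hkey.trans_le (hfin.trans (hC.trans_eq hend))
  linarith

/-- The Moebius field fixing the boundary points `q` and `-q`. -/
noncomputable def moebiusField (q z : ℂ) : ℂ := (z - q) * (z + q) * conj q / 2

/-- The boundary field with a singularity of its divergence at `q`. -/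
noncomputable def boundaryField (q z : ℂ) : ℂ :=
  (‖z - -q‖ ^ (1 : ℝ) * ‖z - q‖ ^ (-1 : ℝ)) • moebiusField q z

lemma conj_mul_self_of_norm_eq_one {q : ℂ} (hq : ‖q‖ = 1) : conj q * q = 1 := by
  rw [Complex.conj_mul']; simp [hq]

lemma ne_of_norm_lt_one {q z : ℂ} (hq : ‖q‖ = 1) (hz : ‖z‖ < 1) : z ≠ q := by
  rintro rfl; linarith

lemma norm_boundaryField_le {q z : ℂ} (hq : ‖q‖ = 1) (hz : ‖z‖ < 1) :
    ‖boundaryField q z‖ ≤ 2 := by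
  have h1 : 0 < ‖z - q‖ := norm_pos_iff.2 (sub_ne_zero.2 (ne_of_norm_lt_one hq hz))
  have h2 : ‖z + q‖ ≤ 2 := by linarith [norm_add_le z q]
  rw [boundaryField, moebiusField, norm_smul, norm_mul, Real.norm_of_nonneg (by positivity),
    Real.norm_of_nonneg (by positivity), sub_neg_eq_add, Real.rpow_one, Real.rpow_neg_one,
    norm_div, norm_mul, norm_mul, Complex.norm_conj, hq, Complex.norm_two]
  calc _ = ‖z + q‖ * ‖z + q‖ / 2 := by field_simp
    _ ≤ _ := by nlinarith [norm_nonneg (z + q)]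

lemma contDiff_moebiusField (q : ℂ) : ContDiff ℝ 1 (moebiusField q) := by
  unfold moebiusField
  exact (((contDiff_id.sub contDiff_const).mul (contDiff_id.add contDiff_const)).mul
    contDiff_const).div_const 2

lemma divergence_moebiusField (q z : ℂ) :
    divergence (moebiusField q) z = 2 * (z * conj q).re := by
  have h1 : HasDerivAt (moebiusField q) (z * conj q) z := by
    have := ((((hasDerivAt_id z).sub_const q).mul ((hasDerivAt_id z).add_const q)).mul_const
      (conj q)).div_const 2
    refine this.congr_deriv ?_
    simp; ring
  have h2 := (h1.hasFDerivAt.restrictScalars ℝ).fderiv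
  rw [divergence, h2]
  simp
  ring

lemma re_moebiusField_mul_conj {q z : ℂ} (hq : ‖q‖ = 1) :
    (moebiusField q z * conj (z - q)).re = ‖z - q‖ ^ 2 * (((z * conj q).re + 1) / 2) ∧
      (moebiusField q z * conj (z + q)).re = ‖z + q‖ ^ 2 * (((z * conj q).re - 1) / 2) := by
  have hqq : q * conj q = 1 := by rw [mul_comm]; exact conj_mul_self_of_norm_eq_one hq
  constructor
  · have e : moebiusField q z * conj (z - q) =
        ((‖z - q‖ ^ 2 : ℝ) : ℂ) * ((z * conj q + 1) / 2) := by
      rw [Complex.ofReal_pow, ← Complex.mul_conj', moebiusField, ← hqq]; ring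
    rw [e, Complex.re_ofReal_mul]; simp
  · have e : moebiusField q z * conj (z + q) =
        ((‖z + q‖ ^ 2 : ℝ) : ℂ) * ((z * conj q - 1) / 2) := by
      rw [Complex.ofReal_pow, ← Complex.mul_conj', moebiusField, ← hqq]; ring
    rw [e, Complex.re_ofReal_mul]; simp

lemma contDiffOn_boundaryField {q : ℂ} (hq : ‖q‖ = 1) :
    ContDiffOn ℝ 1 (boundaryField q) (ball 0 1) := by
  intro z hz
  rw [mem_ball_zero_iff] at hz
  refine ContDiffAt.contDiffWithinAt ?_
  exact ((hasFDerivAt_norm_sub_rpow (ne_of_norm_lt_one (by simpa using hq) hz) 1).1.mul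
    (hasFDerivAt_norm_sub_rpow (ne_of_norm_lt_one hq hz) (-1)).1).smul
    (contDiff_moebiusField q).contDiffAt

lemma divergence_boundaryField {q z : ℂ} (hq : ‖q‖ = 1) (hz : ‖z‖ < 1) :
    divergence (boundaryField q) z = ‖z + q‖ / ‖z - q‖ * (2 * (z * conj q).re - 1) := by
  have hn := ne_of_norm_lt_one (q := -q) (by simpa using hq) hz
  have hp := ne_of_norm_lt_one hq hz
  obtain ⟨a1, a2⟩ := hasFDerivAt_norm_sub_rpow hn 1
  obtain ⟨b1, b2⟩ := hasFDerivAt_norm_sub_rpow hp (-1)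
  have a1 := a1.differentiableAt one_ne_zero
  have b1 := b1.differentiableAt one_ne_zero
  have h1 : 0 < ‖z - q‖ := norm_pos_iff.2 (sub_ne_zero.2 hp)
  have h2 : 0 < ‖z - -q‖ := norm_pos_iff.2 (sub_ne_zero.2 hn)
  have hab : DifferentiableAt ℝ (fun z => ‖z - -q‖ ^ (1 : ℝ) * ‖z - q‖ ^ (-1 : ℝ)) z := a1.mul b1
  have e := divergence_smul hab ((contDiff_moebiusField q).differentiable one_ne_zero z)
  have e' : divergence (boundaryField q) z = _ := e
  rw [e', fderiv_fun_mul a1 b1]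
  simp only [_root_.add_apply, _root_.smul_apply, smul_eq_mul, a2, b2, divergence_moebiusField]
  rw [sub_neg_eq_add] at h2 ⊢
  obtain ⟨m1, m2⟩ := re_moebiusField_mul_conj (z := z) hq
  rw [m1, m2, Real.rpow_one, Real.rpow_neg_one]
  field_simp
  ring

lemma re_moebiusField_kernel_one (x y : ℂ) :
    ((x - 1) * (x + 1) / 2 * conj ((y - x) * (1 - x * conj y))).re =
      1 / 2 * (1 - ‖x‖ ^ 2) * (1 / 4 * (‖y - 1‖ ^ 2 * ‖x + 1‖ ^ 2 - ‖x - 1‖ ^ 2 * ‖y + 1‖ ^ 2)) := by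
  simp only [← Complex.normSq_eq_norm_sq, Complex.normSq_apply]
  have e : (x - 1) * (x + 1) / 2 * conj ((y - x) * (1 - x * conj y)) =
    (x - 1) * (x + 1) * conj ((y - x) * (1 - x * conj y)) / (2 : ℝ) := by push_cast; ring
  rw [e, Complex.div_ofReal_re]
  simp
  ring

lemma re_moebiusField_kernel {q x y : ℂ} (hq : ‖q‖ = 1) :
    (moebiusField q x * conj ((y - x) * (1 - x * conj y))).re =
      1 / 2 * (1 - ‖x‖ ^ 2) * (1 / 4 * (‖y - q‖ ^ 2 * ‖x + q‖ ^ 2 - ‖x - q‖ ^ 2 * ‖y + q‖ ^ 2)) := by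
  have hqq : conj q * q = 1 := conj_mul_self_of_norm_eq_one hq
  obtain ⟨x', rfl⟩ : ∃ x', x = q * x' := ⟨conj q * x, by linear_combination -x * hqq⟩
  obtain ⟨y', rfl⟩ : ∃ y', y = q * y' := ⟨conj q * y, by linear_combination -y * hqq⟩
  have hm : ∀ z, ‖q * z - q‖ = ‖z - 1‖ := fun z => by
    rw [← mul_sub_one, norm_mul, hq, one_mul]
  have hp : ∀ z, ‖q * z + q‖ = ‖z + 1‖ := fun z => by
    rw [← mul_add_one, norm_mul, hq, one_mul]
  rw [hm, hm, hp, hp, norm_mul, hq, one_mul, ← re_moebiusField_kernel_one]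
  congr 1
  simp only [moebiusField, map_mul, map_sub, map_one, Complex.conj_conj]
  linear_combination ((x' - 1) * (x' + 1) / 2 * (conj y' - conj x') * ((conj q * q + 1) -
    conj x' * y' * ((conj q * q) ^ 2 + conj q * q + 1))) * hqq

lemma re_div_eq (v k : ℂ) : (v / k).re = (v * conj k).re / ‖k‖ ^ 2 := by
  rw [div_eq_mul_inv, Complex.inv_def, Complex.normSq_eq_norm_sq, ← mul_assoc, mul_comm,
    Complex.re_ofReal_mul]
  ring

lemma re_mul_gradKernel (v x y : ℂ) : (v * gradKernel x y).re =
    (1 - ‖y‖ ^ 2) * (v * conj ((y - x) * (1 - x * conj y))).re /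
      (‖x - y‖ ^ 2 * ‖1 - x * conj y‖ ^ 2) := by
  have e : v * gradKernel x y =
      ((1 - ‖y‖ ^ 2 : ℝ) : ℂ) * (v / ((y - x) * (1 - x * conj y))) := by
    rw [gradKernel]; push_cast; ring
  rw [e, Complex.re_ofReal_mul, re_div_eq, norm_mul, mul_pow, norm_sub_rev y x]
  ring

lemma norm_one_sub_mul_conj_comm (x y : ℂ) : ‖1 - y * conj x‖ = ‖1 - x * conj y‖ := by
  rw [← Complex.norm_conj]; simp [mul_comm]

lemma symKernel_boundaryField_nonneg {q x y : ℂ} (hq : ‖q‖ = 1) (hx : ‖x‖ < 1) (hy : ‖y‖ < 1) :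
    0 ≤ symKernel (boundaryField q) x y := by
  have px : 0 < ‖x - q‖ := norm_pos_iff.2 (sub_ne_zero.2 (ne_of_norm_lt_one hq hx))
  have py : 0 < ‖y - q‖ := norm_pos_iff.2 (sub_ne_zero.2 (ne_of_norm_lt_one hq hy))
  have e : symKernel (boundaryField q) x y =
      (1 - ‖x‖ ^ 2) * (1 - ‖y‖ ^ 2) / (8 * (‖x - y‖ ^ 2 * ‖1 - x * conj y‖ ^ 2)) *
      ((‖x + q‖ / ‖x - q‖ - ‖y + q‖ / ‖y - q‖) *
        (‖y - q‖ ^ 2 * ‖x + q‖ ^ 2 - ‖x - q‖ ^ 2 * ‖y + q‖ ^ 2)) := by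
    rw [symKernel, re_mul_gradKernel, re_mul_gradKernel, boundaryField, boundaryField,
      norm_one_sub_mul_conj_comm x y, norm_sub_rev y x, smul_mul_assoc, smul_mul_assoc,
      Complex.smul_re, Complex.smul_re, re_moebiusField_kernel hq, re_moebiusField_kernel hq]
    simp only [sub_neg_eq_add, Real.rpow_one, Real.rpow_neg_one, smul_eq_mul]
    ring
  rw [e]
  have hx2 : 0 ≤ 1 - ‖x‖ ^ 2 := by nlinarith [norm_nonneg x]
  have hy2 : 0 ≤ 1 - ‖y‖ ^ 2 := by nlinarith [norm_nonneg y]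
  refine mul_nonneg (by positivity) ?_
  have e2 : (‖x + q‖ / ‖x - q‖ - ‖y + q‖ / ‖y - q‖) *
        (‖y - q‖ ^ 2 * ‖x + q‖ ^ 2 - ‖x - q‖ ^ 2 * ‖y + q‖ ^ 2) =
      (‖x + q‖ / ‖x - q‖ - ‖y + q‖ / ‖y - q‖) ^ 2 * (‖x - q‖ * ‖y - q‖ *
        (‖y - q‖ * ‖x + q‖ + ‖x - q‖ * ‖y + q‖)) := by
    field_simp
    ring
  rw [e2]
  positivity

lemma boundaryField_ratio {q z : ℂ} (hq : ‖q‖ = 1) (hz : ‖z‖ < 1) :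
    2 / ‖z - q‖ - 1 ≤ ‖z + q‖ / ‖z - q‖ ∧ ‖z + q‖ / ‖z - q‖ ≤ 2 / ‖z - q‖ ∧
      1 - ‖z - q‖ ≤ (z * conj q).re ∧ |(z * conj q).re| ≤ 1 := by
  have h1 : 0 < ‖z - q‖ := norm_pos_iff.2 (sub_ne_zero.2 (ne_of_norm_lt_one hq hz))
  refine ⟨?_, ?_, ?_, ?_⟩
  · have h2 : 2 ≤ ‖z + q‖ + ‖z - q‖ := by
      have h3 := norm_sub_le (z + q) (z - q)
      have h4 : z + q - (z - q) = 2 * q := by ring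
      rw [h4, norm_mul, hq, Complex.norm_two] at h3
      linarith
    rw [div_sub_one h1.ne', div_le_div_iff_of_pos_right h1]
    linarith
  · rw [div_le_div_iff_of_pos_right h1]
    linarith [norm_add_le z q]
  · have h2 : ((z - q) * conj q).re = (z * conj q).re - 1 := by
      rw [sub_mul, mul_comm q, conj_mul_self_of_norm_eq_one hq]; simp
    have h3 := (abs_le.1 (Complex.abs_re_le_norm ((z - q) * conj q))).1
    rw [h2, norm_mul, Complex.norm_conj, hq, mul_one] at h3
    linarith
  · refine (Complex.abs_re_le_norm _).trans ?_
    rw [norm_mul, Complex.norm_conj, hq, mul_one]; exact hz.le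

lemma divergence_boundaryField_ge {q z : ℂ} (hq : ‖q‖ = 1) (hz : ‖z‖ < 1) :
    2 / ‖z - q‖ - 5 ≤ divergence (boundaryField q) z ∧
      |divergence (boundaryField q) z| ≤ 6 / ‖z - q‖ := by
  have h1 : 0 < ‖z - q‖ := norm_pos_iff.2 (sub_ne_zero.2 (ne_of_norm_lt_one hq hz))
  obtain ⟨r1, r2, r3, r4⟩ := boundaryField_ratio hq hz
  rw [divergence_boundaryField hq hz]
  set φ := ‖z + q‖ / ‖z - q‖ with hφ
  have hφ0 : 0 ≤ φ := by positivity
  have hm : φ * ‖z - q‖ ≤ 2 := (le_div_iff₀ h1).1 r2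
  constructor
  · nlinarith
  · rw [abs_mul, abs_of_nonneg hφ0]
    have : |2 * (z * conj q).re - 1| ≤ 3 := by
      rw [abs_le] at r4 ⊢; constructor <;> linarith
    calc φ * |2 * (z * conj q).re - 1| ≤ 2 / ‖z - q‖ * 3 := by gcongr
      _ = _ := by ring

lemma abs_re_mul_conj_div_le {v z : ℂ} {B : ℝ} (hv : ‖v‖ ≤ B) (hz : 0 < ‖z‖) :
    |(v * conj z).re / ‖z‖ ^ 2| ≤ B / ‖z‖ := by
  rw [abs_div, abs_of_nonneg (a := ‖z‖ ^ 2) (by positivity), div_le_div_iff₀ (by positivity) hz]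
  have h1 := Complex.abs_re_le_norm (v * conj z)
  rw [norm_mul, Complex.norm_conj] at h1
  have h2 := mul_le_mul_of_nonneg_right hv (norm_nonneg z)
  nlinarith [norm_nonneg z]

lemma weightedDiv_boundaryField_ge {α : ℝ} {q x₀ z : ℂ} (hα : 0 < α) (hα' : α < 1 / 2)
    (hq : ‖q‖ = 1) (hx₀ : ‖x₀‖ = 1) (hz : ‖z‖ < 1) :
    2 / ‖z - q‖ - 5 - 2 / ‖z - x₀‖ ≤ weightedDiv α x₀ (boundaryField q) z ∧
      |weightedDiv α x₀ (boundaryField q) z| ≤ 6 / ‖z - q‖ + 2 / ‖z - x₀‖ := by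
  have h0 : 0 < ‖z - x₀‖ := norm_pos_iff.2 (sub_ne_zero.2 (ne_of_norm_lt_one hx₀ hz))
  obtain ⟨d1, d2⟩ := divergence_boundaryField_ge hq hz
  have h2 := abs_re_mul_conj_div_le (norm_boundaryField_le hq hz) h0
  rw [weightedDiv]
  set t := (boundaryField q z * conj (z - x₀)).re / ‖z - x₀‖ ^ 2
  have h3 : |2 * α * t| ≤ 2 / ‖z - x₀‖ := by
    rw [abs_mul, abs_of_nonneg (by positivity : 0 ≤ 2 * α)]
    refine (mul_le_of_le_one_left (abs_nonneg _) (by linarith)).trans h2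
  constructor
  · linarith [le_abs_self (2 * α * t)]
  · exact (abs_sub _ _).trans (add_le_add d2 h3)

lemma weightedDiv_boundaryField_self_ge {α : ℝ} {q z : ℂ} (hα : 0 < α) (hα' : α < 1 / 2)
    (hq : ‖q‖ = 1) (hz : ‖z‖ < 1) :
    2 * (1 - 2 * α) / ‖z - q‖ - 5 ≤ weightedDiv α q (boundaryField q) z := by
  have h1 : 0 < ‖z - q‖ := norm_pos_iff.2 (sub_ne_zero.2 (ne_of_norm_lt_one hq hz))
  obtain ⟨r1, r2, r3, r4⟩ := boundaryField_ratio hq hz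
  have e : weightedDiv α q (boundaryField q) z =
      ‖z + q‖ / ‖z - q‖ * (2 * (z * conj q).re - 1 - α * (1 + (z * conj q).re)) := by
    rw [weightedDiv, divergence_boundaryField hq hz, boundaryField, smul_mul_assoc,
      Complex.smul_re, (re_moebiusField_mul_conj hq).1]
    simp only [sub_neg_eq_add, Real.rpow_one, Real.rpow_neg_one, smul_eq_mul]
    field_simp
    ring
  rw [e]
  set φ := ‖z + q‖ / ‖z - q‖ with hφ
  have hφ0 : 0 ≤ φ := by positivity
  have hm : φ * ‖z - q‖ ≤ 2 := (le_div_iff₀ h1).1 r2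
  have k1 : (1 - 2 * α) - 2 * ‖z - q‖ ≤ 2 * (z * conj q).re - 1 - α * (1 + (z * conj q).re) := by
    have := mul_nonneg (by linarith : 0 ≤ 2 - α) (by linarith : 0 ≤ (z * conj q).re - (1 - ‖z - q‖))
    nlinarith
  have k2 := mul_le_mul_of_nonneg_left k1 hφ0
  have k3 := mul_le_mul_of_nonneg_left r1 (by linarith : 0 ≤ 1 - 2 * α)
  have k4 : 2 * (1 - 2 * α) / ‖z - q‖ = (1 - 2 * α) * (2 / ‖z - q‖) := by ring
  rw [k4]
  nlinarith

namespace BoundedSol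

variable {α b C A s : ℝ} {x₀ : ℂ} {V u : ℂ → ℝ}

lemma exp_sub_one_le (h : BoundedSol α x₀ b C A s V u) {r : ℝ} {c x q : ℂ}
    (hr : ScaledAt α x₀ u r c) (hx : x ∈ ball (0 : ℂ) 1) (hq : ‖q‖ = 1) :
    (Real.exp (u x) - 1) / ‖x - q‖ ≤ gradConst α b / r * Real.exp (u x) := by
  have hx' := mem_ball_zero_iff.1 hx
  have hr0 := hr.r_pos
  have h0 : 0 < ‖x - q‖ := norm_pos_iff.2 (sub_ne_zero.2 (ne_of_norm_lt_one hq hx'))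
  have h1 := Real.one_sub_le_exp_neg (u x)
  have h2 : Real.exp (u x) * Real.exp (-u x) = 1 := by rw [← Real.exp_add]; simp
  have h3 : Real.exp (u x) - 1 ≤ Real.exp (u x) * u x := by
    have := mul_le_mul_of_nonneg_left h1 (Real.exp_pos (u x)).le
    linarith
  have h4 : 1 - ‖x‖ ≤ ‖x - q‖ := by
    have := norm_sub_norm_le q x
    rwa [hq, norm_sub_rev] at this
  have hΛ := gradConst_ge h.α_lt h.b_pos
  rw [div_le_iff₀ h0]
  calc _ ≤ Real.exp (u x) * u x := h3
    _ ≤ Real.exp (u x) * (gradConst α b / r * (1 - ‖x‖)) := by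
        gcongr; exact h.le_gradConst_mul hr hx
    _ ≤ Real.exp (u x) * (gradConst α b / r * ‖x - q‖) := by gcongr
    _ = _ := by ring

lemma exp_sub_one_nonneg (h : BoundedSol α x₀ b C A s V u) {x : ℂ} (hx : x ∈ ball (0 : ℂ) 1) :
    0 ≤ Real.exp (u x) - 1 := by
  linarith [Real.add_one_le_exp (u x), h.nonneg hx]

lemma integral_weight_mul_inv_le (h : BoundedSol α x₀ b C A s V u) {q : ℂ} (hq : ‖q‖ = 1) :
    IntegrableOn (fun y : ℂ => ‖y - x₀‖ ^ (-(2 * α)) * ‖y - q‖⁻¹) (ball 0 1) ∧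
      ∫ y in ball (0 : ℂ) 1, ‖y - x₀‖ ^ (-(2 * α)) * ‖y - q‖⁻¹ ≤
        2 * radialMass (2 * α + 1) 2 := by
  obtain ⟨h1, h2⟩ := integrableOn_rpow_mul_inv x₀ q (γ := 2 * α) (by linarith [h.α_pos])
    (by linarith [h.α_lt]) zero_le_two
  have hsub := ball_subset_ball_two hq.le
  refine ⟨h1.mono_set hsub, le_trans ?_ h2⟩
  exact setIntegral_mono_set h1 (Eventually.of_forall fun y => by positivity) hsub.eventuallyLE

end BoundedSol

open BoundedSol in
lemma exists_boundary_field_estimate (α b C A s : ℝ) : ∃ T : ℝ, ∀ {x₀ : ℂ} {V u : ℂ → ℝ},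
    BoundedSol α x₀ b C A s V u → ∀ {r : ℝ} {c q : ℂ}, ScaledAt α x₀ u r c → ‖q‖ = 1 →
    ∀ {a e : ℝ}, 0 ≤ a → 0 ≤ e → (∀ z : ℂ, ‖z‖ < 1 → a / ‖z - q‖ - 5 - e / ‖z - x₀‖ ≤
      weightedDiv α x₀ (boundaryField q) z) →
    a * ∫ x in ball (0 : ℂ) 1, dens α x₀ V u x * ‖x - q‖⁻¹ ≤
      T * r ^ (s - 1) + 80 * Real.pi + a * b * (2 * radialMass (2 * α + 1) 2) +
        e * ∫ x in ball (0 : ℂ) 1, dens α x₀ V u x * ‖x - x₀‖⁻¹ := by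
  obtain ⟨κ, hκ, hpoh⟩ := exists_pohozaev
  refine ⟨κ * A * C * (2 * gradConst α b + 2 + 8 * gradConst α b), ?_⟩
  intro x₀ V u h r c q hr hq a e ha he hd
  have hΛ := gradConst_ge h.α_lt h.b_pos
  have hb := h.b_pos
  obtain ⟨hI, hle⟩ := hpoh h hr (X := boundaryField q) (Ξ := 2) (N := 8 * gradConst α b)
    (contDiffOn_boundaryField hq) zero_le_two (by positivity)
    (fun x hx => norm_boundaryField_le hq (mem_ball_zero_iff.1 hx)) (fun x hx => by
      have h1 := (weightedDiv_boundaryField_ge h.α_pos h.α_lt hq h.norm_x₀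
        (mem_ball_zero_iff.1 hx)).2
      have h2 := h.exp_sub_one_le hr hx hq
      have h3 := h.exp_sub_one_le hr hx h.norm_x₀
      have h4 := mul_le_mul_of_nonneg_left h1 (h.exp_sub_one_nonneg hx)
      calc _ ≤ _ := h4
        _ = 6 * ((Real.exp (u x) - 1) / ‖x - q‖) + 2 * ((Real.exp (u x) - 1) / ‖x - x₀‖) := by ring
        _ ≤ 6 * (gradConst α b / r * Real.exp (u x)) + 2 * (gradConst α b / r * Real.exp (u x)) := by
            gcongr
        _ = _ := by ring)
  have hvir := h.virial_ge (X := boundaryField q) (Ξ := 2) (E := 0) (φ := fun _ => 0)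
    (χ := fun _ => 0) (contDiffOn_boundaryField hq).continuousOn
    (fun x hx => norm_boundaryField_le hq (mem_ball_zero_iff.1 hx))
    (fun _ _ => le_rfl) (fun _ _ => le_rfl) le_rfl (by simp) (by simp) (fun x hx y hy _ => by
      simpa using symKernel_boundaryField_nonneg hq (mem_ball_zero_iff.1 hx)
        (mem_ball_zero_iff.1 hy))
  simp only [mul_zero, integral_zero, zero_mul, neg_zero, sub_zero] at hvir
  have hI0 : 0 ≤ ∫ x in ball (0 : ℂ) 1, dens α x₀ V u x * fderiv ℝ u x (boundaryField q x) := by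
    have := Real.pi_pos
    exact nonneg_of_mul_nonneg_right hvir (by positivity)
  obtain ⟨hw1, hw2⟩ := h.integral_weight_mul_inv_le hq
  have hq1 : q ∈ closedBall (0 : ℂ) 1 := by simp [hq]
  have hx1 : x₀ ∈ closedBall (0 : ℂ) 1 := by simp [h.norm_x₀]
  have i1 := (h.integrableOn_dens_mul_inv hq1).const_mul a
  have i2 := hw1.const_mul (a * b)
  have i3 := h.integrableOn_dens.const_mul 5
  have i4 := (h.integrableOn_dens_mul_inv hx1).const_mul e
  have hlow : ∀ x ∈ ball (0 : ℂ) 1, a * (dens α x₀ V u x * ‖x - q‖⁻¹) -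
      a * b * (‖x - x₀‖ ^ (-(2 * α)) * ‖x - q‖⁻¹) - 5 * dens α x₀ V u x -
      e * (dens α x₀ V u x * ‖x - x₀‖⁻¹) ≤
      (Real.exp (u x) - 1) * V x * ‖x - x₀‖ ^ (-(2 * α)) *
        weightedDiv α x₀ (boundaryField q) x := by
    intro x hx
    have hV0 := h.V_nonneg x (ball_subset_closedBall hx)
    have hV1 := h.V_le x (ball_subset_closedBall hx)
    have hg := h.exp_sub_one_nonneg hx
    set w := ‖x - x₀‖ ^ (-(2 * α)) with hw
    have hw0 : 0 ≤ w := by positivity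
    have hG0 : 0 ≤ (Real.exp (u x) - 1) * V x * w := by positivity
    have hGf : (Real.exp (u x) - 1) * V x * w = dens α x₀ V u x - V x * w := by
      rw [dens]; ring
    have hVw : 0 ≤ V x * w := by positivity
    have hVw' : V x * w ≤ b * w := by gcongr
    have k1 := mul_le_mul_of_nonneg_left (hd x (mem_ball_zero_iff.1 hx)) hG0
    refine le_trans ?_ k1
    rw [hGf] at hG0 ⊢
    set F := dens α x₀ V u x
    have p1 : 0 ≤ a / ‖x - q‖ := by positivity
    have p2 : 0 ≤ e / ‖x - x₀‖ := by positivity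
    have m1 := mul_le_mul_of_nonneg_right hVw' p1
    have m2 := mul_nonneg hVw p2
    calc _ = (F - b * w) * (a / ‖x - q‖) - 5 * F - F * (e / ‖x - x₀‖) := by ring
      _ ≤ _ := by linarith
  have hmono := setIntegral_mono_on (((i1.sub i2).sub i3).sub i4) hI measurableSet_ball hlow
  have es := integral_sub ((i1.sub i2).sub i3) i4
  have es2 := integral_sub (i1.sub i2) i3
  have es3 := integral_sub i1 i2
  simp only [Pi.sub_apply] at hmono es es2 es3
  rw [es, es2, es3, integral_const_mul, integral_const_mul, integral_const_mul,
    integral_const_mul] at hmono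
  have hm := h.mass
  have hw3 := mul_le_mul_of_nonneg_left hw2 (show 0 ≤ a * b by positivity)
  linarith

lemma exists_boundary_potential (α b C A s : ℝ) : ∃ Q : ℝ, ∀ {x₀ : ℂ} {V u : ℂ → ℝ},
    BoundedSol α x₀ b C A s V u → ∀ {r : ℝ} {c q : ℂ}, ScaledAt α x₀ u r c → ‖q‖ = 1 →
    ∫ x in ball (0 : ℂ) 1, dens α x₀ V u x * ‖x - q‖⁻¹ ≤ Q * r ^ (s - 1) := by
  obtain ⟨T, hT⟩ := exists_boundary_field_estimate α b C A s
  set Z := 2 * radialMass (2 * α + 1) 2 with hZ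
  set Q₁ := (T + 80 * Real.pi + 2 * (1 - 2 * α) * b * Z) / (2 * (1 - 2 * α)) with hQ₁
  refine ⟨(T + 80 * Real.pi + 2 * b * Z + 2 * Q₁) / 2, ?_⟩
  intro x₀ V u h r c q hr hq
  have hα' := h.α_lt
  have hα := h.α_pos
  have hb := h.b_pos
  have hZ0 : 0 ≤ Z := mul_nonneg zero_le_two (radialMass_nonneg (by linarith) zero_le_two)
  have hR : 1 ≤ r ^ (s - 1) :=
    Real.one_le_rpow_of_pos_of_le_one_of_nonpos hr.r_pos hr.r_lt.le (by linarith [h.s_le])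
  have ha : 0 < 2 * (1 - 2 * α) := by linarith
  have h1 := hT h hr h.norm_x₀ (a := 2 * (1 - 2 * α)) (e := 0) ha.le le_rfl (fun z hz => by
    simpa using weightedDiv_boundaryField_self_ge hα hα' h.norm_x₀ hz)
  have h2 := hT h hr hq (a := 2) (e := 2) zero_le_two zero_le_two (fun z hz =>
    (weightedDiv_boundaryField_ge hα hα' hq h.norm_x₀ hz).1)
  rw [zero_mul, add_zero, mul_comm (2 * (1 - 2 * α)), ← le_div_iff₀ ha] at h1
  have hp := Real.pi_pos
  have h3 : ∫ x in ball (0 : ℂ) 1, dens α x₀ V u x * ‖x - x₀‖⁻¹ ≤ Q₁ * r ^ (s - 1) := by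
    refine h1.trans ?_
    rw [hQ₁, div_mul_eq_mul_div, div_le_div_iff_of_pos_right ha]
    have k1 : 0 ≤ 80 * Real.pi + 2 * (1 - 2 * α) * b * Z := by positivity
    nlinarith
  have k2 : 0 ≤ 80 * Real.pi + 2 * b * Z := by positivity
  nlinarith

/-- Concentration points stay far from the boundary at the scale of concentration. -/
lemma exists_boundary_distance (α b C A s : ℝ) : ∃ Q : ℝ, 0 < Q ∧ ∀ {x₀ : ℂ} {V u : ℂ → ℝ},
    BoundedSol α x₀ b C A s V u → ∀ {r : ℝ} {c : ℂ}, ScaledAt α x₀ u r c →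
    concConst α b C * r ≤ 1 - ‖c‖ → Q * r ^ (1 - s) ≤ 1 - ‖c‖ := by
  obtain ⟨Q, hQ⟩ := exists_boundary_potential α b C A s
  refine ⟨(2 * max Q 1)⁻¹, by positivity, ?_⟩
  intro x₀ V u h r c hr hK
  have hr0 := hr.r_pos
  have hK1 := h.concConst_ge
  obtain ⟨q, hq, hcq⟩ := exists_sphere_dist_eq hr.mem
  have hq' : ‖q‖ = 1 := by simpa using hq
  have h1 := h.one_le_local_mass hr hK
  have hsub := BoundedSol.ball_subset_of_le hK
  have hδ : 0 < 1 - ‖c‖ := lt_of_lt_of_le (by positivity) hK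
  have hqc : q ∈ closedBall (0 : ℂ) 1 := sphere_subset_closedBall hq
  have i1 := h.integrableOn_dens_mul_inv hqc
  have h2 : ∫ y in ball c (concConst α b C * r), dens α x₀ V u y ≤
      ∫ y in ball c (concConst α b C * r), 2 * (1 - ‖c‖) * (dens α x₀ V u y * ‖y - q‖⁻¹) := by
    refine setIntegral_mono_on (h.integrableOn_dens.mono_set hsub)
      ((i1.mono_set hsub).const_mul _) measurableSet_ball fun y hy => ?_
    have hy1 := hsub hy
    rw [mem_ball, dist_eq_norm] at hy
    have h3 : ‖y - q‖ ≤ 2 * (1 - ‖c‖) := by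
      have := norm_sub_le_norm_sub_add_norm_sub y c q
      linarith
    have h4 : 0 < ‖y - q‖ :=
      norm_pos_iff.2 (sub_ne_zero.2 (ne_of_norm_lt_one hq' (mem_ball_zero_iff.1 hy1)))
    have h5 := h.dens_nonneg hy1
    have h6 : 1 ≤ 2 * (1 - ‖c‖) * ‖y - q‖⁻¹ := by
      rw [← div_eq_mul_inv, one_le_div h4]; exact h3
    nlinarith
  have h3 : ∫ y in ball c (concConst α b C * r), 2 * (1 - ‖c‖) * (dens α x₀ V u y * ‖y - q‖⁻¹) ≤
      2 * (1 - ‖c‖) * (Q * r ^ (s - 1)) := by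
    rw [integral_const_mul]
    refine mul_le_mul_of_nonneg_left (le_trans ?_ (hQ h hr hq')) (by positivity)
    refine setIntegral_mono_set i1 ?_ hsub.eventuallyLE
    exact (ae_restrict_iff' measurableSet_ball).2 (Eventually.of_forall fun y hy =>
      mul_nonneg (h.dens_nonneg hy) (by positivity))
  have h4 : 1 ≤ 2 * (1 - ‖c‖) * (max Q 1 * r ^ (s - 1)) :=
    (h1.trans (h2.trans h3)).trans (by gcongr; exact le_max_left _ _)
  have h5 : r ^ (1 - s) * r ^ (s - 1) = 1 := by
    rw [← Real.rpow_add hr0]; simp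
  have h6 : 0 < r ^ (1 - s) := by positivity
  have hm : 0 < max Q 1 := by positivity
  rw [inv_mul_le_iff₀ (by positivity)]
  calc r ^ (1 - s) = r ^ (1 - s) * 1 := by ring
    _ ≤ r ^ (1 - s) * (2 * (1 - ‖c‖) * (max Q 1 * r ^ (s - 1))) := by gcongr
    _ = 2 * max Q 1 * (1 - ‖c‖) * (r ^ (1 - s) * r ^ (s - 1)) := by ring
    _ = _ := by rw [h5, mul_one]

lemma hasDerivAt_max_zero_sq (t : ℝ) : HasDerivAt (fun t : ℝ => max t 0 ^ 2) (2 * max t 0) t := by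
  rcases lt_trichotomy t 0 with ht | rfl | ht
  · rw [max_eq_right ht.le, mul_zero]
    refine (hasDerivAt_const t (0 : ℝ)).congr_of_eventuallyEq ?_
    filter_upwards [Iio_mem_nhds ht] with z hz
    rw [max_eq_right (le_of_lt hz)]; simp
  · rw [hasDerivAt_iff_isLittleO]
    simp only [max_self, mul_zero, sub_zero, smul_zero, ne_eq, OfNat.ofNat_ne_zero,
      not_false_eq_true, zero_pow]
    have h1 : (fun t : ℝ => max t 0 ^ 2) =O[𝓝 0] fun t : ℝ => t ^ 2 := by
      refine Asymptotics.IsBigO.of_bound 1 (Eventually.of_forall fun t => ?_)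
      rw [Real.norm_of_nonneg (by positivity), Real.norm_of_nonneg (by positivity), one_mul]
      rcases le_total t 0 with ht | ht
      · rw [max_eq_right ht]; nlinarith
      · rw [max_eq_left ht]
    refine h1.trans_isLittleO ?_
    simpa using Asymptotics.isLittleO_pow_id (𝕜 := ℝ) (n := 2) (by norm_num)
  · rw [max_eq_left ht.le]
    have h1 : HasDerivAt (fun t : ℝ => t ^ 2) (2 * t) t := by simpa using hasDerivAt_pow 2 t
    refine h1.congr_of_eventuallyEq ?_
    filter_upwards [Ioi_mem_nhds ht] with z hz
    rw [max_eq_left (le_of_lt hz)]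

lemma contDiff_max_zero_sq : ContDiff ℝ 1 fun t : ℝ => max t 0 ^ 2 := by
  rw [contDiff_one_iff_deriv]
  refine ⟨fun t => (hasDerivAt_max_zero_sq t).differentiableAt, ?_⟩
  have : deriv (fun t : ℝ => max t 0 ^ 2) = fun t => 2 * max t 0 :=
    funext fun t => (hasDerivAt_max_zero_sq t).deriv
  rw [this]
  fun_prop

/-- A logarithmic cutoff function around `c`. -/
noncomputable def logCutoff (c : ℂ) (a ℓ : ℝ) (x : ℂ) : ℝ :=
  max (1 - Real.log (1 + ‖x - c‖ ^ 2 / a ^ 2) / ℓ) 0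

/-- The dilation field around `c`, truncated by a logarithmic cutoff. -/
noncomputable def dilationField (c : ℂ) (a ℓ : ℝ) (x : ℂ) : ℂ := (logCutoff c a ℓ x ^ 2) • (x - c)

section

variable {c x y : ℂ} {a ℓ R : ℝ}

lemma logCutoff_nonneg (c : ℂ) (a ℓ : ℝ) (x : ℂ) : 0 ≤ logCutoff c a ℓ x := le_max_right _ _

lemma logCutoff_le_one (hℓ : 0 < ℓ) (c : ℂ) (a : ℝ) (x : ℂ) : logCutoff c a ℓ x ≤ 1 := by
  refine max_le ?_ zero_le_one
  have : 0 ≤ Real.log (1 + ‖x - c‖ ^ 2 / a ^ 2) := Real.log_nonneg (by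
    have : 0 ≤ ‖x - c‖ ^ 2 / a ^ 2 := by positivity
    linarith)
  have : 0 ≤ Real.log (1 + ‖x - c‖ ^ 2 / a ^ 2) / ℓ := by positivity
  linarith

lemma logCutoff_eq_zero (hℓ : 0 < ℓ) (hR : 0 ≤ R) (hℓR : ℓ ≤ Real.log (1 + R ^ 2 / a ^ 2))
    (hx : R ≤ ‖x - c‖) : logCutoff c a ℓ x = 0 := by
  refine max_eq_right ?_
  rw [sub_nonpos, le_div_iff₀ hℓ, one_mul]
  exact hℓR.trans (Real.log_le_log (by positivity) (by gcongr))

lemma half_le_logCutoff_sq (hℓ : 4 ≤ ℓ) (hx : ‖x - c‖ ≤ a) (ha : 0 < a) :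
    1 / 2 ≤ logCutoff c a ℓ x ^ 2 := by
  have h1 : Real.log (1 + ‖x - c‖ ^ 2 / a ^ 2) ≤ 1 := by
    have h2 : ‖x - c‖ ^ 2 / a ^ 2 ≤ 1 := by
      rw [div_le_one (by positivity)]; gcongr
    refine (Real.log_le_sub_one_of_pos (by positivity)).trans ?_
    linarith
  have h3 : 3 / 4 ≤ logCutoff c a ℓ x := by
    refine le_max_of_le_left ?_
    have : Real.log (1 + ‖x - c‖ ^ 2 / a ^ 2) / ℓ ≤ 1 / 4 := by
      rw [div_le_div_iff₀ (by linarith) (by norm_num)]; linarith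
    linarith
  nlinarith

lemma logCutoff_anti (hℓ : 0 < ℓ) (hxy : ‖y - c‖ ≤ ‖x - c‖) :
    logCutoff c a ℓ x ≤ logCutoff c a ℓ y := by
  unfold logCutoff
  gcongr

lemma hasFDerivAt_log_one_add (c x : ℂ) (a : ℝ) :
    HasFDerivAt (fun x : ℂ => Real.log (1 + ‖x - c‖ ^ 2 / a ^ 2))
      ((1 + ‖x - c‖ ^ 2 / a ^ 2)⁻¹ • ((a ^ 2)⁻¹ • ((2 : ℝ) • innerSL ℝ (x - c)))) x := by
  have h2 : HasFDerivAt (fun x : ℂ => ‖x - c‖ ^ 2) ((2 : ℝ) • innerSL ℝ (x - c)) x := by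
    have h3 : HasFDerivAt (fun x : ℂ => ‖x‖ ^ 2) ((2 : ℝ) • innerSL ℝ (x - c)) (x - c) := by
      simpa [two_smul] using (hasStrictFDerivAt_norm_sq (x - c)).hasFDerivAt
    have h4 := h3.comp x ((hasFDerivAt_id x).sub_const c)
    rw [ContinuousLinearMap.comp_id] at h4
    exact h4
  have h3 : HasFDerivAt (fun x : ℂ => 1 + ‖x - c‖ ^ 2 / a ^ 2)
      ((a ^ 2)⁻¹ • ((2 : ℝ) • innerSL ℝ (x - c))) x := by
    simp only [div_eq_mul_inv]
    exact (h2.mul_const ((a ^ 2)⁻¹)).const_add 1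
  exact h3.log (by positivity)

lemma contDiff_logCutoff_sq (c : ℂ) (a ℓ : ℝ) : ContDiff ℝ 1 fun x => logCutoff c a ℓ x ^ 2 := by
  have h1 : ContDiff ℝ 1 fun x : ℂ => Real.log (1 + ‖x - c‖ ^ 2 / a ^ 2) := by
    refine ContDiff.log ?_ fun x => by positivity
    exact contDiff_const.add (((contDiff_norm_sq ℝ).comp (contDiff_id.sub contDiff_const)).div_const _)
  exact contDiff_max_zero_sq.comp (contDiff_const.sub (h1.div_const ℓ))

lemma contDiff_dilationField (c : ℂ) (a ℓ : ℝ) : ContDiff ℝ 1 (dilationField c a ℓ) :=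
  (contDiff_logCutoff_sq c a ℓ).smul (contDiff_id.sub contDiff_const)

lemma fderiv_logCutoff_sq_radial (c x : ℂ) (a ℓ : ℝ) :
    fderiv ℝ (fun x => logCutoff c a ℓ x ^ 2) x (x - c) = -(2 * logCutoff c a ℓ x *
      ((1 + ‖x - c‖ ^ 2 / a ^ 2)⁻¹ * ((a ^ 2)⁻¹ * (2 * ‖x - c‖ ^ 2)) / ℓ)) := by
  have h1 := ((hasFDerivAt_log_one_add c x a).mul_const ℓ⁻¹).const_sub 1
  have h2 := (hasDerivAt_max_zero_sq (1 - Real.log (1 + ‖x - c‖ ^ 2 / a ^ 2) * ℓ⁻¹)).comp_hasFDerivAt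
    x h1
  have h3 : fderiv ℝ (fun x => logCutoff c a ℓ x ^ 2) x = _ := h2.fderiv
  rw [h3]
  simp only [_root_.smul_apply, _root_.neg_apply, innerSL_apply_apply, smul_eq_mul,
    real_inner_self_eq_norm_sq, logCutoff, div_eq_mul_inv]
  ring

lemma divergence_dilationField (hℓ : 0 < ℓ) (ha : 0 < a) :
    2 * logCutoff c a ℓ x ^ 2 - 4 / ℓ ≤ divergence (dilationField c a ℓ) x ∧
      |divergence (dilationField c a ℓ) x| ≤ 2 + 4 / ℓ ∧
      (logCutoff c a ℓ x = 0 → divergence (dilationField c a ℓ) x = 0) := by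
  have h1 : divergence (dilationField c a ℓ) x =
      logCutoff c a ℓ x ^ 2 * divergence (fun z : ℂ => z - c) x +
        fderiv ℝ (fun x => logCutoff c a ℓ x ^ 2) x (x - c) :=
    divergence_smul ((contDiff_logCutoff_sq c a ℓ).differentiable one_ne_zero x)
      (differentiableAt_id.sub_const c)
  have h2 : divergence (fun z : ℂ => z - c) x = 2 := by
    rw [divergence, fderiv_sub_const]; simp; norm_num
  set ψ := logCutoff c a ℓ x with hψ
  have hψ0 : 0 ≤ ψ := logCutoff_nonneg _ _ _ _
  have hψ1 : ψ ≤ 1 := logCutoff_le_one hℓ _ _ _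
  set k := (1 + ‖x - c‖ ^ 2 / a ^ 2)⁻¹ * ((a ^ 2)⁻¹ * (2 * ‖x - c‖ ^ 2)) / ℓ with hk
  have hk0 : 0 ≤ k := by positivity
  have hk1 : k ≤ 2 / ℓ := by
    rw [hk, div_le_div_iff_of_pos_right hℓ, inv_mul_le_iff₀ (by positivity), ← sub_nonneg]
    have : (1 + ‖x - c‖ ^ 2 / a ^ 2) * 2 - (a ^ 2)⁻¹ * (2 * ‖x - c‖ ^ 2) = 2 := by ring
    rw [this]; norm_num
  rw [h1, h2, fderiv_logCutoff_sq_radial, ← hψ, ← hk]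
  have e4 : 4 / ℓ = 2 * (2 / ℓ) := by ring
  have hm : ψ * k ≤ 2 / ℓ := (mul_le_of_le_one_left hk0 hψ1).trans hk1
  have hm0 : 0 ≤ ψ * k := by positivity
  refine ⟨by rw [e4]; nlinarith, ?_, fun h0 => by rw [h0]; ring⟩
  rw [e4, abs_le]
  constructor <;> nlinarith

lemma norm_dilationField_le (hℓ : 0 < ℓ) (hR : 0 ≤ R) (hℓR : ℓ ≤ Real.log (1 + R ^ 2 / a ^ 2)) :
    ‖dilationField c a ℓ x‖ ≤ R := by
  by_cases hx : R ≤ ‖x - c‖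
  · rw [dilationField, logCutoff_eq_zero hℓ hR hℓR hx]; simpa using hR
  · push Not at hx
    rw [dilationField, norm_smul, Real.norm_of_nonneg (by positivity)]
    have h1 := logCutoff_nonneg c a ℓ x
    have h2 := logCutoff_le_one hℓ c a x
    refine (mul_le_of_le_one_left (norm_nonneg _) ?_).trans hx.le
    exact pow_le_one₀ h1 h2

lemma norm_mul_log_sub_le (ha : 0 < a) (hxy : ‖y - c‖ ≤ ‖x - c‖) :
    ‖y - c‖ * (Real.log (1 + ‖x - c‖ ^ 2 / a ^ 2) - Real.log (1 + ‖y - c‖ ^ 2 / a ^ 2)) ≤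
      2 * (‖x - c‖ - ‖y - c‖) := by
  set p := ‖x - c‖
  set q := ‖y - c‖ with hq
  rcases (norm_nonneg (y - c)).eq_or_lt with h0 | h0
  · rw [← hq] at h0
    rw [← h0] at hxy ⊢; linarith
  · have hq0 : 0 < q := h0
    have hp0 : 0 < p := hq0.trans_le hxy
    have h1 : Real.log (1 + p ^ 2 / a ^ 2) - Real.log (1 + q ^ 2 / a ^ 2) ≤
        2 * (p / q - 1) := by
      rw [← Real.log_div (by positivity) (by positivity)]
      have h2 : (1 + p ^ 2 / a ^ 2) / (1 + q ^ 2 / a ^ 2) ≤ (p / q) ^ 2 := by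
        rw [div_pow, div_le_div_iff₀ (by positivity) (by positivity)]
        have h3 : q ^ 2 ≤ p ^ 2 := by gcongr
        have h4 : p ^ 2 / a ^ 2 * q ^ 2 = p ^ 2 * (q ^ 2 / a ^ 2) := by ring
        nlinarith
      refine (Real.log_le_log (by positivity) h2).trans ?_
      rw [Real.log_pow]
      have := Real.log_le_sub_one_of_pos (div_pos hp0 hq0)
      push_cast; linarith
    calc _ ≤ q * (2 * (p / q - 1)) := by gcongr
      _ = _ := by field_simp

lemma norm_mul_logCutoff_sq_sub_le (hℓ : 0 < ℓ) (ha : 0 < a) (hxy : ‖y - c‖ ≤ ‖x - c‖) :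
    ‖y - c‖ * (logCutoff c a ℓ y ^ 2 - logCutoff c a ℓ x ^ 2) ≤ 4 / ℓ * (‖x - c‖ - ‖y - c‖) := by
  have h1 := norm_mul_log_sub_le (x := x) (y := y) (c := c) ha hxy
  have hx0 := logCutoff_nonneg c a ℓ x
  have hy1 := logCutoff_le_one hℓ c a y
  have hanti := logCutoff_anti (a := a) hℓ hxy
  set Lx := Real.log (1 + ‖x - c‖ ^ 2 / a ^ 2) with hLx
  set Ly := Real.log (1 + ‖y - c‖ ^ 2 / a ^ 2) with hLy
  have hL : Ly ≤ Lx := by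
    rw [hLx, hLy]; gcongr
  have h2 : logCutoff c a ℓ y - logCutoff c a ℓ x ≤ (Lx - Ly) / ℓ := by
    have : logCutoff c a ℓ y ≤ logCutoff c a ℓ x + (Lx - Ly) / ℓ := by
      have hd : 0 ≤ (Lx - Ly) / ℓ := div_nonneg (by linarith) hℓ.le
      refine max_le ?_ (by positivity)
      have := le_max_left (1 - Lx / ℓ) 0
      have e : 1 - Ly / ℓ = 1 - Lx / ℓ + (Lx - Ly) / ℓ := by ring
      have e2 : max (1 - Lx / ℓ) 0 = logCutoff c a ℓ x := rfl
      rw [e2] at this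
      linarith
    linarith
  have h3 : logCutoff c a ℓ y ^ 2 - logCutoff c a ℓ x ^ 2 ≤ 2 * ((Lx - Ly) / ℓ) := by nlinarith
  calc _ ≤ ‖y - c‖ * (2 * ((Lx - Ly) / ℓ)) := by gcongr
    _ = 2 / ℓ * (‖y - c‖ * (Lx - Ly)) := by ring
    _ ≤ 2 / ℓ * (2 * (‖x - c‖ - ‖y - c‖)) := by gcongr
    _ = _ := by ring

lemma re_dilationField_sub_div_le (hℓ : 0 < ℓ) (ha : 0 < a) (hne : x ≠ y)
    (hxy : ‖y - c‖ ≤ ‖x - c‖) :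
    ((dilationField c a ℓ x - dilationField c a ℓ y) / (x - y)).re ≤
      logCutoff c a ℓ x ^ 2 + 4 / ℓ := by
  have h0 : x - y ≠ 0 := sub_ne_zero.2 hne
  have hpos : 0 < ‖x - y‖ := norm_pos_iff.2 h0
  have h1 := norm_mul_logCutoff_sq_sub_le (x := x) (y := y) (c := c) hℓ ha hxy
  have hanti := logCutoff_anti (a := a) hℓ hxy
  have hx0 := logCutoff_nonneg c a ℓ x
  have hsq : logCutoff c a ℓ x ^ 2 ≤ logCutoff c a ℓ y ^ 2 := by gcongr
  have e : (dilationField c a ℓ x - dilationField c a ℓ y) / (x - y) =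
      ((logCutoff c a ℓ x ^ 2 : ℝ) : ℂ) -
        ((logCutoff c a ℓ y ^ 2 - logCutoff c a ℓ x ^ 2 : ℝ) : ℂ) * ((y - c) / (x - y)) := by
    simp only [dilationField, Complex.real_smul]
    push_cast
    field_simp
    ring
  rw [e, Complex.sub_re, Complex.re_ofReal_mul, Complex.ofReal_re]
  have h2 : -((y - c) / (x - y)).re ≤ ‖y - c‖ / ‖x - y‖ := by
    rw [← norm_div]; exact (neg_le_abs _).trans (Complex.abs_re_le_norm _)
  have h3 := mul_le_mul_of_nonneg_left h2 (sub_nonneg.2 hsq)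
  have h4 : ‖x - c‖ - ‖y - c‖ ≤ ‖x - y‖ := by
    have := norm_sub_norm_le (x - c) (y - c)
    rwa [sub_sub_sub_cancel_right] at this
  have h5 : (logCutoff c a ℓ y ^ 2 - logCutoff c a ℓ x ^ 2) * (‖y - c‖ / ‖x - y‖) ≤ 4 / ℓ := by
    rw [mul_div_assoc', div_le_iff₀ hpos, mul_comm]
    refine h1.trans ?_
    gcongr
  linarith

lemma re_dilationField_sub_div_le_min (hℓ : 0 < ℓ) (ha : 0 < a) (hne : x ≠ y) :
    ((dilationField c a ℓ x - dilationField c a ℓ y) / (x - y)).re ≤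
      min (logCutoff c a ℓ x ^ 2) (logCutoff c a ℓ y ^ 2) + 4 / ℓ := by
  rcases le_total ‖y - c‖ ‖x - c‖ with hxy | hxy
  · have hanti := logCutoff_anti (a := a) hℓ hxy
    have hx0 := logCutoff_nonneg c a ℓ x
    rw [min_eq_left (by gcongr)]
    exact re_dilationField_sub_div_le hℓ ha hne hxy
  · have hanti := logCutoff_anti (a := a) hℓ hxy
    have hx0 := logCutoff_nonneg c a ℓ y
    rw [min_eq_right (by gcongr)]
    have := re_dilationField_sub_div_le (c := c) hℓ ha hne.symm hxy
    rwa [← neg_sub (dilationField c a ℓ x), ← neg_sub x y, neg_div_neg_eq] at this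

lemma gradKernel_eq (hx : ‖x‖ < 1) (hy : ‖y‖ < 1) (hne : x ≠ y) :
    gradKernel x y = -(x - y)⁻¹ - conj y / (1 - x * conj y) := by
  have h1 : y - x ≠ 0 := sub_ne_zero.2 hne.symm
  have h1' : x - y ≠ 0 := sub_ne_zero.2 hne
  have h2 : 1 - x * conj y ≠ 0 := by
    intro h0
    have h3 : x * conj y = 1 := (sub_eq_zero.1 h0).symm
    have h4 := congrArg norm h3
    rw [norm_mul, Complex.norm_conj, norm_one] at h4
    nlinarith [norm_nonneg x, norm_nonneg y]
  have h3 : ((‖y‖ : ℂ)) ^ 2 = y * conj y := (Complex.mul_conj' y).symm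
  rw [gradKernel, h3]
  have h4 : y - x = -(x - y) := by ring
  rw [h4]
  generalize conj y = w at *
  have h5 : 1 - w * x ≠ 0 := by rwa [mul_comm]
  field_simp
  ring

lemma symKernel_dilationField_ge (hℓ : 0 < ℓ) (ha : 0 < a) (hR : 0 ≤ R)
    (hℓR : ℓ ≤ Real.log (1 + R ^ 2 / a ^ 2)) (hδ : 0 < 1 - ‖c‖) (hRδ : 2 * R ≤ 1 - ‖c‖)
    (hx : ‖x‖ < 1) (hy : ‖y‖ < 1) (hne : x ≠ y) :
    -(min (logCutoff c a ℓ x ^ 2) (logCutoff c a ℓ y ^ 2) +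
      (4 / ℓ + 4 * (R / (1 - ‖c‖)))) ≤ symKernel (dilationField c a ℓ) x y := by
  have hside : ∀ x y : ℂ, ‖x‖ < 1 → ‖y‖ < 1 →
      (dilationField c a ℓ x * (conj y / (1 - x * conj y))).re ≤ 2 * (R / (1 - ‖c‖)) := by
    intro x y hx hy
    by_cases hxR : R ≤ ‖x - c‖
    · rw [dilationField, logCutoff_eq_zero hℓ hR hℓR hxR]
      simp only [ne_eq, OfNat.ofNat_ne_zero, not_false_eq_true, zero_pow, zero_smul, zero_mul,
        Complex.zero_re]
      positivity
    · push Not at hxR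
      have h1 : (1 - ‖c‖) / 2 ≤ ‖1 - x * conj y‖ := by
        have h2 : ‖x‖ ≤ ‖x - c‖ + ‖c‖ := by
          simpa using norm_add_le (x - c) c
        have h3 := one_sub_norm_le_norm (x := conj x) (y := conj y)
          (by rw [Complex.norm_conj]; exact hy.le)
        rw [Complex.conj_conj, Complex.norm_conj] at h3
        linarith
      refine (Complex.re_le_norm _).trans ?_
      rw [norm_mul, norm_div, Complex.norm_conj]
      have h4 : ‖y‖ / ‖1 - x * conj y‖ ≤ 1 / ((1 - ‖c‖) / 2) := by
        gcongr
      calc _ ≤ R * (1 / ((1 - ‖c‖) / 2)) := by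
            gcongr
            exact norm_dilationField_le hℓ hR hℓR
        _ = _ := by field_simp
  have hP := re_dilationField_sub_div_le_min (c := c) hℓ ha hne
  have h1 := hside x y hx hy
  have h2 := hside y x hy hx
  have e : symKernel (dilationField c a ℓ) x y =
      -((dilationField c a ℓ x - dilationField c a ℓ y) / (x - y)).re -
      (dilationField c a ℓ x * (conj y / (1 - x * conj y))).re -
      (dilationField c a ℓ y * (conj x / (1 - y * conj x))).re := by
    rw [symKernel, gradKernel_eq hx hy hne, gradKernel_eq hy hx hne.symm, ← Complex.add_re,
      ← Complex.neg_re, ← Complex.sub_re, ← Complex.sub_re]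
    congr 1
    rw [← neg_sub x y, inv_neg]
    ring
  rw [e]
  linarith

end

namespace BoundedSol

variable {α b C A s : ℝ} {x₀ : ℂ} {V u : ℂ → ℝ}

lemma weightedDiv_dilationField (h : BoundedSol α x₀ b C A s V u) {c x : ℂ} {a ℓ R : ℝ}
    (ha : 0 < a) (hR : 0 < R) (hRδ : 2 * R ≤ 1 - ‖c‖) (hℓ : 4 ≤ ℓ)
    (hℓR : ℓ ≤ Real.log (1 + R ^ 2 / a ^ 2)) :
    (‖x - c‖ < R → 2 * logCutoff c a ℓ x ^ 2 - (4 / ℓ + 2 * (R / (1 - ‖c‖))) ≤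
        weightedDiv α x₀ (dilationField c a ℓ) x) ∧
      |weightedDiv α x₀ (dilationField c a ℓ) x| ≤ 4 ∧
      (R ≤ ‖x - c‖ → weightedDiv α x₀ (dilationField c a ℓ) x = 0) := by
  have hℓ0 : 0 < ℓ := by linarith
  have hδ : 0 < 1 - ‖c‖ := by linarith
  have hα := h.α_pos
  have hα' := h.α_lt
  obtain ⟨h1, h2, h3⟩ := divergence_dilationField (c := c) (x := x) hℓ0 ha
  have h4 : R ≤ ‖x - c‖ → weightedDiv α x₀ (dilationField c a ℓ) x = 0 := by
    intro hx
    have hψ := logCutoff_eq_zero hℓ0 hR.le hℓR hx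
    rw [weightedDiv, h3 hψ, dilationField, hψ]
    simp
  have hℓ4 : 4 / ℓ ≤ 1 := by rw [div_le_one hℓ0]; exact hℓ
  have hmain : ‖x - c‖ < R → |2 * α * ((dilationField c a ℓ x * conj (x - x₀)).re /
      ‖x - x₀‖ ^ 2)| ≤ 2 * (R / (1 - ‖c‖)) := by
    intro hx
    have k1 := h.one_sub_norm_le_dist c
    have k2 : ‖c - x₀‖ ≤ ‖x - c‖ + ‖x - x₀‖ := by
      have := norm_sub_le_norm_sub_add_norm_sub c x x₀
      rwa [norm_sub_rev c x] at this
    have k3 : (1 - ‖c‖) / 2 ≤ ‖x - x₀‖ := by linarith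
    have k4 : 0 < ‖x - x₀‖ := by linarith
    have k5 := abs_re_mul_conj_div_le (norm_dilationField_le (c := c) (x := x) hℓ0 hR.le hℓR) k4
    rw [abs_mul, abs_of_nonneg (by positivity : 0 ≤ 2 * α)]
    calc _ ≤ 1 * (R / ((1 - ‖c‖) / 2)) := by
          gcongr
          · linarith
          · refine k5.trans ?_
            gcongr
      _ = _ := by field_simp
  have hq : R / (1 - ‖c‖) ≤ 1 / 2 := by
    rw [div_le_div_iff₀ hδ two_pos]; linarith
  refine ⟨fun hx => ?_, ?_, h4⟩
  · have := (abs_le.1 (hmain hx)).2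
    rw [weightedDiv]; linarith
  · rcases lt_or_ge ‖x - c‖ R with hx | hx
    · rw [weightedDiv]
      refine (abs_sub _ _).trans ?_
      linarith [hmain hx]
    · rw [h4 hx]; norm_num

end BoundedSol

set_option maxHeartbeats 1000000 in
/-- A Pohozaev-type quantization of the mass concentrating near an interior point. -/
lemma exists_quantization (α b C A s : ℝ) : ∃ T : ℝ, ∀ {x₀ : ℂ} {V u : ℂ → ℝ},
    BoundedSol α x₀ b C A s V u → ∀ {r R : ℝ} {c : ℂ}, ScaledAt α x₀ u r c →
    concConst α b C * r ≤ 1 - ‖c‖ → 0 < R → R ≤ 1 → 2 * R ≤ 1 - ‖c‖ →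
    4 ≤ Real.log (1 + R ^ 2 / (concConst α b C * r) ^ 2) →
    ∃ J : ℝ, 1 / 2 ≤ J ∧
      (2 - (∫ y in ball c R, dens α x₀ V u y) / (4 * Real.pi)) * J ≤
        T * ((Real.log (1 + R ^ 2 / (concConst α b C * r) ^ 2))⁻¹ + R / (1 - ‖c‖) + R +
          (R + r) * r ^ (s - 1)) := by
  obtain ⟨κ, hκ, hpoh⟩ := exists_pohozaev
  refine ⟨320 * Real.pi + 4 * b * Real.pi + κ * A * C * (gradConst α b + 4), ?_⟩
  intro x₀ V u h r R c hr hK hR hR1 hRδ hℓ4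
  have hpi := Real.pi_pos
  have hr0 := hr.r_pos
  have hK1 := h.concConst_ge
  have hb := h.b_pos
  have hA := h.A_pos
  have hC := h.exp_mass_nonneg
  have hΛ := gradConst_ge h.α_lt h.b_pos
  set a := concConst α b C * r with hadef
  have ha : 0 < a := by positivity
  set ℓ := Real.log (1 + R ^ 2 / a ^ 2) with hℓdef
  have hℓ0 : 0 < ℓ := by linarith
  have hδ : 0 < 1 - ‖c‖ := by linarith
  set f := dens α x₀ V u with hf
  set φ : ℂ → ℝ := fun x => logCutoff c a ℓ x ^ 2 with hφ
  set χ : ℂ → ℝ := (ball c R).indicator 1 with hχ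
  set X := dilationField c a ℓ with hX
  set e := 4 / ℓ + 2 * (R / (1 - ‖c‖)) with he
  have he0 : 0 ≤ e := by positivity
  set E := 4 / ℓ + 4 * (R / (1 - ‖c‖)) with hE
  have hfi : IntegrableOn f (ball 0 1) := h.integrableOn_dens
  have hφ0 : ∀ x, 0 ≤ φ x := fun x => sq_nonneg _
  have hφ1 : ∀ x, φ x ≤ 1 := fun x =>
    pow_le_one₀ (logCutoff_nonneg c a ℓ x) (logCutoff_le_one hℓ0 c a x)
  have hφc : Continuous φ := (contDiff_logCutoff_sq c a ℓ).continuous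
  have hχ0 : ∀ x, 0 ≤ χ x := fun x => indicator_nonneg (fun _ _ => zero_le_one) x
  have hφi : IntegrableOn (fun x => f x * φ x) (ball 0 1) :=
    hfi.mul_bdd (c := 1) hφc.aestronglyMeasurable
      (Eventually.of_forall fun x => by rw [Real.norm_of_nonneg (hφ0 x)]; exact hφ1 x)
  have hfχ : (fun x => f x * χ x) = (ball c R).indicator f := by
    funext x
    by_cases hx : x ∈ ball c R <;> simp [hχ, hx]
  have hsubR : ball c R ⊆ ball (0 : ℂ) 1 := BoundedSol.ball_subset_of_le (by linarith)
  have hχi : IntegrableOn (fun x => f x * χ x) (ball 0 1) := by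
    rw [hfχ]; exact hfi.indicator measurableSet_ball
  have hχint : ∫ x in ball (0 : ℂ) 1, f x * χ x = ∫ x in ball c R, f x := by
    rw [hfχ, setIntegral_indicator measurableSet_ball, inter_eq_right.2 hsubR]
  have hvir := h.virial_ge (X := X) (Ξ := R) (E := E) (φ := φ) (χ := χ)
    (contDiff_dilationField c a ℓ).continuous.continuousOn
    (fun x _ => norm_dilationField_le hℓ0 hR.le le_rfl) (fun x _ => hφ0 x) (fun x _ => hχ0 x)
    (by positivity) hφi hχi (fun x hx y hy hne => by
      refine le_trans ?_ (symKernel_dilationField_ge hℓ0 ha hR.le le_rfl hδ hRδ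
        (mem_ball_zero_iff.1 hx) (mem_ball_zero_iff.1 hy) hne)
      have : min (φ x) (φ y) ≤ φ x * χ y := by
        by_cases hyR : y ∈ ball c R
        · rw [hχ, indicator_of_mem hyR]; simp
        · have : φ y = 0 := by
            rw [mem_ball, dist_eq_norm, not_lt] at hyR
            rw [hφ]
            simp only [logCutoff_eq_zero hℓ0 hR.le le_rfl hyR]
            norm_num
          rw [this]
          exact (min_le_right _ _).trans (mul_nonneg (hφ0 x) (hχ0 y))
      linarith)
  obtain ⟨hI, hP⟩ := hpoh h hr (X := X) (Ξ := R) (N := 4 * r)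
    (contDiff_dilationField c a ℓ).contDiffOn hR.le (by positivity)
    (fun x _ => norm_dilationField_le hℓ0 hR.le le_rfl) (fun x hx => by
      have h1 := (h.weightedDiv_dilationField (x := x) ha hR hRδ hℓ4 le_rfl).2.1
      have h2 := h.exp_sub_one_nonneg hx
      rw [mul_div_cancel_right₀ _ hr0.ne']
      calc _ ≤ (Real.exp (u x) - 1) * 4 := by gcongr
        _ ≤ _ := by linarith)
  set J := ∫ x in ball (0 : ℂ) 1, f x * φ x with hJ
  set M := ∫ x in ball (0 : ℂ) 1, f x with hM
  set m := ∫ x in ball c R, f x with hm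
  rw [hχint] at hvir
  have hM16 : M ≤ 16 * Real.pi := h.mass
  have hM0 : 0 ≤ M := setIntegral_nonneg measurableSet_ball fun x hx => h.dens_nonneg hx
  have hχi' : IntegrableOn χ (ball (0 : ℂ) 1) :=
    (integrableOn_const (by simp) (by simp)).indicator measurableSet_ball
  have hχm : ∫ x in ball (0 : ℂ) 1, χ x = Real.pi * R ^ 2 := by
    rw [hχ, setIntegral_indicator measurableSet_ball, inter_eq_right.2 hsubR]
    simp [Measure.real, Complex.volume_ball, hR.le]
    ring
  have hlow : ∫ x in ball (0 : ℂ) 1, ((2 * (f x * φ x) - e * f x) - 4 * b * R⁻¹ * χ x) ≤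
      ∫ x in ball (0 : ℂ) 1, (Real.exp (u x) - 1) * V x * ‖x - x₀‖ ^ (-(2 * α)) *
        weightedDiv α x₀ X x := by
    refine setIntegral_mono_on (((hφi.const_mul 2).sub (hfi.const_mul e)).sub
      (hχi'.const_mul (4 * b * R⁻¹))) hI measurableSet_ball fun x hx => ?_
    obtain ⟨d1, d2, d3⟩ := h.weightedDiv_dilationField (x := x) ha hR hRδ hℓ4 le_rfl
    have hf0 : 0 ≤ f x := h.dens_nonneg hx
    by_cases hxR : ‖x - c‖ < R
    · have hχx : χ x = 1 := by
        rw [hχ, indicator_of_mem (by rwa [mem_ball, dist_eq_norm])]; rfl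
      have hV0 := h.V_nonneg x (ball_subset_closedBall hx)
      have hV1 := h.V_le x (ball_subset_closedBall hx)
      have k1 := h.one_sub_norm_le_dist c
      have k2 : ‖c - x₀‖ ≤ ‖x - c‖ + ‖x - x₀‖ := by
        have := norm_sub_le_norm_sub_add_norm_sub c x x₀
        rwa [norm_sub_rev c x] at this
      have k3 : R ≤ ‖x - x₀‖ := by linarith
      have k4 : ‖x - x₀‖ ^ (-(2 * α)) ≤ R⁻¹ := by
        calc _ ≤ R ^ (-(2 * α)) :=
              Real.rpow_le_rpow_of_nonpos hR k3 (by linarith [h.α_pos])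
          _ ≤ R ^ (-1 : ℝ) :=
              Real.rpow_le_rpow_of_exponent_ge hR hR1 (by linarith [h.α_lt])
          _ = _ := Real.rpow_neg_one R
      have k5 : f x * (2 * φ x - e) ≤ f x * weightedDiv α x₀ X x :=
        mul_le_mul_of_nonneg_left (d1 hxR) hf0
      have k6 : V x * ‖x - x₀‖ ^ (-(2 * α)) * weightedDiv α x₀ X x ≤ b * R⁻¹ * 4 := by
        have : weightedDiv α x₀ X x ≤ 4 := (le_abs_self _).trans d2
        calc _ ≤ V x * ‖x - x₀‖ ^ (-(2 * α)) * 4 := by gcongr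
          _ ≤ _ := by gcongr
      have k7 : (Real.exp (u x) - 1) * V x * ‖x - x₀‖ ^ (-(2 * α)) * weightedDiv α x₀ X x =
          f x * weightedDiv α x₀ X x - V x * ‖x - x₀‖ ^ (-(2 * α)) * weightedDiv α x₀ X x := by
        rw [hf, dens]; ring
      rw [hχx, k7]
      linarith
    · rw [not_lt] at hxR
      have hφx : φ x = 0 := by
        rw [hφ]
        simp only [logCutoff_eq_zero hℓ0 hR.le le_rfl hxR]
        norm_num
      rw [d3 hxR, hφx]
      have : 0 ≤ 4 * b * R⁻¹ * χ x := mul_nonneg (by positivity) (hχ0 x)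
      have : 0 ≤ e * f x := by positivity
      linarith
  have es := integral_sub ((hφi.const_mul 2).sub (hfi.const_mul e)) (hχi'.const_mul (4 * b * R⁻¹))
  have es2 := integral_sub (hφi.const_mul 2) (hfi.const_mul e)
  simp only [Pi.sub_apply] at es es2
  rw [es, es2, integral_const_mul, integral_const_mul, integral_const_mul, hχm, ← hJ, ← hM] at hlow
  have hJhalf : 1 / 2 ≤ J := by
    have hsub : ball c a ⊆ ball (0 : ℂ) 1 := BoundedSol.ball_subset_of_le hK
    have h1 : 1 ≤ ∫ y in ball c a, f y := h.one_le_local_mass hr hK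
    have h2 : ∫ y in ball c a, f y ≤ ∫ y in ball c a, 2 * (f y * φ y) := by
      refine setIntegral_mono_on (hfi.mono_set hsub) ((hφi.mono_set hsub).const_mul 2)
        measurableSet_ball fun y hy => ?_
      have h3 := h.dens_nonneg (hsub hy)
      rw [mem_ball, dist_eq_norm] at hy
      have h4 : 1 / 2 ≤ φ y := half_le_logCutoff_sq hℓ4 hy.le ha
      have h5 := mul_le_mul_of_nonneg_left h4 h3
      linarith
    have h3 : ∫ y in ball c a, f y * φ y ≤ J := by
      refine setIntegral_mono_set hφi ?_ hsub.eventuallyLE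
      exact (ae_restrict_iff' measurableSet_ball).2 (Eventually.of_forall fun y hy =>
        mul_nonneg (h.dens_nonneg hy) (hφ0 y))
    rw [integral_const_mul] at h2
    linarith
  refine ⟨J, hJhalf, ?_⟩
  set I := ∫ x in ball (0 : ℂ) 1, f x * fderiv ℝ u x (X x) with hIdef
  have hρ : 0 < r ^ (s - 1) := by positivity
  have q1 : -I ≤ m / (4 * Real.pi) * J + 64 * Real.pi * E := by
    have hE0 : 0 ≤ E := by positivity
    have hMsq : E * M ^ 2 ≤ E * (16 * Real.pi) ^ 2 := by gcongr
    have : -(J * m) - E * (16 * Real.pi) ^ 2 ≤ 4 * Real.pi * I := by linarith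
    have e2 : m / (4 * Real.pi) * J + 64 * Real.pi * E =
      (J * m + E * (16 * Real.pi) ^ 2) / (4 * Real.pi) := by field_simp; ring
    rw [e2, le_div_iff₀ (by positivity)]
    linarith
  have q2 : e * M ≤ e * (16 * Real.pi) := by gcongr
  have q3 : 4 * b * R⁻¹ * (Real.pi * R ^ 2) = 4 * b * Real.pi * R := by field_simp
  have q4 : κ * A * C * (R * gradConst α b + R + 4 * r) * r ^ (s - 1) ≤
      κ * A * C * (gradConst α b + 4) * ((R + r) * r ^ (s - 1)) := by
    have : R * gradConst α b + R + 4 * r ≤ (gradConst α b + 4) * (R + r) := by nlinarith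
    calc _ ≤ κ * A * C * ((gradConst α b + 4) * (R + r)) * r ^ (s - 1) := by gcongr
      _ = _ := by ring
  have q5 : e * (16 * Real.pi) + 64 * Real.pi * E ≤
      320 * Real.pi * (ℓ⁻¹ + R / (1 - ‖c‖)) := by
    have t : 0 ≤ Real.pi * (R / (1 - ‖c‖)) := by positivity
    rw [he, hE, div_eq_mul_inv 4 ℓ]
    linarith
  rw [q3] at hlow
  set B := κ * A * C * (gradConst α b + 4)
  have hB : 0 ≤ B := by positivity
  have p1 : 0 ≤ ℓ⁻¹ := by positivity
  have p2 : 0 ≤ R / (1 - ‖c‖) := by positivity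
  have p3 : 0 ≤ (R + r) * r ^ (s - 1) := by positivity
  have n1 : 0 ≤ 320 * Real.pi * (R + (R + r) * r ^ (s - 1)) := by positivity
  have n2 : 0 ≤ 4 * b * Real.pi * (ℓ⁻¹ + R / (1 - ‖c‖) + (R + r) * r ^ (s - 1)) := by positivity
  have n3 : 0 ≤ B * (ℓ⁻¹ + R / (1 - ‖c‖) + R) := by positivity
  linarith

lemma tendsto_rpow_nhdsGT_zero {p : ℝ} (hp : 0 < p) :
    Tendsto (fun r : ℝ => r ^ p) (𝓝[>] 0) (𝓝 0) := by
  have := (Real.continuousAt_rpow_const 0 p (Or.inr hp.le)).tendsto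
  rw [Real.zero_rpow hp.ne'] at this
  exact this.mono_left nhdsWithin_le_nhds

lemma tendsto_log_inv_nhdsGT_zero : Tendsto (fun r : ℝ => Real.log r⁻¹) (𝓝[>] 0) atTop :=
  Real.tendsto_log_atTop.comp tendsto_inv_nhdsGT_zero

lemma tendsto_log_one_add_rpow_div {K θ : ℝ} (hK : 0 < K) (hθ : θ < 1) :
    Tendsto (fun r : ℝ => Real.log (1 + (r ^ θ) ^ 2 / (K * r) ^ 2)) (𝓝[>] 0) atTop := by
  refine Real.tendsto_log_atTop.comp (tendsto_atTop_add_const_left _ _ ?_)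
  have h1 : Tendsto (fun r : ℝ => (K ^ 2)⁻¹ * (r⁻¹) ^ (2 - 2 * θ)) (𝓝[>] 0) atTop :=
    ((tendsto_rpow_atTop (by linarith)).comp tendsto_inv_nhdsGT_zero).const_mul_atTop (by positivity)
  refine h1.congr' ?_
  filter_upwards [self_mem_nhdsWithin] with r (hr : 0 < r)
  rw [Real.inv_rpow hr.le, ← Real.rpow_neg hr.le, neg_sub, Real.rpow_sub hr, mul_comm 2 θ,
    Real.rpow_mul hr.le, Real.rpow_two, Real.rpow_two]
  field_simp

/-- Concentration cannot occur at arbitrarily small scales. -/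
lemma exists_scale_lower_bound {α b C A s : ℝ} (hK : 0 < concConst α b C) (hs : 1 / 2 < s)
    (hs1 : s ≤ 1) : ∃ R : ℝ, 0 < R ∧ ∀ {x₀ : ℂ} {V u : ℂ → ℝ},
    BoundedSol α x₀ b C A s V u → ∀ {r : ℝ} {c : ℂ}, ScaledAt α x₀ u r c → R ≤ r := by
  obtain ⟨Q, hQ, hdist⟩ := exists_boundary_distance α b C A s
  obtain ⟨T, hT⟩ := exists_quantization α b C A s
  obtain ⟨θ, hθ⟩ : ∃ θ, θ = 5 / 4 - s / 2 := ⟨_, rfl⟩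
  obtain ⟨σ, hσ⟩ : ∃ σ, σ = 1 / 4 + s / 2 := ⟨_, rfl⟩
  obtain ⟨k, hk⟩ : ∃ k, k = (2 * σ - 1) / (4 * σ) := ⟨_, rfl⟩
  have hσ0 : 0 < σ := by linarith
  have hθ0 : 0 < θ := by linarith
  have hk0 : 0 < k := by rw [hk]; exact div_pos (by linarith) (by linarith)
  have hkσ : (2 - 2 * k) * σ = σ + 1 / 2 := by rw [hk]; field_simp; ring
  have hℓ := tendsto_log_one_add_rpow_div (θ := θ) hK (by linarith)
  have hlog := tendsto_log_inv_nhdsGT_zero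
  have e1 := hlog.eventually_ge_atTop (concConst α b C * gradConst α b)
  have e2 : ∀ᶠ r : ℝ in 𝓝[>] 0, r ^ σ < Q / 2 :=
    (tendsto_rpow_nhdsGT_zero hσ0).eventually_lt_const (by positivity)
  have e3 := hℓ.eventually_ge_atTop 4
  have e4 : ∀ᶠ r : ℝ in 𝓝[>] 0, 0 < σ * Real.log r⁻¹ + Real.log Q :=
    (tendsto_atTop_add_const_right _ _ (hlog.const_mul_atTop hσ0)).eventually_gt_atTop 0
  have e5 : ∀ᶠ r : ℝ in 𝓝[>] 0, Real.log 2 - (2 - 2 * k) * Real.log Q ≤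
      (σ - 1 / 2) * Real.log r⁻¹ :=
    (hlog.const_mul_atTop (by linarith)).eventually_ge_atTop _
  have e6 : ∀ᶠ r : ℝ in 𝓝[>] 0, |T| * ((Real.log (1 + (r ^ θ) ^ 2 / (concConst α b C * r) ^ 2))⁻¹ +
      r ^ σ / Q + r ^ θ + (r ^ σ + r ^ s)) < k := by
    refine Tendsto.eventually_lt_const (v := 0) hk0 ?_
    have h1 := tendsto_rpow_nhdsGT_zero hσ0
    have := (((hℓ.inv_tendsto_atTop.add (h1.div_const Q)).add (tendsto_rpow_nhdsGT_zero hθ0)).add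
      (h1.add (tendsto_rpow_nhdsGT_zero (p := s) (by linarith)))).const_mul |T|
    simpa using this
  obtain ⟨R, hR, hall⟩ := (nhdsGT_basis (0 : ℝ)).eventually_iff.1
    (e1.and (e2.and (e3.and (e4.and (e5.and e6)))))
  refine ⟨R, hR, ?_⟩
  intro x₀ V u h r c hr
  by_contra! hlt
  have hr0 := hr.r_pos
  obtain ⟨e1, e2, e3, e4, e5, e6⟩ := hall ⟨hr0, hlt⟩
  have hΛ := gradConst_ge h.α_lt h.b_pos
  have hpi := Real.pi_pos
  have hlog0 : 0 ≤ Real.log r⁻¹ := Real.log_nonneg ((one_le_inv₀ hr0).2 hr.r_lt.le)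
  have hKr : concConst α b C * r ≤ 1 - ‖c‖ := by
    have h1 := h.le_gradConst_mul hr hr.mem
    have h2 := hr.exp_ge'
    have h3 : concConst α b C * gradConst α b ≤ gradConst α b / r * (1 - ‖c‖) := by
      nlinarith [h.α_lt]
    rw [div_mul_eq_mul_div, le_div_iff₀ hr0] at h3
    have h4 : gradConst α b * (concConst α b C * r) ≤ gradConst α b * (1 - ‖c‖) := by linarith
    exact le_of_mul_le_mul_left h4 (by linarith)
  have hδQ := hdist h hr hKr
  have hδ : 0 < 1 - ‖c‖ := lt_of_lt_of_le (by positivity) hKr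
  have hrs : 0 < r ^ (1 - s) := by positivity
  have hsplit : r ^ θ = r ^ σ * r ^ (1 - s) := by
    rw [← Real.rpow_add hr0]; congr 1; rw [hθ, hσ]; ring
  have hRδ : 2 * r ^ θ ≤ 1 - ‖c‖ := by
    rw [hsplit]; nlinarith
  have hR0 : 0 < r ^ θ := by positivity
  have hRQ : r ^ θ / (1 - ‖c‖) ≤ r ^ σ / Q := by
    rw [div_le_div_iff₀ hδ hQ, hsplit]
    have := mul_le_mul_of_nonneg_left hδQ (show 0 ≤ r ^ σ by positivity)
    linarith
  obtain ⟨J, hJ, hq⟩ := hT h hr hKr hR0 (Real.rpow_le_one hr0.le hr.r_lt.le hθ0.le) hRδ e3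
  have hmlog := h.local_mass_mul_log_le hr.mem hR0 (by linarith)
  set m := ∫ y in ball c (r ^ θ), dens α x₀ V u y with hm
  have hm0 : 0 ≤ m := setIntegral_nonneg measurableSet_ball fun y hy =>
    h.dens_nonneg (BoundedSol.ball_subset_of_le (by linarith) hy)
  set L := σ * Real.log r⁻¹ + Real.log Q with hL
  have hLle : L ≤ Real.log ((1 - ‖c‖) / r ^ θ) := by
    have h1 : Q / r ^ σ ≤ (1 - ‖c‖) / r ^ θ := by
      rw [div_le_div_iff₀ (by positivity) hR0]
      rw [div_le_div_iff₀ hδ hQ] at hRQ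
      linarith
    refine le_trans (le_of_eq ?_) (Real.log_le_log (by positivity) h1)
    rw [Real.log_div hQ.ne' (by positivity), Real.log_rpow hr0, hL, Real.log_inv]
    ring
  have huc : u c ≤ 2 * (Real.log 2 + Real.log r⁻¹) := by
    have h1 := (Real.le_log_iff_exp_le (by positivity)).2 (hr.exp_le c hr.mem)
    refine h1.trans (le_of_eq ?_)
    rw [show 4 * (r ^ 2)⁻¹ = (2 * r⁻¹) ^ 2 by ring, Real.log_pow,
      Real.log_mul two_ne_zero (by positivity)]
    norm_num
  have hm4 : m / (4 * Real.pi) ≤ 2 - 2 * k := by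
    rw [div_le_iff₀ (by positivity)]
    refine le_of_mul_le_mul_right ?_ e4
    have h1 : m * L ≤ m * Real.log ((1 - ‖c‖) / r ^ θ) := by gcongr
    have h2 : Real.log 2 + Real.log r⁻¹ ≤ (2 - 2 * k) * L := by
      have : (2 - 2 * k) * L = (2 - 2 * k) * σ * Real.log r⁻¹ + (2 - 2 * k) * Real.log Q := by
        rw [hL]; ring
      rw [this, hkσ]
      linarith
    calc m * L ≤ 2 * Real.pi * u c := h1.trans hmlog
      _ ≤ 2 * Real.pi * (2 * ((2 - 2 * k) * L)) := by gcongr; linarith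
      _ = _ := by ring
  have hkJ : k ≤ (2 - m / (4 * Real.pi)) * J := by nlinarith
  have hrs' : (r ^ θ + r) * r ^ (s - 1) = r ^ σ + r ^ s := by
    rw [add_mul, ← Real.rpow_add hr0]
    congr 1
    · congr 1; rw [hθ, hσ]; ring
    · rw [← Real.rpow_one_add' hr0.le (by linarith)]; congr 1; ring
  rw [hrs'] at hq
  refine absurd (hkJ.trans hq) (not_le.2 (lt_of_le_of_lt ?_ e6))
  set ℓ := Real.log (1 + (r ^ θ) ^ 2 / (concConst α b C * r) ^ 2)
  have hℓ0 : 0 < ℓ := by linarith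
  have hpos : 0 ≤ ℓ⁻¹ + r ^ θ / (1 - ‖c‖) + r ^ θ + (r ^ σ + r ^ s) := by positivity
  calc _ ≤ |T| * (ℓ⁻¹ + r ^ θ / (1 - ‖c‖) + r ^ θ + (r ^ σ + r ^ s)) :=
        mul_le_mul_of_nonneg_right (le_abs_self T) hpos
    _ ≤ _ := by gcongr

/-- Uniform a priori bound for solutions of the singular boundary problem with
s-Hölder coefficient, `1/2 < s ≤ 1`, under the mass bound `16π - ε`. -/
theorem uniform_estimate
    (α : ℝ) (hα : α ∈ Set.Ioo (0:ℝ) (1/2)) (x₀ : ℂ) (hx₀ : ‖x₀‖ = 1)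
    (b C A s ε : ℝ) (hb : 0 < b) (hC : 0 < C) (hA : 0 < A)
    (hs : s ∈ Set.Ioc (1/2 : ℝ) 1) (hε : 0 < ε) :
    ∃ c : ℝ, ∀ u V : ℂ → ℝ,
      (∀ y ∈ closedBall (0:ℂ) 1, 0 ≤ V y ∧ V y ≤ b) →
      (∀ y ∈ closedBall (0:ℂ) 1, ∀ z ∈ closedBall (0:ℂ) 1, |V y - V z| ≤ A * ‖y - z‖ ^ s) →
      IsSol α x₀ V u →
      (∫ y in ball (0:ℂ) 1, ‖y - x₀‖ ^ (-(2*α)) * Real.exp (u y)) ≤ C →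
      (∫ y in ball (0:ℂ) 1, ‖y - x₀‖ ^ (-(2*α)) * V y * Real.exp (u y)) ≤ 16 * Real.pi - ε →
      ∀ y ∈ ball (0:ℂ) 1, u y ≤ c := by
  have hK : 0 < concConst α b C := by
    have := harnackConst_pos α b
    rw [concConst]; positivity
  obtain ⟨R, hR, hscale⟩ := exists_scale_lower_bound (A := A) hK hs.1 hs.2
  refine ⟨Real.log (4 * (min R 1 ^ 2)⁻¹), fun u V hV hH hu hmass hmass' y hy => ?_⟩
  obtain ⟨hu2, hu1, hlap, hbd⟩ := hu
  have h : BoundedSol α x₀ b C A s V u :=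
    { α_pos := hα.1
      α_lt := hα.2
      norm_x₀ := hx₀
      b_pos := hb
      A_pos := hA
      s_gt := hs.1
      s_le := hs.2
      V_nonneg := fun y hy => (hV y hy).1
      V_le := fun y hy => (hV y hy).2
      holder := hH
      contDiffAt := fun z hz => hu2.contDiffAt (isOpen_ball.mem_nhds hz)
      continuousOn := hu1.continuousOn
      boundary := hbd
      exists_bound := exists_gradient_bound hu1 hbd
      lap_eq := fun z hz => by rw [dens, ← hlap z hz, neg_neg]
      exp_mass := hmass
      mass := hmass'.trans (by linarith) }
  have hm : 0 < min R 1 := lt_min hR one_pos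
  rcases h.exists_scale hm (min_le_right _ _) with h1 | ⟨r, c, hlt, hr⟩
  · exact (Real.le_log_iff_exp_le (by positivity)).2 (h1 y hy)
  · exact absurd (hscale h hr) (not_le.2 (hlt.trans_le (min_le_left _ _)))
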